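/- arXiv:1905.02629 — 17 statements merged into one kernel-verified Lean document; each statement's English description precedes it below -/
import Mathlib

section
/- Let T_1, T_2, ... be nonnegative reals with L = limsup_{j→∞} T_j^{1/j}, and suppose w_0 ∈ (0, 1/2] satisfies L·w_0 < 1 and t̂(w_0) = 0. Then w_0 is the unique zero of t̂ of minimal modulus inside the disk of convergence: every complex number w with |w| < 1/L, t̂(w) = 0 and w ≠ w_0 satisfies |w| > w_0. -/
open Filter
open scoped ENNReal Topology

/-- The unique real zero `w₀ ∈ (0, 1/2]` of the Tokunaga generating function
`t̂(z) = -1 + 2z + ∑_{j≥1} T_j z^j` is the zero of minimal modulus in the disk of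
convergence `|z| < 1/L`, where `L = limsup T_j^{1/j}`. -/
theorem stmt0 (T : ℕ → ℝ) (hT : ∀ j, 0 ≤ T j)
    (L : ℝ≥0∞)
    (hL : L = Filter.limsup (fun j : ℕ => ENNReal.ofReal (T j ^ ((j : ℝ)⁻¹))) Filter.atTop)
    (w₀ : ℝ) (hw₀ : 0 < w₀) (hw₀' : w₀ ≤ 1 / 2)
    (hconv : L * ENNReal.ofReal w₀ < 1)
    (hroot : -1 + 2 * w₀ + ∑' j : ℕ, T (j + 1) * w₀ ^ (j + 1) = 0) :
    ∀ w : ℂ, L * ENNReal.ofReal ‖w‖ < 1 →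
      -1 + 2 * w + ∑' j : ℕ, (T (j + 1) : ℂ) * w ^ (j + 1) = 0 →
      w ≠ (w₀ : ℂ) → w₀ < ‖w‖ := by
  intro w _ hw hne
  have hsum : Summable (fun j : ℕ => T (j + 1) * w₀ ^ (j + 1)) := by
    have hpos : ENNReal.ofReal w₀ ≠ 0 := by simpa using hw₀
    have h1 : L < (ENNReal.ofReal w₀)⁻¹ := by
      rw [← one_div, ENNReal.lt_div_iff_mul_lt (Or.inl hpos) (Or.inl ENNReal.ofReal_ne_top)]
      exact hconv
    obtain ⟨r, hr1, hr2⟩ := ENNReal.lt_iff_exists_nnreal_btwn.1 h1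
    have hr3 : (r : ℝ) * w₀ < 1 := by
      rw [← one_div, ENNReal.lt_div_iff_mul_lt (Or.inl hpos) (Or.inl ENNReal.ofReal_ne_top),
        ← ENNReal.ofReal_coe_nnreal, ← ENNReal.ofReal_mul r.coe_nonneg,
        ENNReal.ofReal_lt_one] at hr2
      exact hr2
    rw [hL] at hr1
    have hev := Filter.eventually_lt_of_limsup_lt hr1
    have hs : Summable (fun j : ℕ => T j * w₀ ^ j) := by
      refine Summable.of_norm_bounded_eventually_nat
        (summable_geometric_of_lt_one (by positivity) hr3) ?_
      filter_upwards [hev, Filter.eventually_gt_atTop 0] with j hj hj0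
      have h2 : T j ^ ((j : ℝ)⁻¹) ≤ r := by
        rw [← ENNReal.ofReal_coe_nnreal] at hj
        exact (ENNReal.ofReal_lt_ofReal_iff'.1 hj).1.le
      have h3 : T j ≤ (r : ℝ) ^ j := by
        calc T j = (T j ^ ((j : ℝ)⁻¹)) ^ j := (Real.rpow_inv_natCast_pow (hT j) hj0.ne').symm
          _ ≤ _ := pow_le_pow_left₀ (Real.rpow_nonneg (hT j) _) h2 j
      rw [Real.norm_of_nonneg (mul_nonneg (hT j) (by positivity)), mul_pow]
      gcongr
    exact (summable_nat_add_iff 1).2 hs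
  by_contra! hle
  have hb : ‖∑' j : ℕ, (T (j + 1) : ℂ) * w ^ (j + 1)‖ ≤ ∑' j : ℕ, T (j + 1) * w₀ ^ (j + 1) := by
    refine tsum_of_norm_bounded hsum.hasSum fun j => ?_
    rw [norm_mul, norm_pow, Complex.norm_real, Real.norm_of_nonneg (hT _)]
    exact mul_le_mul_of_nonneg_left (pow_le_pow_left₀ (norm_nonneg _) hle _) (hT _)
  have hre := congrArg Complex.re hw
  have h4 := Complex.re_le_norm (∑' j : ℕ, (T (j + 1) : ℂ) * w ^ (j + 1))
  generalize (∑' j : ℕ, (T (j + 1) : ℂ) * w ^ (j + 1)) = S at *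
  simp at hre
  have h5 : w₀ ≤ w.re := by linarith
  have h6 : w.re ^ 2 + w.im ^ 2 ≤ w₀ ^ 2 := by
    have := pow_le_pow_left₀ (norm_nonneg _) hle 2
    rw [Complex.sq_norm, Complex.normSq_apply] at this
    linarith
  have h7 : w.im = 0 := by
    have : w.im ^ 2 ≤ 0 := by nlinarith
    exact pow_eq_zero_iff (two_ne_zero) |>.1 (le_antisymm this (sq_nonneg _))
  apply hne
  apply Complex.ext
  · simpa using le_antisymm ((Complex.re_le_norm w).trans hle) h5
  · simpa using h7
end

section
/- Let T_1, T_2, ... be nonnegative reals and let N_K be the mean branch counts defined by the Horton counting recursion. Suppose there exists w_0 ∈ (0, 1/2] with limsup_{j→∞} T_j^{1/j} < 1/w_0 and t̂(w_0) = -1 + 2·w_0 + sum_{j=1}^∞ T_j·w_0^j = 0. Then there exists a constant A > 0 such that N_K·w_0^K → A as K → ∞; consequently N_{K+1}/N_K → R := 1/w_0 as K → ∞, and for every fixed k ≥ 1, N_{K-k+1}/N_K → R^{1-k} as K → ∞ (the strong Horton law for mean branch numbers, with Horton exponent R = 1/w_0). -/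
open Filter
open scoped ENNReal Topology

lemma renewal_aux (q r u : ℕ → ℝ) (hq : ∀ j, 0 ≤ q j) (hq0 : 0 < q 0) (hqs : HasSum q 1)
    (hr : ∀ j, 0 ≤ r j) (hrs : Summable r) (B a : ℝ) (hu : ∀ K, |u K| ≤ B)
    (h1 : ∀ᶠ K in atTop, u K = ∑' j, q j * u (K - (j + 1)))
    (h2 : ∀ᶠ K in atTop, ∑' j, r j * u (K - j) = a) (M : ℝ)
    (hM : IsGreatest {x | MapClusterPt x atTop u} M) : M * ∑' j, r j = a := by
  obtain ⟨hM1, hM2⟩ := hM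
  obtain ⟨F, hF, hFM⟩ := mapClusterPt_iff_ultrafilter.1 hM1
  have hsub : ∀ m : ℕ, Tendsto (fun K : ℕ => K - m) F atTop := fun m =>
    (tendsto_sub_atTop_nat m).mono_left hF
  have hL : ∀ m : ℕ, ∃ x, Tendsto (fun K => u (K - m)) F (𝓝 x) := by
    intro m
    have hc : IsCompact (Set.Icc (-B) B) := isCompact_Icc
    obtain ⟨x, -, hx⟩ := hc.ultrafilter_le_nhds (F.map (fun K => u (K - m)))
      (by
        rw [le_principal_iff]
        exact Filter.mem_map.2 (Filter.univ_mem' fun K => abs_le.1 (hu _)))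
    exact ⟨x, hx⟩
  choose L hL using hL
  have hLM : ∀ m, L m ≤ M := by
    intro m
    apply hM2
    have : MapClusterPt (L m) (F : Filter ℕ) (u ∘ fun K => K - m) := (hL m).mapClusterPt
    exact this.of_comp (hsub m)
  have hL0 : L 0 = M := tendsto_nhds_unique (hL 0) hFM
  have hdom : ∀ (p : ℕ → ℝ) (hp : ∀ j, 0 ≤ p j) (hps : Summable p) (g : ℕ → ℕ),
      Tendsto (fun K => ∑' j, p j * u (K - g j)) F (𝓝 (∑' j, p j * L (g j))) := by
    intro p hp hps g
    refine tendsto_tsum_of_dominated_convergence (bound := fun j => p j * B) (hps.mul_right B)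
      (fun j => (hL (g j)).const_mul _) (Eventually.of_forall fun K j => ?_)
    rw [norm_mul, Real.norm_of_nonneg (hp j)]
    exact mul_le_mul_of_nonneg_left (hu _) (hp j)
  have hLrec : ∀ m, L m = ∑' j, q j * L (m + (j + 1)) := by
    intro m
    have e := (hsub m).eventually h1
    refine tendsto_nhds_unique (hL m) ?_
    refine (hdom q hq hqs.summable (fun j => m + (j + 1))).congr' ?_
    filter_upwards [e] with K hK
    rw [hK]
    simp only [Nat.sub_sub]
  have hLB : ∀ m, |L m| ≤ B := fun m =>
    le_of_tendsto (hL m).abs (Eventually.of_forall fun K => hu _)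
  have hall : ∀ m, L m = M := by
    intro m
    induction m with
    | zero => exact hL0
    | succ m ih =>
      by_contra hne
      have hlt : L (m + 1) < M := lt_of_le_of_ne (hLM _) hne
      have hs : Summable fun j => q j * L (m + (j + 1)) := by
        refine Summable.of_norm_bounded (hqs.summable.mul_right B) fun j => ?_
        rw [norm_mul, Real.norm_of_nonneg (hq j)]
        exact mul_le_mul_of_nonneg_left (hLB _) (hq j)
      have : ∑' j, q j * L (m + (j + 1)) < ∑' j, q j * M :=
        Summable.tsum_lt_tsum (i := 0) (fun j => mul_le_mul_of_nonneg_left (hLM _) (hq j))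
          (mul_lt_mul_of_pos_left hlt hq0) hs (hqs.summable.mul_right M)
      rw [← hLrec, tsum_mul_right, hqs.tsum_eq, ih] at this
      linarith
  have h3 := hdom r hr hrs id
  simp only [hall, id] at h3
  rw [tsum_mul_right, mul_comm] at h3
  refine tendsto_nhds_unique h3 (tendsto_const_nhds.congr' ?_)
  filter_upwards [hF h2] with K hK
  exact hK.symm

lemma renewal (q r u : ℕ → ℝ) (hq : ∀ j, 0 ≤ q j) (hq0 : 0 < q 0) (hqs : HasSum q 1)
    (hr : ∀ j, 0 ≤ r j) (hrs : Summable r) (hr0 : 0 < ∑' j, r j) (B a : ℝ)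
    (hu : ∀ K, |u K| ≤ B)
    (h1 : ∀ᶠ K in atTop, u K = ∑' j, q j * u (K - (j + 1)))
    (h2 : ∀ᶠ K in atTop, ∑' j, r j * u (K - j) = a) :
    Tendsto u atTop (𝓝 (a / ∑' j, r j)) := by
  have hc : IsCompact (Set.Icc (-B) B) := isCompact_Icc
  have hmem : ∀ K, u K ∈ Set.Icc (-B) B := fun K => abs_le.1 (hu K)
  have hCsub : {x | MapClusterPt x atTop u} ⊆ Set.Icc (-B) B := by
    intro x hx
    exact isClosed_Icc.mem_of_mapClusterPt hx (Eventually.of_forall hmem)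
  have hCc : IsCompact {x | MapClusterPt x atTop u} :=
    hc.of_isClosed_subset isClosed_setOfPred_clusterPt hCsub
  have hCn : {x | MapClusterPt x atTop u}.Nonempty := by
    obtain ⟨x, -, hx⟩ := hc.exists_mapClusterPt (f := atTop) (u := u)
      (by rw [le_principal_iff]; exact Filter.mem_map.2 (Filter.univ_mem' hmem))
    exact ⟨x, hx⟩
  obtain ⟨M, hM⟩ := hCc.exists_isGreatest hCn
  obtain ⟨m, hm⟩ := hCc.exists_isLeast hCn
  have eM := renewal_aux q r u hq hq0 hqs hr hrs B a hu h1 h2 M hM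
  have hneg : ∀ x, MapClusterPt x atTop (fun K => - u K) → MapClusterPt (-x) atTop u := by
    intro x hx
    have := hx.continuousAt_comp (f := fun y : ℝ => -y) continuous_neg.continuousAt
    simpa [Function.comp_def] using this
  have hneg' : ∀ x, MapClusterPt x atTop u → MapClusterPt (-x) atTop (fun K => - u K) := by
    intro x hx
    exact hx.continuousAt_comp (f := fun y : ℝ => -y) continuous_neg.continuousAt
  have em := renewal_aux q r (fun K => - u K) hq hq0 hqs hr hrs B (-a) (by simpa using hu)
    (by filter_upwards [h1] with K hK; simp only [mul_neg, tsum_neg]; rw [← hK])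
    (by filter_upwards [h2] with K hK; simp only [mul_neg, tsum_neg]; rw [hK]) (-m)
    ⟨hneg' _ hm.1, fun x hx => by have := hm.2 (hneg x hx); linarith⟩
  have hM' : M = a / ∑' j, r j := by rw [eq_div_iff hr0.ne']; exact eM
  have hm' : m = a / ∑' j, r j := by rw [eq_div_iff hr0.ne']; linarith
  refine hc.tendsto_nhds_of_unique_mapClusterPt (Eventually.of_forall hmem) ?_
  intro x _ hx
  have := hM.2 hx
  have := hm.2 hx
  linarith

lemma geom_bound (T : ℕ → ℝ) (hT : ∀ j, 0 ≤ T j) (w : ℝ) (hw : 0 < w)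
    (hconv : Filter.limsup (fun j : ℕ => ENNReal.ofReal (T j ^ ((j : ℝ)⁻¹))) Filter.atTop
        * ENNReal.ofReal w < 1) :
    ∃ θ : ℝ, 0 ≤ θ ∧ θ < 1 ∧ ∀ᶠ j in atTop, T j * w ^ j ≤ θ ^ j := by
  have hw1 : ENNReal.ofReal w ≠ 0 := by simpa using hw
  have h : Filter.limsup (fun j : ℕ => ENNReal.ofReal (T j ^ ((j : ℝ)⁻¹))) Filter.atTop
      < 1 / ENNReal.ofReal w := by
    rw [ENNReal.lt_div_iff_mul_lt (Or.inl hw1) (Or.inl ENNReal.ofReal_ne_top)]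
    exact hconv
  obtain ⟨b, hb1, hb2⟩ := exists_between h
  have hbt : b ≠ ⊤ := hb2.ne_top
  rw [ENNReal.lt_div_iff_mul_lt (Or.inl hw1) (Or.inl ENNReal.ofReal_ne_top)] at hb2
  refine ⟨b.toReal * w, by positivity, ?_, ?_⟩
  · have := (ENNReal.toReal_lt_toReal hb2.ne_top ENNReal.one_ne_top).2 hb2
    simpa [ENNReal.toReal_mul, ENNReal.toReal_ofReal hw.le] using this
  · filter_upwards [eventually_lt_of_limsup_lt hb1, eventually_ge_atTop 1] with j hj hj1
    have h3 : T j ^ ((j : ℝ)⁻¹) ≤ b.toReal := (ENNReal.ofReal_le_iff_le_toReal hbt).1 hj.le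
    have h4 : (T j ^ ((j : ℝ)⁻¹)) ^ j = T j := Real.rpow_inv_natCast_pow (hT j) (by omega)
    rw [mul_pow]
    refine mul_le_mul_of_nonneg_right ?_ (by positivity)
    rw [← h4]
    exact pow_le_pow_left₀ (Real.rpow_nonneg (hT j) _) h3 j

lemma tail_summable (q : ℕ → ℝ) (hq : ∀ j, 0 ≤ q j) (θ : ℝ) (h0 : 0 ≤ θ) (h1 : θ < 1)
    (hb : ∀ᶠ j in atTop, q j ≤ θ ^ j) :
    Summable q ∧ Summable (fun n => ∑' j, q (j + n)) := by
  have hg := summable_geometric_of_lt_one h0 h1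
  have hs : Summable q := by
    refine summable_of_isBigO_nat hg (Asymptotics.IsBigO.of_bound 1 ?_)
    filter_upwards [hb] with j hj
    rw [one_mul, Real.norm_of_nonneg (hq j), Real.norm_of_nonneg (by positivity)]
    exact hj
  refine ⟨hs, ?_⟩
  refine summable_of_isBigO_nat hg (Asymptotics.IsBigO.of_bound (1 - θ)⁻¹ ?_)
  obtain ⟨J, hJ⟩ := eventually_atTop.1 hb
  filter_upwards [eventually_ge_atTop J] with n hn
  rw [Real.norm_of_nonneg (tsum_nonneg fun j => hq _), Real.norm_of_nonneg (by positivity),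
    ← tsum_geometric_of_lt_one h0 h1, ← tsum_mul_right]
  refine Summable.tsum_le_tsum (fun j => ?_) ((summable_nat_add_iff n).2 hs) (hg.mul_right _)
  rw [← pow_add]
  exact hJ _ (by omega)

/-- Strong Horton law for mean branch numbers: if `w₀ ∈ (0,1/2]` is a zero of the
Tokunaga generating function inside the disk of convergence, then the mean branch
counts `N_K` (defined by the Horton counting recursion) satisfy `N_K · w₀^K → A > 0`,
`N_{K+1}/N_K → R = 1/w₀`, and `N_{K-k+1}/N_K → R^{1-k}` for every fixed `k ≥ 1`. -/
theorem stmt1 (T : ℕ → ℝ) (hT : ∀ j, 0 ≤ T j)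
    (N : ℕ → ℝ) (hN1 : N 1 = 1)
    (hNrec : ∀ K : ℕ, 2 ≤ K →
      N K = 2 * N (K - 1) + ∑ j ∈ Finset.Icc 1 (K - 1), T j * N (K - j))
    (w₀ : ℝ) (hw₀ : 0 < w₀) (hw₀' : w₀ ≤ 1 / 2)
    (hconv : Filter.limsup (fun j : ℕ => ENNReal.ofReal (T j ^ ((j : ℝ)⁻¹))) Filter.atTop
        * ENNReal.ofReal w₀ < 1)
    (hroot : -1 + 2 * w₀ + ∑' j : ℕ, T (j + 1) * w₀ ^ (j + 1) = 0) :
    (∃ A : ℝ, 0 < A ∧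
      Filter.Tendsto (fun K : ℕ => N K * w₀ ^ K) Filter.atTop (nhds A)) ∧
    Filter.Tendsto (fun K : ℕ => N (K + 1) / N K) Filter.atTop (nhds (1 / w₀)) ∧
    ∀ k : ℕ, 1 ≤ k →
      Filter.Tendsto (fun K : ℕ => N (K - k + 1) / N K) Filter.atTop
        (nhds (w₀ ^ (k - 1))) := by
  obtain ⟨θ, hθ0, hθ1, hθ⟩ := geom_bound T hT w₀ hw₀ hconv
  obtain ⟨q, hqd⟩ : ∃ q : ℕ → ℝ, ∀ j, q j = (if j = 0 then 2 * w₀ else 0) +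
    T (j + 1) * w₀ ^ (j + 1) := ⟨_, fun _ => rfl⟩
  have hq : ∀ j, 0 ≤ q j := by
    intro j
    rw [hqd]
    have := hT (j + 1)
    split_ifs <;> positivity
  have hq0 : 0 < q 0 := by
    rw [hqd]
    have := hT (0 + 1)
    simp only [if_true]
    positivity
  have hqb : ∀ᶠ j in atTop, q j ≤ θ ^ j := by
    filter_upwards [(tendsto_add_atTop_nat 1).eventually hθ, eventually_ge_atTop 1] with j hj hj1
    rw [hqd, if_neg (by omega), zero_add]
    exact hj.trans (pow_le_pow_of_le_one hθ0 hθ1.le (by omega))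
  obtain ⟨hqs, hrs⟩ := tail_summable q hq θ hθ0 hθ1 hqb
  have hsum : HasSum q 1 := by
    have e1 : HasSum (fun j : ℕ => if j = 0 then 2 * w₀ else 0) (2 * w₀) := hasSum_ite_eq 0 _
    have e2 : Summable (fun j : ℕ => T (j + 1) * w₀ ^ (j + 1)) := by
      have := hqs.sub e1.summable
      simpa [hqd] using this
    have := e1.add e2.hasSum
    convert this using 1
    · funext j; exact hqd j
    · linarith
  obtain ⟨r, hrd⟩ : ∃ r : ℕ → ℝ, ∀ n, r n = ∑' j, q (j + n) := ⟨_, fun _ => rfl⟩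
  have hr : ∀ n, 0 ≤ r n := fun n => by rw [hrd]; exact tsum_nonneg fun j => hq _
  have hrs' : Summable r := by rw [show r = _ from funext hrd]; exact hrs
  have hr0 : r 0 = 1 := by rw [hrd]; exact hsum.tsum_eq
  have hrsucc : ∀ n, r n = q n + r (n + 1) := by
    intro n
    rw [hrd, hrd, ((summable_nat_add_iff n).2 hqs).tsum_eq_zero_add]
    simp [add_assoc, add_comm 1 n]
  have hrpos : 0 < ∑' j, r j := hrs'.tsum_pos hr 0 (by rw [hr0]; exact one_pos)
  obtain ⟨u, hud⟩ : ∃ u : ℕ → ℝ, ∀ K, u K = if K = 0 then 0 else N K * w₀ ^ K :=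
    ⟨_, fun _ => rfl⟩
  have hu0 : u 0 = 0 := by simp [hud]
  have hu1 : u 1 = w₀ := by simp [hud, hN1]
  have hupos : ∀ K, K ≠ 0 → u K = N K * w₀ ^ K := fun K hK => by rw [hud, if_neg hK]
  have hurec : ∀ K, 1 ≤ K → u (K + 1) = ∑ n ∈ Finset.range K, q n * u (K - n) := by
    intro K hK
    have hIcc : Finset.Icc 1 K = Finset.Ico 1 (K + 1) := by ext x; simp
    have hrec := hNrec (K + 1) (by omega)
    simp only [Nat.add_sub_cancel] at hrec
    rw [hIcc, Finset.sum_Ico_eq_sum_range, Nat.add_sub_cancel] at hrec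
    rw [hupos _ (by omega), hrec, add_mul, Finset.sum_mul]
    simp only [hqd, add_mul, ite_mul, zero_mul, Finset.sum_add_distrib]
    congr 1
    · rw [Finset.sum_ite_eq' (Finset.range K) 0, if_pos (Finset.mem_range.2 (by omega)), Nat.sub_zero, hupos K (by omega)]
      ring
    · refine Finset.sum_congr rfl fun n hn => ?_
      have hn' := Finset.mem_range.1 hn
      rw [hupos _ (by omega), show K + 1 - (1 + n) = K - n by omega, add_comm 1 n,
        show K + 1 = (n + 1) + (K - n) by omega, pow_add w₀ (n + 1) (K - n)]
      ring
  have hunn : ∀ K, 0 ≤ u K := by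
    intro K
    induction K using Nat.strong_induction_on with
    | _ K ih =>
      match K, ih with
      | 0, _ => rw [hu0]
      | 1, _ => rw [hu1]; exact hw₀.le
      | K + 2, ih =>
        rw [hurec (K + 1) (by omega)]
        exact Finset.sum_nonneg fun n hn => mul_nonneg (hq n) (ih _ (by omega))
  have hcons : ∀ K, 1 ≤ K → ∑ n ∈ Finset.range K, r n * u (K - n) = w₀ := by
    intro K hK
    induction K, hK using Nat.le_induction with
    | base => simp [hr0, hu1]
    | succ K hK ih =>
      rw [Finset.sum_range_succ', Nat.sub_zero, hr0, one_mul, hurec K hK,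
        ← Finset.sum_add_distrib, ← ih]
      refine Finset.sum_congr rfl fun n _ => ?_
      rw [hrsucc n, Nat.add_sub_add_right]
      ring
  have hub : ∀ K, |u K| ≤ w₀ := by
    intro K
    rw [abs_of_nonneg (hunn K)]
    rcases Nat.eq_zero_or_pos K with rfl | hK
    · rw [hu0]; exact hw₀.le
    · have := Finset.single_le_sum (f := fun n => r n * u (K - n))
        (fun n _ => mul_nonneg (hr n) (hunn _)) (Finset.mem_range.2 hK)
      simp only [hr0, Nat.sub_zero, one_mul] at this
      rw [hcons K hK] at this
      exact this
  have hlim := renewal q r u hq hq0 hsum hr hrs' hrpos w₀ w₀ hub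
    (by
      filter_upwards [eventually_ge_atTop 2] with K hK
      obtain ⟨K, rfl⟩ : ∃ k, K = k + 1 := ⟨K - 1, by omega⟩
      rw [hurec K (by omega), tsum_eq_sum (s := Finset.range K)]
      · simp only [Nat.add_sub_add_right]
      · intro n hn
        rw [Finset.mem_range] at hn
        rw [show K + 1 - (n + 1) = 0 by omega, hu0, mul_zero])
    (by
      filter_upwards [eventually_ge_atTop 1] with K hK
      rw [← hcons K hK, tsum_eq_sum (s := Finset.range K)]
      intro n hn
      rw [Finset.mem_range] at hn
      rw [show K - n = 0 by omega, hu0, mul_zero])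
  have hApos : 0 < w₀ / ∑' j, r j := div_pos hw₀ hrpos
  generalize w₀ / ∑' j, r j = A at hlim hApos
  have hNu : ∀ K, K ≠ 0 → N K = u K / w₀ ^ K := fun K hK => by
    rw [hupos K hK]; field_simp
  refine ⟨⟨A, hApos, hlim.congr' ?_⟩, ?_, ?_⟩
  · filter_upwards [eventually_ge_atTop 1] with K hK
    exact hupos K (by omega)
  · have := ((hlim.comp (tendsto_add_atTop_nat 1)).div hlim hApos.ne').div_const w₀
    rw [div_self hApos.ne'] at this
    refine this.congr' ?_
    filter_upwards [eventually_ge_atTop 1] with K hK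
    rw [hNu K (by omega), hNu (K + 1) (by omega)]
    simp only [Function.comp, Pi.div_apply]
    rw [pow_succ, div_div_div_eq, div_div, mul_comm (u (K + 1)), mul_comm (w₀ ^ K) w₀,
      mul_comm w₀ (w₀ ^ K), mul_assoc, mul_div_mul_left _ _ (by positivity), mul_comm w₀]
  · intro k hk
    obtain ⟨k, rfl⟩ : ∃ l, k = l + 1 := ⟨k - 1, by omega⟩
    have := ((hlim.comp (tendsto_sub_atTop_nat k)).div hlim hApos.ne').mul_const (w₀ ^ k)
    rw [div_self hApos.ne', one_mul] at this
    refine this.congr' ?_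
    filter_upwards [eventually_ge_atTop (k + 1)] with K hK
    obtain ⟨m, rfl⟩ : ∃ m, K = m + 1 + k := ⟨K - k - 1, by omega⟩
    rw [show m + 1 + k - (k + 1) + 1 = m + 1 by omega, hNu (m + 1) (by omega),
      hNu (m + 1 + k) (by omega)]
    simp only [Function.comp, Pi.div_apply, Nat.add_sub_cancel]
    rw [pow_add w₀ (m + 1) k, div_div_div_eq, mul_comm (w₀ ^ (m + 1)) (u (m + 1 + k)),
      mul_comm (w₀ ^ (m + 1)) (w₀ ^ k), ← mul_assoc,
      mul_div_mul_right _ _ (by positivity), div_mul_eq_mul_div]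
end

section
/- Let T_1, T_2, ... be nonnegative reals and let N_K be the mean branch counts defined by the Horton counting recursion. If the limit R = lim_{K→∞} N_{K+1}/N_K exists and is finite, then limsup_{j→∞} T_j^{1/j} ≤ R. In particular, if limsup_{j→∞} T_j^{1/j} = ∞, then the ratios N_{K+1}/N_K do not converge to a finite limit. -/
open Filter
open scoped ENNReal Topology

/-- If the ratios `N_{K+1}/N_K` of the mean branch counts converge to a finite limit
`R`, then `limsup T_j^{1/j} ≤ R`; in particular, if `limsup T_j^{1/j} = ∞` then the
ratios do not converge to a finite limit. -/
theorem stmt3 (T : ℕ → ℝ) (hT : ∀ j, 0 ≤ T j)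
    (N : ℕ → ℝ) (hN1 : N 1 = 1)
    (hNrec : ∀ K : ℕ, 2 ≤ K →
      N K = 2 * N (K - 1) + ∑ j ∈ Finset.Icc 1 (K - 1), T j * N (K - j)) :
    (∀ R : ℝ, Filter.Tendsto (fun K : ℕ => N (K + 1) / N K) Filter.atTop (nhds R) →
      Filter.limsup (fun j : ℕ => ENNReal.ofReal (T j ^ ((j : ℝ)⁻¹))) Filter.atTop
        ≤ ENNReal.ofReal R) ∧
    (Filter.limsup (fun j : ℕ => ENNReal.ofReal (T j ^ ((j : ℝ)⁻¹))) Filter.atTop = ⊤ →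
      ¬ ∃ R : ℝ, Filter.Tendsto (fun K : ℕ => N (K + 1) / N K) Filter.atTop (nhds R)) := by
  have hpos : ∀ K : ℕ, 1 ≤ K → 0 < N K := by
    intro K
    induction K using Nat.strong_induction_on with
    | _ K ih =>
      intro hK
      rcases Nat.lt_or_ge K 2 with h | h
      · have : K = 1 := by omega
        rw [this, hN1]; norm_num
      · rw [hNrec K h]
        have h1 := ih (K - 1) (by omega) (by omega)
        have h2 : 0 ≤ ∑ j ∈ Finset.Icc 1 (K - 1), T j * N (K - j) := by
          apply Finset.sum_nonneg
          intro j hj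
          rw [Finset.mem_Icc] at hj
          exact mul_nonneg (hT j) (ih (K - j) (by omega) (by omega)).le
        linarith
  have hTN : ∀ j : ℕ, 1 ≤ j → T j ≤ N (j + 1) := by
    intro j hj
    rw [hNrec (j + 1) (by omega)]
    have h1 := hpos j hj
    have h2 : T j * N (j + 1 - j) ≤ ∑ i ∈ Finset.Icc 1 (j + 1 - 1), T i * N (j + 1 - i) := by
      apply Finset.single_le_sum (f := fun i => T i * N (j + 1 - i))
      · intro i hi
        rw [Finset.mem_Icc] at hi
        exact mul_nonneg (hT i) (hpos _ (by omega)).le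
      · rw [Finset.mem_Icc]; omega
    have h3 : j + 1 - j = 1 := by omega
    rw [h3, hN1, mul_one] at h2
    have h4 : j + 1 - 1 = j := by omega
    rw [h4] at h2 ⊢
    linarith
  have main : ∀ R : ℝ, Filter.Tendsto (fun K : ℕ => N (K + 1) / N K) Filter.atTop (nhds R) →
      Filter.limsup (fun j : ℕ => ENNReal.ofReal (T j ^ ((j : ℝ)⁻¹))) Filter.atTop
        ≤ ENNReal.ofReal R := by
    intro R hR
    have hR0 : 0 ≤ R := by
      apply ge_of_tendsto hR
      filter_upwards [eventually_ge_atTop 1] with K hK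
      exact (div_pos (hpos _ (by omega)) (hpos _ hK)).le
    have key : ∀ r : ℝ, R < r →
        Filter.limsup (fun j : ℕ => ENNReal.ofReal (T j ^ ((j : ℝ)⁻¹))) Filter.atTop
        ≤ ENNReal.ofReal r := by
      intro r hr
      have hr0 : 0 < r := lt_of_le_of_lt hR0 hr
      obtain ⟨M, hM⟩ := eventually_atTop.1
        ((hR.eventually (gt_mem_nhds hr)).and (eventually_ge_atTop 1))
      have hM1 : 1 ≤ M := (hM M le_rfl).2
      have hMpos := hpos M hM1
      obtain ⟨C, hC, hCdef⟩ : ∃ C : ℝ, 0 < C ∧ C * r ^ M = N M :=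
        ⟨N M / r ^ M, by positivity, by field_simp⟩
      have hb : ∀ K, M ≤ K → N K ≤ C * r ^ K := by
        intro K hK
        induction K, hK using Nat.le_induction with
        | base => exact hCdef.ge
        | succ K hK ih =>
          have h1 := (hM K hK).1
          have h2 := hpos K (by omega)
          rw [div_lt_iff₀ h2] at h1
          calc N (K + 1) ≤ r * N K := h1.le
            _ ≤ r * (C * r ^ K) := by gcongr
            _ = C * r ^ (K + 1) := by ring
      have hlim : Tendsto (fun j : ℕ => ENNReal.ofReal ((C * r) ^ ((j : ℝ)⁻¹) * r)) atTop
          (𝓝 (ENNReal.ofReal r)) := by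
        apply ENNReal.tendsto_ofReal
        have h0 : Tendsto (fun j : ℕ => ((j : ℝ)⁻¹)) atTop (𝓝 0) :=
          tendsto_inv_atTop_nhds_zero_nat
        have h1 := ((Real.continuousAt_const_rpow (a := C * r) (b := 0) (by positivity)).tendsto.comp h0).mul_const r
        simpa [Function.comp_def] using h1
      rw [← hlim.limsup_eq]
      refine Filter.limsup_le_limsup ?_
      · filter_upwards [eventually_ge_atTop M] with j hj
        apply ENNReal.ofReal_le_ofReal
        have hj1 : j ≠ 0 := by omega
        have h1 : T j ≤ (C * r) * r ^ j := by
          calc T j ≤ N (j + 1) := hTN j (by omega)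
            _ ≤ C * r ^ (j + 1) := hb _ (by omega)
            _ = _ := by ring
        calc T j ^ ((j : ℝ)⁻¹) ≤ ((C * r) * r ^ j) ^ ((j : ℝ)⁻¹) :=
              Real.rpow_le_rpow (hT j) h1 (by positivity)
          _ = (C * r) ^ ((j : ℝ)⁻¹) * r := by
              rw [Real.mul_rpow (by positivity) (by positivity),
                Real.pow_rpow_inv_natCast hr0.le hj1]
    have ht : Tendsto (fun r : ℝ => ENNReal.ofReal r) (𝓝[>] R) (𝓝 (ENNReal.ofReal R)) :=
      (ENNReal.continuous_ofReal.tendsto R).mono_left nhdsWithin_le_nhds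
    apply ge_of_tendsto ht
    filter_upwards [self_mem_nhdsWithin] with r hr
    exact key r hr
  refine ⟨main, ?_⟩
  rintro h ⟨R, hR⟩
  have := main R hR
  rw [h, top_le_iff] at this
  exact ENNReal.ofReal_ne_top this
end

section
/- Fix a > 0 and c > 0 and let T_j = a·c^{j-1} (Tokunaga self-similarity). Then the quadratic 2c·z² − (a+c+2)·z + 1 has positive discriminant (a+c+2)² − 8c > 0, hence two distinct real roots z_1 < z_2 with z_1·z_2 = 1/(2c); and the mean branch counts satisfy the closed form N_{K+1} = (1/(2c·(z_2 − z_1)))·((1 − c·z_1)/z_1^{K+1} − (1 − c·z_2)/z_2^{K+1}) for every K ≥ 0. Consequently N_{K+1}/N_K → 1/z_1 = (a + c + 2 + sqrt((a+c+2)² − 8c))/2 as K → ∞ (the Horton exponent of a Tokunaga self-similar tree). -/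
open Filter
open scoped Topology

/-- For Tokunaga coefficients `T_j = a·c^{j-1}` with `a, c > 0`, the quadratic
`2cz² - (a+c+2)z + 1` has two distinct real roots `z₁ < z₂` with `z₁z₂ = 1/(2c)`,
the mean branch counts have the stated closed form, and
`N_{K+1}/N_K → 1/z₁ = (a+c+2+√((a+c+2)²-8c))/2`. -/
theorem stmt4 (a c : ℝ) (ha : 0 < a) (hc : 0 < c)
    (T : ℕ → ℝ) (hTdef : ∀ j : ℕ, 1 ≤ j → T j = a * c ^ (j - 1))
    (N : ℕ → ℝ) (hN1 : N 1 = 1)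
    (hNrec : ∀ K : ℕ, 2 ≤ K →
      N K = 2 * N (K - 1) + ∑ j ∈ Finset.Icc 1 (K - 1), T j * N (K - j)) :
    0 < (a + c + 2) ^ 2 - 8 * c ∧
    ∃ z₁ z₂ : ℝ, z₁ < z₂ ∧
      2 * c * z₁ ^ 2 - (a + c + 2) * z₁ + 1 = 0 ∧
      2 * c * z₂ ^ 2 - (a + c + 2) * z₂ + 1 = 0 ∧
      z₁ * z₂ = 1 / (2 * c) ∧
      (∀ K : ℕ, N (K + 1) =
        1 / (2 * c * (z₂ - z₁)) *
          ((1 - c * z₁) / z₁ ^ (K + 1) - (1 - c * z₂) / z₂ ^ (K + 1))) ∧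
      1 / z₁ = (a + c + 2 + Real.sqrt ((a + c + 2) ^ 2 - 8 * c)) / 2 ∧
      Filter.Tendsto (fun K : ℕ => N (K + 1) / N K) Filter.atTop (nhds (1 / z₁)) := by
  have hDpos : 0 < (a + c + 2) ^ 2 - 8 * c := by nlinarith [sq_nonneg (c - 2), mul_pos ha hc, sq_nonneg a]
  refine ⟨hDpos, ?_⟩
  -- three-term recurrence
  have hS : ∀ n : ℕ, ∑ j ∈ Finset.Icc 1 (n + 1), T j * N (n + 2 - j)
      = a * N (n + 1) + c * ∑ j ∈ Finset.Icc 1 n, T j * N (n + 1 - j) := by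
    intro n
    have e : ∀ (m : ℕ) (f : ℕ → ℝ), ∑ j ∈ Finset.Icc 1 m, f j = ∑ i ∈ Finset.range m, f (i + 1) := by
      intro m f
      induction m with
      | zero => simp
      | succ k ih => rw [Finset.sum_Icc_succ_top (by omega), ih, Finset.sum_range_succ]
    rw [e, e, Finset.sum_range_succ', Finset.mul_sum, add_comm]
    congr 1
    · rw [hTdef _ (by omega)]; simp
    · refine Finset.sum_congr rfl fun i _ => ?_
      rw [hTdef _ (by omega), hTdef _ (by omega)]
      have e1 : n + 2 - (i + 1 + 1) = n + 1 - (i + 1) := by omega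
      rw [e1]
      simp only [Nat.add_sub_cancel, pow_succ]
      ring
  have hN2 : N 2 = a + 2 := by
    have h := hNrec 2 le_rfl
    simp [hTdef 1 le_rfl, hN1] at h
    linarith
  have hrec : ∀ n : ℕ, N (n + 3) = (a + c + 2) * N (n + 2) - 2 * c * N (n + 1) := by
    intro n
    have h3 := hNrec (n + 3) (by omega)
    have h2 := hNrec (n + 2) (by omega)
    have h := hS (n + 1)
    simp only [show n + 3 - 1 = n + 2 from rfl] at h3
    simp only [show n + 2 - 1 = n + 1 from rfl] at h2
    simp only [show n + 1 + 1 = n + 2 from rfl, show n + 1 + 2 = n + 3 from rfl] at h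
    rw [h] at h3
    linear_combination h3 - c * h2
  set D := Real.sqrt ((a + c + 2) ^ 2 - 8 * c) with hD
  have hD0 : 0 < D := Real.sqrt_pos.mpr hDpos
  have hDsq : D ^ 2 = (a + c + 2) ^ 2 - 8 * c := Real.sq_sqrt hDpos.le
  obtain ⟨x, hx⟩ : ∃ x, x = (a + c + 2 + D) / 2 := ⟨_, rfl⟩
  obtain ⟨y, hy⟩ : ∃ y, y = (a + c + 2 - D) / 2 := ⟨_, rfl⟩
  have hsum : x + y = a + c + 2 := by rw [hx, hy]; ring
  have hprod : x * y = 2 * c := by rw [hx, hy]; linear_combination -hDsq / 4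
  have hyx : y < x := by rw [hx, hy]; linarith
  have hx0 : 0 < x := by rw [hx]; positivity
  have hy0 : 0 < y := by
    by_contra h
    nlinarith
  have hxc : c < x := by
    by_contra h
    have h1 : (x - c) * (y - c) = -(a * c) := by linear_combination hprod - c * hsum
    nlinarith [mul_pos ha hc, mul_nonneg (show 0 ≤ c - x by linarith) (show 0 ≤ c - y by linarith)]
  have hform : ∀ K : ℕ, N (K + 1) * (x - y) = (x - c) * x ^ K - (y - c) * y ^ K ∧
      N (K + 2) * (x - y) = (x - c) * x ^ (K + 1) - (y - c) * y ^ (K + 1) := by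
    intro K
    induction K with
    | zero =>
      constructor
      · simp [hN1]
      · simp only [Nat.zero_add, hN2]; linear_combination -(x - y) * hsum
    | succ k ih =>
      refine ⟨ih.2, ?_⟩
      have := hrec k
      rw [show k + 1 + 2 = k + 3 from rfl, this, ← hsum, ← hprod]
      linear_combination (x + y) * ih.2 - x * y * ih.1
  have hxy : x - y ≠ 0 := by linarith
  have hx' := hx0.ne'
  have hy' := hy0.ne'
  refine ⟨1 / x, 1 / y, one_div_lt_one_div_of_lt hy0 hyx, ?_, ?_, ?_, ?_, ?_, ?_⟩
  · rw [← hsum, ← hprod]; field_simp; ring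
  · rw [← hsum, ← hprod]; field_simp; ring
  · rw [← hprod]; field_simp
  · intro K
    have h := (hform K).1
    have e1 : 2 * c * (1 / y - 1 / x) = x - y := by rw [← hprod]; field_simp
    have e2 : (1 - c * (1 / x)) / (1 / x) ^ (K + 1) = (x - c) * x ^ K := by
      rw [one_div_pow, pow_succ]; field_simp
    have e3 : (1 - c * (1 / y)) / (1 / y) ^ (K + 1) = (y - c) * y ^ K := by
      rw [one_div_pow, pow_succ]; field_simp
    rw [e1, e2, e3, ← h]; field_simp
  · rw [one_div_one_div, hx]
  · rw [one_div_one_div]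
    rw [← tendsto_add_atTop_iff_nat 1]
    have hr : Tendsto (fun K : ℕ => (y / x) ^ K) atTop (𝓝 0) :=
      tendsto_pow_atTop_nhds_zero_of_lt_one (by positivity) ((div_lt_one hx0).mpr hyx)
    have hden : Tendsto (fun K : ℕ => (x - c) - (y - c) * (y / x) ^ K) atTop (𝓝 (x - c)) := by
      simpa using (hr.const_mul (y - c)).const_sub (x - c)
    have hnum := (hden.comp (tendsto_add_atTop_nat 1)).const_mul x
    have hq := hnum.div hden (by linarith)
    rw [mul_div_assoc, div_self (by linarith), mul_one] at hq
    refine hq.congr fun K => ?_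
    have h1 := (hform K).1
    have h2 := (hform K).2
    have g : ∀ k : ℕ, (x - c) * x ^ k - (y - c) * y ^ k
        = x ^ k * ((x - c) - (y - c) * (y / x) ^ k) := by
      intro k
      rw [div_pow]; field_simp
    rw [g] at h1 h2
    simp only [Pi.div_apply, Function.comp]
    rw [← mul_div_mul_right (N (K + 1 + 1)) (N (K + 1)) hxy, h1, show K + 1 + 1 = K + 2 from rfl, h2,
      pow_succ x K, mul_assoc, mul_div_mul_left _ _ (pow_ne_zero K hx')]
end

section
/- Fix c ≥ 1, let T_j = (c−1)·c^{j−1} (the critical Tokunaga sequence) and set R = 2c. Then the mean branch counts satisfy the closed form N_K = (R^K + R − 2)/(2(R−1)) for every K ≥ 1; equivalently, (2c−1)·N_{K−k+1} − (c−1) = R^{1−k}·((2c−1)·N_K − (c−1)) for all 1 ≤ k ≤ K. -/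
/-- For the critical Tokunaga sequence `T_j = (c-1)·c^{j-1}` with `c ≥ 1` and
`R = 2c`, the mean branch counts satisfy the closed form
`N_K = (R^K + R - 2)/(2(R-1))`, equivalently
`(2c-1)·N_{K-k+1} - (c-1) = R^{1-k}·((2c-1)·N_K - (c-1))` for `1 ≤ k ≤ K`. -/
theorem stmt5 (c : ℝ) (hc : 1 ≤ c)
    (T : ℕ → ℝ) (hTdef : ∀ j : ℕ, 1 ≤ j → T j = (c - 1) * c ^ (j - 1))
    (N : ℕ → ℝ) (hN1 : N 1 = 1)
    (hNrec : ∀ K : ℕ, 2 ≤ K →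
      N K = 2 * N (K - 1) + ∑ j ∈ Finset.Icc 1 (K - 1), T j * N (K - j)) :
    (∀ K : ℕ, 1 ≤ K →
      N K = ((2 * c) ^ K + 2 * c - 2) / (2 * (2 * c - 1))) ∧
    (∀ K k : ℕ, 1 ≤ k → k ≤ K →
      (2 * c - 1) * N (K - k + 1) - (c - 1)
        = (2 * c) ^ ((1 : ℤ) - (k : ℤ)) * ((2 * c - 1) * N K - (c - 1))) := by
  have h2 : (2 * c - 1) ≠ 0 := by linarith
  have hc0 : (2 * c) ≠ 0 := by linarith
  -- the side-branch sum, reindexed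
  let S : ℕ → ℝ := fun n => ∑ i ∈ Finset.range n, (c - 1) * c ^ i * N (n - i)
  have hrec : ∀ n : ℕ, N (n + 2) = 2 * N (n + 1) + S (n + 1) := by
    intro n
    rw [hNrec (n + 2) (by omega)]
    have e : n + 2 - 1 = n + 1 := by omega
    rw [e]
    congr 1
    have e2 : Finset.Icc 1 (n + 1) = Finset.Ico 1 (n + 2) := by
      ext x
      simp only [Finset.mem_Icc, Finset.mem_Ico]
      omega
    rw [e2, Finset.sum_Ico_eq_sum_range, e]
    apply Finset.sum_congr rfl
    intro i _
    rw [hTdef (1 + i) (by omega)]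
    have e3 : 1 + i - 1 = i := by omega
    have e4 : n + 2 - (1 + i) = n + 1 - i := by omega
    rw [e3, e4]
  have hS : ∀ n : ℕ, S (n + 1) = (c - 1) * N (n + 1) + c * S n := by
    intro n
    simp only [S]
    rw [Finset.sum_range_succ', Finset.mul_sum, add_comm]
    congr 1
    · simp
    · apply Finset.sum_congr rfl
      intro i _
      rw [Nat.add_sub_add_right]
      ring
  have key : ∀ n : ℕ, N (n + 1) = ((2 * c) ^ (n + 1) + 2 * c - 2) / (2 * (2 * c - 1)) ∧
      S n = ((2 * c) ^ (n + 1) + 2 * c - 2) / (2 * (2 * c - 1))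
        - 2 * (((2 * c) ^ n + 2 * c - 2) / (2 * (2 * c - 1))) := by
    intro n
    induction n with
    | zero =>
      constructor
      · rw [zero_add, hN1]
        field_simp
        ring
      · simp only [S, Finset.range_zero, Finset.sum_empty]
        field_simp
        ring
    | succ n ih =>
      obtain ⟨h, hs⟩ := ih
      have h3 : S (n + 1) = ((2 * c) ^ (n + 1 + 1) + 2 * c - 2) / (2 * (2 * c - 1))
        - 2 * (((2 * c) ^ (n + 1) + 2 * c - 2) / (2 * (2 * c - 1))) := by
        rw [hS, h, hs, pow_succ _ (n + 1), pow_succ _ n]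
        generalize (2 * c) ^ n = x
        field_simp
        ring
      refine ⟨?_, h3⟩
      rw [hrec, h3, h]
      ring
  have main : ∀ K : ℕ, 1 ≤ K →
      N K = ((2 * c) ^ K + 2 * c - 2) / (2 * (2 * c - 1)) := by
    intro K hK
    obtain ⟨n, rfl⟩ := Nat.exists_eq_add_of_le' hK
    exact (key n).1
  have lin : ∀ K : ℕ, 1 ≤ K → (2 * c - 1) * N K - (c - 1) = (2 * c) ^ K / 2 := by
    intro K hK
    rw [main K hK]
    field_simp
    ring
  refine ⟨main, ?_⟩
  intro K k hk hkK
  rw [lin _ (by omega), lin K (by omega), ← mul_div_assoc, ← zpow_natCast, ← zpow_natCast,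
    ← zpow_add₀ hc0]
  congr 2
  push_cast [Nat.cast_sub hkK]
  ring
end

section
/- Let T_1, T_2, ... be nonnegative reals with L = limsup_{j→∞} T_j^{1/j} < ∞, and suppose w_0 ∈ (0, 1/2] satisfies L·w_0 < 1 and t̂(w_0) = 0; set R = 1/w_0. Fix p ∈ (0,1), γ > 0 and ζ ≥ max(1, L), and define the average progeny of the self-similar hierarchical branching process by C(s) = 1 + sum_{m=1}^∞ ((s·γ/ζ)^m/m!)·[prod_{i=1}^m t̂(ζ^{−i}(1−p))]·p/(1 − ζ^{−m}(1−p)) for s ≥ 0 (this series converges for every s ≥ 0). Then: C is strictly decreasing on [0,∞) if p > 1 − ζ/R; C(s) = 1 for all s ≥ 0 if p = 1 − ζ/R; and C is strictly increasing on [0,∞) if p < 1 − ζ/R. -/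
open Filter
open scoped ENNReal Topology

/-- The Tokunaga generating function `t̂(x) = -1 + 2x + ∑_{j≥1} T_j x^j`. -/
noncomputable def tokHat (T : ℕ → ℝ) (x : ℝ) : ℝ :=
  -1 + 2 * x + ∑' j : ℕ, T (j + 1) * x ^ (j + 1)

/-- The `m`-th term of the series defining the average progeny of a self-similar
hierarchical branching process:
`((sγ/ζ)^m/m!)·[∏_{i=1}^m t̂(ζ^{-i}(1-p))]·p/(1-ζ^{-m}(1-p))`. -/
noncomputable def progenyTerm (T : ℕ → ℝ) (p γ ζ s : ℝ) (m : ℕ) : ℝ :=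
  (s * γ / ζ) ^ m / (Nat.factorial m : ℝ) *
    (∏ i ∈ Finset.Icc 1 m, tokHat T ((1 - p) / ζ ^ i)) *
    (p / (1 - (1 - p) / ζ ^ m))

/-- The average progeny `C(s) = 1 + ∑_{m=1}^∞ progenyTerm m`. -/
noncomputable def avgProgeny (T : ℕ → ℝ) (p γ ζ s : ℝ) : ℝ :=
  1 + ∑' m : ℕ, progenyTerm T p γ ζ s (m + 1)


namespace Tok

/-- Power series with nonnegative coefficients on `[0,1)`. -/
def Cone (f : ℝ → ℝ) : Prop :=
  ∃ a : ℕ → ℝ, (∀ n, 0 ≤ a n) ∧ ∀ y, 0 ≤ y → y < 1 → HasSum (fun n => a n * y ^ n) (f y)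

lemma Cone.nonneg {f : ℝ → ℝ} (hf : Cone f) {y : ℝ} (h0 : 0 ≤ y) (h1 : y < 1) : 0 ≤ f y := by
  obtain ⟨a, ha, hs⟩ := hf
  exact (hs y h0 h1).nonneg (fun n => mul_nonneg (ha n) (pow_nonneg h0 n))

lemma Cone.add {f g : ℝ → ℝ} (hf : Cone f) (hg : Cone g) : Cone (fun y => f y + g y) := by
  obtain ⟨a, ha, hs⟩ := hf
  obtain ⟨b, hb, ht⟩ := hg
  refine ⟨fun n => a n + b n, fun n => add_nonneg (ha n) (hb n), fun y h0 h1 => ?_⟩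
  simpa only [add_mul] using (hs y h0 h1).add (ht y h0 h1)

lemma Cone.mul {f g : ℝ → ℝ} (hf : Cone f) (hg : Cone g) : Cone (fun y => f y * g y) := by
  obtain ⟨a, ha, hs⟩ := hf
  obtain ⟨b, hb, ht⟩ := hg
  refine ⟨fun n => ∑ kl ∈ Finset.HasAntidiagonal.antidiagonal n, a kl.1 * b kl.2,
    fun n => Finset.sum_nonneg fun i _ => mul_nonneg (ha _) (hb _), fun y h0 h1 => ?_⟩
  have h := hs y h0 h1
  have h' := ht y h0 h1
  have e := tsum_mul_tsum_eq_tsum_sum_antidiagonal_of_summable_norm h.summable.norm h'.summable.norm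
  have e2 := (summable_norm_sum_mul_antidiagonal_of_summable_norm
    h.summable.norm h'.summable.norm).of_norm
  rw [h.tsum_eq, h'.tsum_eq] at e
  change HasSum _ (f y * g y)
  rw [e]
  refine Eq.mp (congrArg (fun F => HasSum F _) (funext fun n => ?_)) e2.hasSum
  rw [Finset.sum_mul]
  refine Finset.sum_congr rfl fun kl hkl => ?_
  rw [← Finset.HasAntidiagonal.mem_antidiagonal.1 hkl, pow_add]
  ring

lemma div_mem {ζ y : ℝ} (hζ : 1 ≤ ζ) (h0 : 0 ≤ y) (h1 : y < 1) : 0 ≤ y / ζ ∧ y / ζ < 1 :=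
  ⟨by positivity, lt_of_le_of_lt (div_le_self h0 hζ) h1⟩

lemma Cone.comp {f : ℝ → ℝ} (hf : Cone f) {ζ : ℝ} (hζ : 1 ≤ ζ) : Cone (fun y => f (y / ζ)) := by
  obtain ⟨a, ha, hs⟩ := hf
  refine ⟨fun n => a n / ζ ^ n, fun n => div_nonneg (ha n) (by positivity), fun y h0 h1 => ?_⟩
  convert hs (y / ζ) (div_mem hζ h0 h1).1 (div_mem hζ h0 h1).2 using 2 with n
  rw [div_pow]; ring

lemma Cone.sub {f : ℝ → ℝ} (hf : Cone f) {ζ : ℝ} (hζ : 1 ≤ ζ) :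
    Cone (fun y => f y - f (y / ζ)) := by
  obtain ⟨a, ha, hs⟩ := hf
  refine ⟨fun n => a n - a n / ζ ^ n,
    fun n => sub_nonneg.2 (div_le_self (ha n) (one_le_pow₀ hζ)), fun y h0 h1 => ?_⟩
  have e := (hs y h0 h1).sub (hs (y / ζ) (div_mem hζ h0 h1).1 (div_mem hζ h0 h1).2)
  refine Eq.mp (congrArg (fun F => HasSum F _) (funext fun n => ?_)) e
  rw [div_pow]; ring

/-- Convergence of the Tokunaga series. -/
lemma summ (T : ℕ → ℝ) (hT : ∀ j, 0 ≤ T j) (L : NNReal)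
    (hL : Filter.limsup (fun j : ℕ => ENNReal.ofReal (T j ^ ((j : ℝ)⁻¹))) Filter.atTop
      = (L : ℝ≥0∞)) (x : ℝ) (hx : 0 ≤ x) (hLx : (L : ℝ) * x < 1) :
    Summable (fun j : ℕ => T (j + 1) * x ^ (j + 1)) := by
  rcases hx.eq_or_lt with rfl | hx
  · simpa using summable_zero
  have h1 : (L : ℝ) < 1 / x := by rwa [lt_div_iff₀ hx]
  obtain ⟨r, hr1, hr2⟩ := exists_between h1
  have hr0 : 0 < r := lt_of_le_of_lt L.2 hr1
  have h2 : Filter.limsup (fun j : ℕ => ENNReal.ofReal (T j ^ ((j : ℝ)⁻¹))) Filter.atTop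
      < ENNReal.ofReal r := by
    rw [hL, ← ENNReal.ofReal_coe_nnreal]
    exact (ENNReal.ofReal_lt_ofReal_iff hr0).2 hr1
  have h3 := Filter.eventually_lt_of_limsup_lt h2
  have hrx : r * x < 1 := by rwa [lt_div_iff₀ hx] at hr2
  have key : Summable (fun j : ℕ => T j * x ^ j) := by
    refine Summable.of_norm_bounded_eventually_nat (g := fun j => (r * x) ^ j)
      (summable_geometric_of_lt_one (by positivity) hrx) ?_
    filter_upwards [h3, Filter.eventually_gt_atTop 0] with j hj hj0
    have hj' := (ENNReal.ofReal_lt_ofReal_iff hr0).1 hj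
    have : T j ≤ r ^ j := by
      have := pow_le_pow_left₀ (Real.rpow_nonneg (hT j) _) hj'.le j
      rwa [Real.rpow_inv_natCast_pow (hT j) hj0.ne'] at this
    rw [Real.norm_of_nonneg (mul_nonneg (hT j) (by positivity)), mul_pow]
    gcongr
  exact (summable_nat_add_iff 1).2 key

lemma tok_strictMono (T : ℕ → ℝ) (hT : ∀ j, 0 ≤ T j) {x y : ℝ} (hx : 0 ≤ x) (hxy : x < y)
    (sx : Summable (fun j : ℕ => T (j + 1) * x ^ (j + 1)))
    (sy : Summable (fun j : ℕ => T (j + 1) * y ^ (j + 1))) : tokHat T x < tokHat T y := by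
  have := sx.tsum_le_tsum (fun j => mul_le_mul_of_nonneg_left
    (pow_le_pow_left₀ hx hxy.le (j + 1)) (hT (j + 1))) sy
  unfold tokHat
  linarith

lemma tok_ge (T : ℕ → ℝ) (hT : ∀ j, 0 ≤ T j) {x : ℝ} (hx : 0 ≤ x) : -1 ≤ tokHat T x := by
  have : 0 ≤ ∑' j : ℕ, T (j + 1) * x ^ (j + 1) :=
    tsum_nonneg fun j => mul_nonneg (hT _) (by positivity)
  unfold tokHat
  linarith

lemma cone_tok (T : ℕ → ℝ) (hT : ∀ j, 0 ≤ T j) {ζ : ℝ} (hζ : 1 ≤ ζ)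
    (hs : ∀ y, 0 ≤ y → y < 1 → Summable (fun j : ℕ => T (j + 1) * (y / ζ) ^ (j + 1))) :
    Cone (fun y => 1 + tokHat T (y / ζ)) := by
  have c1 : Cone (fun y => 2 * (y / ζ)) := by
    refine ⟨fun n => if n = 1 then 2 / ζ else 0, fun n => ?_, fun y _ _ => ?_⟩
    · dsimp only; split_ifs <;> positivity
    · convert hasSum_single (f := fun n : ℕ => (if n = 1 then 2 / ζ else 0) * y ^ n) 1 ?_ using 1
      · simp; ring
      · intro n hn; simp [hn]
  have c2 : Cone (fun y => ∑' j : ℕ, T (j + 1) * (y / ζ) ^ (j + 1)) := by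
    refine ⟨fun n => if n = 0 then 0 else T n / ζ ^ n, fun n => ?_, fun y h0 h1 => ?_⟩
    · dsimp only; split_ifs
      · exact le_rfl
      · exact div_nonneg (hT n) (by positivity)
    · rw [← hasSum_nat_add_iff' 1]
      simp only [Finset.range_one, Finset.sum_singleton, if_true, zero_mul, sub_zero]
      refine Eq.mp (congrArg (fun F => HasSum F _) (funext fun n => ?_)) (hs y h0 h1).hasSum
      simp [div_pow]; ring
  convert c1.add c2 using 2
  unfold tokHat; ring

/-- The operator `(A f)(y) = t̂(y/ζ) f(y/ζ)`. -/
noncomputable def A (T : ℕ → ℝ) (ζ : ℝ) : Module.End ℝ (ℝ → ℝ) where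
  toFun f := fun y => tokHat T (y / ζ) * f (y / ζ)
  map_add' f g := by funext y; simp [mul_add]
  map_smul' c f := by funext y; simp; ring

/-- `h m = A^m (1/(1-y))` explicitly. -/
noncomputable def h (T : ℕ → ℝ) (ζ : ℝ) (m : ℕ) (y : ℝ) : ℝ :=
  (∏ i ∈ Finset.Icc 1 m, tokHat T (y / ζ ^ i)) * (1 / (1 - y / ζ ^ m))

lemma h_succ (T : ℕ → ℝ) (ζ : ℝ) (m : ℕ) (y : ℝ) :
    h T ζ (m + 1) y = tokHat T (y / ζ) * h T ζ m (y / ζ) := by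
  unfold h
  simp only [← Finset.Ico_add_one_right_eq_Icc]
  rw [Finset.prod_eq_prod_Ico_succ_bot (by omega), ← Finset.prod_Ico_add' _ 1 (m + 1) 1]
  simp only [div_div, pow_succ', mul_assoc, pow_zero, mul_one]

lemma h_eq (T : ℕ → ℝ) (ζ : ℝ) (m : ℕ) : h T ζ m = (A T ζ ^ m) (h T ζ 0) := by
  induction m with
  | zero => simp
  | succ m ih =>
    rw [pow_succ', Module.End.mul_apply, ← ih]
    funext y
    exact h_succ T ζ m y

lemma cone_iter (T : ℕ → ℝ) (hT : ∀ j, 0 ≤ T j) {ζ : ℝ} (hζ : 1 ≤ ζ)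
    (hs : ∀ y, 0 ≤ y → y < 1 → Summable (fun j : ℕ => T (j + 1) * (y / ζ) ^ (j + 1))) (m : ℕ) :
    Cone (((A T ζ + 1) ^ m) (h T ζ 0)) := by
  induction m with
  | zero =>
    refine ⟨fun _ => 1, fun _ => zero_le_one, fun y h0 h1 => ?_⟩
    simpa [h] using hasSum_geometric_of_lt_one h0 h1
  | succ m ih =>
    rw [pow_succ', Module.End.mul_apply]
    set f := ((A T ζ + 1) ^ m) (h T ζ 0)
    convert (ih.sub hζ).add ((cone_tok T hT hζ hs).mul (ih.comp hζ)) using 1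
    funext y
    simp [A]; ring

lemma binom_nonneg (T : ℕ → ℝ) (hT : ∀ j, 0 ≤ T j) {ζ : ℝ} (hζ : 1 ≤ ζ)
    (hs : ∀ y, 0 ≤ y → y < 1 → Summable (fun j : ℕ => T (j + 1) * (y / ζ) ^ (j + 1))) (m : ℕ)
    {y : ℝ} (h0 : 0 ≤ y) (h1 : y < 1) :
    0 ≤ ∑ k ∈ Finset.range (m + 1), (m.choose k : ℝ) * h T ζ k y := by
  have := (cone_iter T hT hζ hs m).nonneg h0 h1
  rw [(Commute.one_right (A T ζ)).add_pow] at this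
  convert this using 1
  simp only [one_pow, mul_one, LinearMap.sum_apply, Finset.sum_apply]
  refine Finset.sum_congr rfl fun k _ => ?_
  rw [h_eq T ζ k, ← nsmul_eq_mul', LinearMap.smul_apply]
  simp

/-- Exponential generating series. -/
noncomputable def E (a : ℕ → ℝ) (u : ℝ) : ℝ := ∑' m : ℕ, u ^ m / (m.factorial : ℝ) * a m

lemma E_summable {a : ℕ → ℝ} {K M : ℝ} (ha : ∀ m, |a m| ≤ K * M ^ m) (u : ℝ) :
    Summable (fun m : ℕ => u ^ m / (m.factorial : ℝ) * a m) := by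
  refine Summable.of_norm_bounded (g := fun m : ℕ => K * ((|u| * M) ^ m / (m.factorial : ℝ)))
    ((Real.summable_pow_div_factorial (|u| * M)).mul_left K) fun m => ?_
  rw [norm_mul, norm_div, norm_pow, Real.norm_eq_abs, Real.norm_eq_abs, Real.norm_eq_abs,
    Nat.abs_cast]
  calc |u| ^ m / (m.factorial : ℝ) * |a m| ≤ |u| ^ m / (m.factorial : ℝ) * (K * M ^ m) := by
        gcongr; exact ha m
    _ = _ := by rw [mul_pow]; ring

lemma E_pos {a : ℕ → ℝ} {K M : ℝ} (ha : ∀ m, |a m| ≤ K * M ^ m) (h0 : 0 < a 0)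
    (hb : ∀ m, 0 ≤ ∑ k ∈ Finset.range (m + 1), (m.choose k : ℝ) * a k) {u : ℝ} (hu : 0 ≤ u) :
    0 < E a u := by
  have s1 := E_summable ha u
  have s2 : Summable (fun m : ℕ => u ^ m / (m.factorial : ℝ)) := Real.summable_pow_div_factorial u
  have e := tsum_mul_tsum_eq_tsum_sum_range_of_summable_norm s1.norm s2.norm
  have e2 := (summable_norm_sum_mul_range_of_summable_norm s1.norm s2.norm).of_norm
  have e3 : ∀ n : ℕ, ∑ k ∈ Finset.range (n + 1), u ^ k / (k.factorial : ℝ) * a k *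
      (u ^ (n - k) / ((n - k).factorial : ℝ)) = u ^ n / (n.factorial : ℝ) *
      ∑ k ∈ Finset.range (n + 1), (n.choose k : ℝ) * a k := by
    intro n
    rw [Finset.mul_sum]
    refine Finset.sum_congr rfl fun k hk => ?_
    have hk : k ≤ n := by simpa [Nat.lt_succ_iff] using hk
    rw [Nat.cast_choose ℝ hk]
    have hn : u ^ n = u ^ k * u ^ (n - k) := by rw [← pow_add]; congr 1; omega
    rw [hn]
    have := Nat.factorial_pos n
    field_simp
  simp only [e3] at e e2
  have p1 : 0 < E a u * ∑' m : ℕ, u ^ m / (m.factorial : ℝ) := by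
    unfold E
    rw [e]
    refine e2.tsum_pos (fun n => mul_nonneg (by positivity) (hb n)) 0 ?_
    simpa using h0
  exact pos_of_mul_pos_left p1 (tsum_nonneg fun m => by positivity)

lemma E_deriv {a : ℕ → ℝ} {K M : ℝ} (ha : ∀ m, |a m| ≤ K * M ^ m) (u : ℝ) :
    HasDerivAt (E a) (E (fun m => a (m + 1)) u) u := by
  have ha' : ∀ m, |(fun m => |a (m + 1)|) m| ≤ (K * M) * M ^ m := fun m => by
    rw [abs_abs]; refine (ha (m + 1)).trans (le_of_eq (by ring))
  have ha1 : ∀ m, |a (m + 1)| ≤ (K * M) * M ^ m := fun m =>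
    (ha (m + 1)).trans (le_of_eq (by ring))
  have s := E_summable ha' (|u| + 1)
  have main : HasDerivAt (fun x => ∑' m : ℕ, x ^ (m + 1) / ((m + 1).factorial : ℝ) * a (m + 1))
      (∑' m : ℕ, u ^ m / (m.factorial : ℝ) * a (m + 1)) u := by
    refine hasDerivAt_tsum_of_isPreconnected (F := ℝ)
      (g := fun (m : ℕ) (x : ℝ) => x ^ (m + 1) / ((m + 1).factorial : ℝ) * a (m + 1))
      (g' := fun (m : ℕ) (x : ℝ) => x ^ m / (m.factorial : ℝ) * a (m + 1)) (t := Metric.ball (0 : ℝ) (|u| + 1)) s Metric.isOpen_ball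
      (convex_ball (0 : ℝ) (|u| + 1)).isPreconnected (y₀ := (0 : ℝ)) (fun m x _ => ?_) (fun m x hx => ?_) ?_ ?_ ?_
    · have := (((hasDerivAt_pow (m + 1) x).div_const ((m + 1).factorial : ℝ)).mul_const (a (m + 1)))
      refine Eq.mp (congrArg (fun F => HasDerivAt _ F x) ?_) this
      rw [Nat.factorial_succ]
      have := Nat.factorial_pos m
      push_cast
      field_simp
    · have hx' : |x| ≤ |u| + 1 := by simpa using (Metric.mem_ball.1 hx).le
      rw [norm_mul, norm_div, norm_pow, Real.norm_eq_abs, Real.norm_eq_abs, Real.norm_eq_abs,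
        Nat.abs_cast]
      gcongr
    · simp; positivity
    · simpa using summable_zero
    · simp; 
  have hE : E a = fun x => a 0 + ∑' m : ℕ, x ^ (m + 1) / ((m + 1).factorial : ℝ) * a (m + 1) := by
    funext x
    unfold E
    rw [(E_summable ha x).tsum_eq_zero_add]
    simp
  rw [hE]
  exact main.const_add (a 0)

lemma E_smul (c : ℝ) (a : ℕ → ℝ) (u : ℝ) : E (fun m => c * a m) u = c * E a u := by
  unfold E
  rw [← tsum_mul_left]
  exact tsum_congr fun m => by ring

lemma h_bound (T : ℕ → ℝ) (hT : ∀ j, 0 ≤ T j) {ζ : ℝ} (hζ : 1 ≤ ζ)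
    (hs : ∀ y, 0 ≤ y → y < 1 → Summable (fun j : ℕ => T (j + 1) * (y / ζ) ^ (j + 1)))
    {y : ℝ} (h0 : 0 ≤ y) (h1 : y < 1) (m : ℕ) :
    |h T ζ m y| ≤ (1 / (1 - y)) * (2 + tokHat T (y / ζ)) ^ m := by
  have hζ0 : 0 < ζ := by linarith
  have b : ∀ i ∈ Finset.Icc 1 m, |tokHat T (y / ζ ^ i)| ≤ 2 + tokHat T (y / ζ) := by
    intro i hi
    obtain ⟨k, rfl⟩ : ∃ k, i = k + 1 := ⟨i - 1, by have := (Finset.mem_Icc.1 hi).1; omega⟩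
    have e : y / ζ ^ (k + 1) = y / ζ ^ k / ζ := by rw [pow_succ, div_div]
    have hk0 : 0 ≤ y / ζ ^ k := by positivity
    have hk1 : y / ζ ^ k ≤ y := div_le_self h0 (one_le_pow₀ hζ)
    have hle : y / ζ ^ k / ζ ≤ y / ζ := by gcongr
    have hm : tokHat T (y / ζ ^ k / ζ) ≤ tokHat T (y / ζ) := by
      rcases hle.eq_or_lt with hh | hh
      · rw [hh]
      · exact (tok_strictMono T hT (by positivity) hh (hs _ hk0 (by linarith)) (hs _ h0 h1)).le
    have h3 := tok_ge T hT (x := y / ζ ^ k / ζ) (by positivity)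
    rw [e, abs_le]
    constructor <;> linarith
  unfold h
  have hm1 : y / ζ ^ m ≤ y := div_le_self h0 (one_le_pow₀ hζ)
  rw [abs_mul, mul_comm, Finset.abs_prod, abs_of_nonneg (a := 1 / (1 - y / ζ ^ m))
    (div_nonneg zero_le_one (by linarith))]
  refine mul_le_mul ?_ ?_ (Finset.prod_nonneg fun i _ => abs_nonneg _)
    (div_nonneg zero_le_one (by linarith))
  · exact one_div_le_one_div_of_le (by linarith) (by linarith)
  · refine (Finset.prod_le_prod (fun i _ => abs_nonneg _) b).trans (le_of_eq ?_)
    simp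

end Tok

/-- Average progeny of a self-similar hierarchical branching process: with
`R = 1/w₀` the reciprocal of the real zero of the Tokunaga generating function,
the series defining `C(s)` converges for all `s ≥ 0`, and `C` is strictly
decreasing if `p > 1 - ζ/R`, constant `≡ 1` if `p = 1 - ζ/R`, and strictly
increasing if `p < 1 - ζ/R`.  (Here `ζ/R = ζ·w₀`.) -/
theorem stmt6 (T : ℕ → ℝ) (hT : ∀ j, 0 ≤ T j) (L : NNReal)
    (hL : Filter.limsup (fun j : ℕ => ENNReal.ofReal (T j ^ ((j : ℝ)⁻¹))) Filter.atTop
      = (L : ℝ≥0∞))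
    (w₀ : ℝ) (hw₀ : 0 < w₀) (hw₀' : w₀ ≤ 1 / 2)
    (hLw₀ : (L : ℝ) * w₀ < 1)
    (hroot : tokHat T w₀ = 0)
    (p γ ζ : ℝ) (hp0 : 0 < p) (hp1 : p < 1) (hγ : 0 < γ)
    (hζ : max 1 (L : ℝ) ≤ ζ) :
    (∀ s : ℝ, 0 ≤ s → Summable (fun m : ℕ => progenyTerm T p γ ζ s (m + 1))) ∧
    (1 - ζ * w₀ < p → StrictAntiOn (avgProgeny T p γ ζ) (Set.Ici 0)) ∧
    (p = 1 - ζ * w₀ → ∀ s : ℝ, 0 ≤ s → avgProgeny T p γ ζ s = 1) ∧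
    (p < 1 - ζ * w₀ → StrictMonoOn (avgProgeny T p γ ζ) (Set.Ici 0)) := by
  have hζ1 : 1 ≤ ζ := (le_max_left _ _).trans hζ
  have hζL : (L : ℝ) ≤ ζ := (le_max_right _ _).trans hζ
  have hζ0 : 0 < ζ := by linarith
  have hsum := Tok.summ T hT L hL
  have hs : ∀ y, 0 ≤ y → y < 1 → Summable (fun j : ℕ => T (j + 1) * (y / ζ) ^ (j + 1)) := by
    intro y h0 h1
    refine hsum _ (by positivity) ?_
    have : (L : ℝ) * (y / ζ) ≤ ζ * (y / ζ) := by gcongr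
    have e : ζ * (y / ζ) = y := by field_simp
    linarith
  have q0 : 0 ≤ 1 - p := by linarith
  have q1 : 1 - p < 1 := by linarith
  have x01 := Tok.div_mem hζ1 q0 q1
  set x := (1 - p) / ζ with hx
  have hb := Tok.h_bound T hT hζ1 hs q0 q1
  have hbx := Tok.h_bound T hT hζ1 hs x01.1 x01.2
  have hterm : ∀ s m, progenyTerm T p γ ζ s m =
      p * ((s * γ / ζ) ^ m / (m.factorial : ℝ) * Tok.h T ζ m (1 - p)) := by
    intro s m
    unfold progenyTerm Tok.h
    ring
  have hC : avgProgeny T p γ ζ = fun s => p * Tok.E (fun m => Tok.h T ζ m (1 - p)) (s * γ / ζ) := by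
    funext s
    unfold avgProgeny Tok.E
    rw [(Tok.E_summable hb (s * γ / ζ)).tsum_eq_zero_add, mul_add, ← tsum_mul_left]
    simp only [hterm]
    congr 1
    simp [Tok.h]
    field_simp
  have hderiv : ∀ s, HasDerivAt (avgProgeny T p γ ζ)
      (p * (tokHat T x * Tok.E (fun m => Tok.h T ζ m x) (s * γ / ζ) * (γ / ζ))) s := by
    intro s
    rw [hC]
    have h1 := Tok.E_deriv hb (s * γ / ζ)
    simp only [Tok.h_succ] at h1
    rw [Tok.E_smul] at h1
    have h2 : HasDerivAt (fun s : ℝ => s * γ / ζ) (γ / ζ) s := by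
      simpa using ((hasDerivAt_id s).mul_const γ).div_const ζ
    exact (HasDerivAt.comp s h1 h2).const_mul p
  have hpos : ∀ s, 0 ≤ s → 0 < Tok.E (fun m => Tok.h T ζ m x) (s * γ / ζ) := by
    intro s hs0
    refine Tok.E_pos hbx ?_ (fun m => Tok.binom_nonneg T hT hζ1 hs m x01.1 x01.2) (by positivity)
    have := x01.2
    simp [Tok.h]
    linarith
  have hcont : ContinuousOn (avgProgeny T p γ ζ) (Set.Ici 0) :=
    fun s _ => (hderiv s).continuousAt.continuousWithinAt
  refine ⟨fun s _ => ?_, fun hlt => ?_, fun heq s _ => ?_, fun hlt => ?_⟩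
  · simp only [hterm]
    exact ((summable_nat_add_iff 1).2 (Tok.E_summable hb (s * γ / ζ))).mul_left p
  · have hxw : x < w₀ := by rw [hx, div_lt_iff₀ hζ0]; linarith
    have ht := Tok.tok_strictMono T hT x01.1 hxw (hs _ q0 q1) (hsum _ hw₀.le hLw₀)
    rw [hroot] at ht
    refine strictAntiOn_of_deriv_neg (convex_Ici 0) hcont fun s hs' => ?_
    rw [interior_Ici] at hs'
    rw [(hderiv s).deriv]
    have hp := hpos s (le_of_lt hs')
    have : 0 < p * (-tokHat T x * Tok.E (fun m => Tok.h T ζ m x) (s * γ / ζ) * (γ / ζ)) := by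
      have : 0 < -tokHat T x := by linarith
      positivity
    linarith
  · have hxw : x = w₀ := by rw [hx, div_eq_iff hζ0.ne']; linarith
    unfold avgProgeny
    simp only [hterm, Tok.h_succ, ← hx]
    simp [hxw, hroot]
  · have hxw : w₀ < x := by rw [hx, lt_div_iff₀ hζ0]; linarith
    have ht := Tok.tok_strictMono T hT hw₀.le hxw (hsum _ hw₀.le hLw₀) (hs _ q0 q1)
    rw [hroot] at ht
    refine strictMonoOn_of_deriv_pos (convex_Ici 0) hcont fun s hs' => ?_
    rw [interior_Ici] at hs'
    rw [(hderiv s).deriv]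
    have hp := hpos s (le_of_lt hs')
    positivity
end

section
/- Fix an integer K ≥ 1 and nonnegative reals T_1, ..., T_{K−1}; set t(1) = T_1 + 2 and t(j) = T_j for 2 ≤ j ≤ K−1. Let x_1, ..., x_K : [0,∞) → ℝ be differentiable functions with x_K(0) = 1, x_k(0) = 0 for 1 ≤ k < K, x_K'(s) = −x_K(s), and x_k'(s) = −x_k(s) + sum_{j=1}^{K−k} t(j)·x_{k+j}(s) for 1 ≤ k < K. Then x_K(s) = e^{−s} for all s ≥ 0, and for every 1 ≤ m ≤ K−1 and all s ≥ 0, x_{K−m}(s) = e^{−s}·sum_{n=1}^{m} ( sum over n-tuples of positive integers i_1, ..., i_n with i_1 + ... + i_n = m of t(i_1)·...·t(i_n) )·s^n/n!. -/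
/-- The `n`-fold convolution of `t` evaluated at `m`. -/
noncomputable def cnv (t : ℕ → ℝ) (n m : ℕ) : ℝ :=
  ∑ f ∈ (Finset.Nat.antidiagonalTuple n m).filter (fun f => ∀ i, 1 ≤ f i), ∏ i, t (f i)

lemma cnv_zero_zero (t : ℕ → ℝ) : cnv t 0 0 = 1 := by
  simp [cnv]

lemma cnv_zero_pos (t : ℕ → ℝ) (m : ℕ) (hm : 1 ≤ m) : cnv t 0 m = 0 := by
  obtain ⟨k, rfl⟩ := Nat.exists_eq_add_of_le' hm
  simp [cnv]

lemma cnv_lt (t : ℕ → ℝ) (n m : ℕ) (h : m < n) : cnv t n m = 0 := by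
  unfold cnv
  apply Finset.sum_eq_zero
  intro f hf
  exfalso
  rw [Finset.mem_filter, Finset.Nat.mem_antidiagonalTuple] at hf
  have h2 : ∑ i : Fin n, 1 ≤ ∑ i, f i := Finset.sum_le_sum (fun i _ => hf.2 i)
  simp at h2
  omega

lemma cnv_succ (t : ℕ → ℝ) (n m : ℕ) :
    cnv t (n + 1) m = ∑ j ∈ Finset.Icc 1 m, t j * cnv t n (m - j) := by
  unfold cnv
  simp_rw [Finset.mul_sum]
  rw [Finset.sum_sigma']
  refine Finset.sum_bij' (fun f _ => ⟨f 0, Fin.tail f⟩) (fun p _ => Fin.cons p.1 p.2) ?_ ?_ ?_ ?_ ?_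
  · intro f hf
    rw [Finset.mem_filter, Finset.Nat.mem_antidiagonalTuple, Fin.sum_univ_succ] at hf
    have h0 := hf.2 0
    simp only [Finset.mem_sigma, Finset.mem_Icc, Finset.mem_filter,
      Finset.Nat.mem_antidiagonalTuple, Fin.tail]
    refine ⟨⟨h0, by omega⟩, by omega, fun i => hf.2 _⟩
  · rintro ⟨j, g⟩ hf
    simp only [Finset.mem_sigma, Finset.mem_Icc, Finset.mem_filter,
      Finset.Nat.mem_antidiagonalTuple] at hf
    simp only [Finset.mem_filter, Finset.Nat.mem_antidiagonalTuple, Fin.sum_univ_succ,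
      Fin.cons_zero, Fin.cons_succ, Fin.forall_fin_succ]
    refine ⟨by omega, hf.1.1, hf.2.2⟩
  · intro f hf
    simp
  · rintro ⟨j, g⟩ hf
    simp
  · intro f hf
    simp [Fin.prod_univ_succ, Fin.tail]

/-- The generating polynomial. -/
noncomputable def qpol (t : ℕ → ℝ) (N m : ℕ) (s : ℝ) : ℝ :=
  ∑ n ∈ Finset.range N, cnv t n m * (s ^ n / (Nat.factorial n : ℝ))

lemma qpol_stable (t : ℕ → ℝ) (N m : ℕ) (s : ℝ) (h : m < N) :
    qpol t (N + 1) m s = qpol t N m s := by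
  unfold qpol
  rw [Finset.sum_range_succ, cnv_lt t N m h]
  simp

lemma qpol_eq (t : ℕ → ℝ) (N m : ℕ) (s : ℝ) (h : m < N) :
    qpol t N m s = qpol t (m + 1) m s := by
  induction N, h using Nat.le_induction with
  | base => rfl
  | succ k hk ih => rw [qpol_stable t k m s hk, ih]

lemma qpol_Icc (t : ℕ → ℝ) (N m : ℕ) (s : ℝ) (h : m < N) (hm : 1 ≤ m) :
    qpol t N m s = ∑ n ∈ Finset.Icc 1 m, cnv t n m * s ^ n / (Nat.factorial n : ℝ) := by
  rw [qpol_eq t N m s h]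
  unfold qpol
  rw [Finset.sum_range_succ', cnv_zero_pos t m hm, zero_mul, add_zero,
    ← Finset.Ico_add_one_right_eq_Icc, Finset.sum_Ico_eq_sum_range]
  refine Finset.sum_congr (by simp) fun n _ => ?_
  rw [add_comm 1 n, mul_div_assoc]

lemma qpol_at_zero (t : ℕ → ℝ) (N m : ℕ) : qpol t (N + 1) m 0 = cnv t 0 m := by
  unfold qpol
  rw [Finset.sum_range_succ']
  simp

lemma qpol_zero (t : ℕ → ℝ) (N : ℕ) (s : ℝ) (hN : 0 < N) : qpol t N 0 s = 1 := by
  rw [qpol_eq t N 0 s hN]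
  simp [qpol, cnv_zero_zero]

lemma qpol_deriv (t : ℕ → ℝ) (N m : ℕ) (s : ℝ) (h : m ≤ N) :
    HasDerivAt (qpol t (N + 1) m)
      (∑ j ∈ Finset.Icc 1 m, t j * qpol t (N + 1) (m - j) s) s := by
  have h1 : qpol t (N + 1) m = fun s => (∑ n ∈ Finset.range N, cnv t (n + 1) m *
      (s ^ (n + 1) / (Nat.factorial (n + 1) : ℝ))) + cnv t 0 m := by
    funext s
    unfold qpol
    rw [Finset.sum_range_succ']
    simp
  have h2 : ∑ j ∈ Finset.Icc 1 m, t j * qpol t (N + 1) (m - j) s =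
      ∑ n ∈ Finset.range N, cnv t (n + 1) m * (s ^ n / (Nat.factorial n : ℝ)) := by
    simp_rw [cnv_succ, Finset.sum_mul]
    rw [Finset.sum_comm]
    refine Finset.sum_congr rfl fun j hj => ?_
    rw [Finset.mem_Icc] at hj
    rw [qpol_stable t N (m - j) s (by omega), qpol, Finset.mul_sum]
    exact Finset.sum_congr rfl fun n _ => by ring
  rw [h1, h2]
  apply HasDerivAt.add_const
  apply HasDerivAt.fun_sum
  intro n _
  apply HasDerivAt.const_mul
  have h3 := (hasDerivAt_pow (n + 1) s).div_const (Nat.factorial (n + 1) : ℝ)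
  convert h3 using 1
  rw [Nat.factorial_succ]
  have : (Nat.factorial n : ℝ) ≠ 0 := by positivity
  push_cast
  have : (n : ℝ) + 1 ≠ 0 := by positivity
  field_simp

lemma main_aux (K : ℕ) (hK : 1 ≤ K) (t : ℕ → ℝ) (x : ℕ → ℝ → ℝ)
    (hxK0 : x K 0 = 1)
    (hx0 : ∀ k : ℕ, 1 ≤ k → k < K → x k 0 = 0)
    (hder : ∀ k : ℕ, 1 ≤ k → k ≤ K → ∀ s ∈ Set.Ici (0 : ℝ),
      HasDerivWithinAt (x k)
        (-(x k s) + ∑ j ∈ Finset.Icc 1 (K - k), t j * x (k + j) s)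
        (Set.Ici 0) s) (m : ℕ) :
    m < K → ∀ s ∈ Set.Ici (0 : ℝ), x (K - m) s = Real.exp (-s) * qpol t (K + 1) m s := by
  induction m using Nat.strong_induction_on with
  | _ m ih =>
  intro hm s hs
  have hd : ∀ u ∈ Set.Ici (0 : ℝ), HasDerivWithinAt
      (fun u => Real.exp u * x (K - m) u - qpol t (K + 1) m u) 0 (Set.Ici 0) u := by
    intro u hu
    have h1 := ((Real.hasDerivAt_exp u).hasDerivWithinAt (s := Set.Ici 0)).mul
      (hder (K - m) (by omega) (by omega) u hu)
    have h2 := h1.sub (qpol_deriv t K m u hm.le).hasDerivWithinAt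
    refine h2.congr_deriv ?_
    have h3 : ∑ j ∈ Finset.Icc 1 (K - (K - m)), t j * x (K - m + j) u =
        Real.exp (-u) * ∑ j ∈ Finset.Icc 1 m, t j * qpol t (K + 1) (m - j) u := by
      rw [show K - (K - m) = m by omega, Finset.mul_sum]
      refine Finset.sum_congr rfl fun j hj => ?_
      rw [Finset.mem_Icc] at hj
      rw [show K - m + j = K - (m - j) by omega, ih (m - j) (by omega) (by omega) u hu]
      ring
    rw [h3, mul_add, ← mul_assoc (Real.exp u) (Real.exp (-u)), ← Real.exp_add]
    simp
  have h0 : Real.exp 0 * x (K - m) 0 - qpol t (K + 1) m 0 = 0 := by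
    rw [qpol_at_zero]
    rcases Nat.eq_zero_or_pos m with rfl | hp
    · simp [cnv_zero_zero, hxK0]
    · rw [cnv_zero_pos t m hp, hx0 (K - m) (by omega) (by omega)]
      simp
  have hc := constant_of_has_deriv_right_zero (a := 0) (b := s)
    (f := fun u => Real.exp u * x (K - m) u - qpol t (K + 1) m u)
    (fun u hu => ((hd u hu.1).continuousWithinAt).mono Set.Icc_subset_Ici_self)
    (fun u hu => (hd u hu.1).mono (Set.Ici_subset_Ici.2 hu.1)) s ⟨hs, le_rfl⟩
  simp only [h0] at hc
  rw [← sub_eq_zero.1 hc, ← mul_assoc, ← Real.exp_add]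
  simp

/-- Closed form solution of the finite triangular ODE system describing the
hydrodynamic limit of the hierarchical branching process with unit rates:
`x_K(s) = e^{-s}` and
`x_{K-m}(s) = e^{-s}·∑_{n=1}^m (∑_{i₁+⋯+i_n=m, i_j≥1} t(i₁)⋯t(i_n))·sⁿ/n!`,
where `t(1) = T₁ + 2` and `t(j) = T_j` for `j ≥ 2`. -/
theorem stmt7 (K : ℕ) (hK : 1 ≤ K) (T : ℕ → ℝ) (hT : ∀ j, 0 ≤ T j)
    (x : ℕ → ℝ → ℝ)
    (hxK0 : x K 0 = 1)
    (hx0 : ∀ k : ℕ, 1 ≤ k → k < K → x k 0 = 0)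
    (hder : ∀ k : ℕ, 1 ≤ k → k ≤ K → ∀ s ∈ Set.Ici (0 : ℝ),
      HasDerivWithinAt (x k)
        (-(x k s) + ∑ j ∈ Finset.Icc 1 (K - k),
          (if j = 1 then T 1 + 2 else T j) * x (k + j) s)
        (Set.Ici 0) s) :
    (∀ s ∈ Set.Ici (0 : ℝ), x K s = Real.exp (-s)) ∧
    (∀ m : ℕ, 1 ≤ m → m ≤ K - 1 → ∀ s ∈ Set.Ici (0 : ℝ),
      x (K - m) s = Real.exp (-s) *
        ∑ n ∈ Finset.Icc 1 m,
          (∑ f ∈ (Finset.Nat.antidiagonalTuple n m).filter (fun f => ∀ i, 1 ≤ f i),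
            ∏ i, (if f i = 1 then T 1 + 2 else T (f i)))
          * s ^ n / (Nat.factorial n : ℝ)) := by
  have key := main_aux K hK (fun j => if j = 1 then T 1 + 2 else T j) x hxK0 hx0 hder
  refine ⟨fun s hs => ?_, fun m hm hmK s hs => ?_⟩
  · have h := key 0 (by omega) s hs
    rw [qpol_zero _ _ _ (by omega)] at h
    simpa using h
  · rw [key m (by omega) s hs, qpol_Icc _ _ _ _ (by omega) hm]
    rfl
end

section
/- Let c > 0 and let (a_k)_{k≥0} be a sequence of strictly positive reals with a_0 = 1/c such that for every integer n ≥ 1 the series sum_{j=1}^∞ 2^{−j}·prod_{k=j}^{n+j−1} a_k converges and equals prod_{k=0}^{n−1} a_k. Then a_k = 1/c for every k ≥ 0. -/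
theorem hasSum_real_congr {f g : ℕ → ℝ} {x : ℝ} (h : HasSum g x)
    (e : ∀ j, f j = g j) : HasSum f x := by
  rwa [funext e]

/-- Uniqueness of the solution of the time-invariance system for the geometric
branching process: if `a₀ = 1/c > 0` and for every `n ≥ 1`
`∑_{j=1}^∞ 2^{-j}·∏_{k=j}^{n+j-1} a_k = ∏_{k=0}^{n-1} a_k` (with the series
converging), then `a_k = 1/c` for all `k`. -/
theorem stmt8 (c : ℝ) (hc : 0 < c) (a : ℕ → ℝ)
    (ha : ∀ k, 0 < a k) (ha0 : a 0 = 1 / c)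
    (hsys : ∀ n : ℕ, 1 ≤ n →
      HasSum (fun j : ℕ =>
          (2 : ℝ)⁻¹ ^ (j + 1) * ∏ k ∈ Finset.Ico (j + 1) (n + (j + 1)), a k)
        (∏ k ∈ Finset.range n, a k)) :
    ∀ k, a k = 1 / c := by
  obtain ⟨w, hw⟩ : ∃ w : ℕ → ℝ, w = fun j =>
      (2 : ℝ)⁻¹ ^ (j + 1) / ∏ k ∈ Finset.range (j + 1), a k := ⟨_, rfl⟩
  obtain ⟨Q, hQ⟩ : ∃ Q : ℕ → ℕ → ℝ, Q = fun n j =>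
      ∏ i ∈ Finset.range (j + 1), a (n + i) := ⟨_, rfl⟩
  have hP : ∀ n, 0 < ∏ k ∈ Finset.range n, a k := fun n =>
    Finset.prod_pos fun k _ => ha k
  have hwpos : ∀ j, 0 < w j := by
    intro j
    rw [hw]
    exact div_pos (by positivity) (hP _)
  have hQpos : ∀ n j, 0 < Q n j := by
    intro n j
    rw [hQ]
    exact Finset.prod_pos fun k _ => ha _
  have hQ0 : ∀ n, Q n 0 = a n := by
    intro n
    simp [hQ]
  have hQs : ∀ n j, Q n j * a (n + (j + 1)) = a n * Q (n + 1) j := by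
    intro n j
    have h1 : Q n j * a (n + (j + 1)) = Q n (j + 1) := by
      rw [hQ]
      exact (Finset.prod_range_succ (fun i => a (n + i)) (j + 1)).symm
    have h2 : Q n (j + 1) = a n * Q (n + 1) j := by
      simp only [hQ]
      rw [Finset.prod_range_succ', mul_comm]
      simp only [add_zero]
      congr 1
      refine Finset.prod_congr rfl fun i _ => ?_
      congr 1
      omega
    rw [h1, h2]
  have hsum1 : ∀ n, HasSum (fun j => w j * Q n j) 1 := by
    intro n
    rcases Nat.eq_zero_or_pos n with rfl | hn
    · have h := hasSum_geometric_two' 1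
      convert h using 2 with j
      simp only [hw, hQ, zero_add]
      rw [div_mul_cancel₀ _ (hP _).ne']
      rw [pow_succ, inv_pow]
      field_simp
    · have h := (hsys n hn).div_const (∏ k ∈ Finset.range n, a k)
      rw [div_self (hP n).ne'] at h
      refine hasSum_real_congr h fun j => ?_
      have e1 : (∏ k ∈ Finset.range (j + 1), a k) *
          ∏ k ∈ Finset.Ico (j + 1) (n + (j + 1)), a k =
          (∏ k ∈ Finset.range n, a k) * Q n j := by
        rw [Finset.prod_range_mul_prod_Ico _ (by omega), hQ, Finset.prod_range_add]
      have p1 := (hP n).ne'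
      have p2 := (hP (j + 1)).ne'
      rw [hw]
      dsimp only
      rw [div_mul_eq_mul_div, div_eq_div_iff p2 p1]
      linear_combination (-(2 : ℝ)⁻¹ ^ (j + 1)) * e1
  have hbd : ∀ n, a n ≤ 1 / w 0 := by
    intro n
    have h := le_hasSum (hsum1 n) 0 (fun j _ => (mul_pos (hwpos j) (hQpos n j)).le)
    rw [hQ0] at h
    rw [le_div_iff₀ (hwpos 0)]
    linarith
  have hB : BddAbove (Set.range a) := ⟨1 / w 0, by rintro _ ⟨n, rfl⟩; exact hbd n⟩
  obtain ⟨v, -, hv, hvm⟩ := exists_seq_tendsto_sSup (Set.range_nonempty a) hB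
  have hM : ∀ n, a n ≤ sSup (Set.range a) := fun n => le_csSup hB ⟨n, rfl⟩
  generalize sSup (Set.range a) = M at hv hM
  have hMpos : 0 < M := (ha 0).trans_le (hM 0)
  choose u hu using hvm
  have hstep : ∀ n, w 0 * a n * (M - a (n + 1)) ≤ M - a n := by
    intro n
    have h2 : HasSum (fun j => w j * Q n j * a (n + (j + 1))) (a n) := by
      have h := (hsum1 (n + 1)).mul_left (a n)
      rw [mul_one] at h
      refine hasSum_real_congr h fun j => ?_
      rw [mul_assoc, hQs]
      ring
    have h3 := ((hsum1 n).mul_right M).sub h2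
    have h4 := le_hasSum h3 0 (fun j _ => by
      have := mul_le_mul_of_nonneg_left (hM (n + (j + 1)))
        (mul_pos (hwpos j) (hQpos n j)).le
      linarith)
    rw [hQ0] at h4
    simp only [zero_add, one_mul] at h4
    linarith
  have hlim : ∀ i, Filter.Tendsto (fun m => a (u m + i)) Filter.atTop (nhds M) := by
    intro i
    induction i with
    | zero => simpa [hu] using hv
    | succ i ih =>
      have hup : Filter.Tendsto
          (fun m => M - (M - a (u m + i)) / (w 0 * a (u m + i))) Filter.atTop (nhds M) := by
        have h := tendsto_const_nhds (x := M) |>.sub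
          ((tendsto_const_nhds (x := M) |>.sub ih).div (ih.const_mul (w 0))
            (mul_pos (hwpos 0) hMpos).ne')
        simpa using h
      refine tendsto_of_tendsto_of_tendsto_of_le_of_le hup tendsto_const_nhds ?_ ?_
      · intro m
        have hp := mul_pos (hwpos 0) (ha (u m + i))
        have h := hstep (u m + i)
        have h' : M - a (u m + (i + 1)) ≤ (M - a (u m + i)) / (w 0 * a (u m + i)) := by
          rw [le_div_iff₀ hp]
          rw [← add_assoc]
          linarith
        dsimp only
        linarith
      · intro m
        exact hM _
  have hfin : ∀ N, ∑ j ∈ Finset.range N, w j * M ^ (j + 1) ≤ 1 := by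
    intro N
    have ht : Filter.Tendsto (fun m => ∑ j ∈ Finset.range N, w j * Q (u m) j)
        Filter.atTop (nhds (∑ j ∈ Finset.range N, w j * M ^ (j + 1))) := by
      refine tendsto_finsetSum _ fun j _ => Filter.Tendsto.const_mul _ ?_
      have h := tendsto_finsetProd (Finset.range (j + 1)) fun i _ => hlim i
      simpa [hQ] using h
    refine le_of_tendsto' ht fun m => ?_
    exact sum_le_hasSum _ (fun j _ => (mul_pos (hwpos j) (hQpos _ j)).le) (hsum1 (u m))
  have hsM : Summable (fun j => w j * M ^ (j + 1)) :=
    summable_of_sum_range_le (fun j => (mul_pos (hwpos j) (by positivity)).le) hfin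
  have htM : ∑' j, w j * M ^ (j + 1) ≤ 1 :=
    Real.tsum_le_of_sum_range_le (fun j => (mul_pos (hwpos j) (by positivity)).le) hfin
  have haM : ∀ n, a n = M := by
    intro n
    refine le_antisymm (hM n) ?_
    have h4 := le_hasSum (hsM.hasSum.sub (hsum1 n)) 0 (fun j _ => by
      have : Q n j ≤ M ^ (j + 1) := by
        rw [hQ]
        calc _ ≤ ∏ i ∈ Finset.range (j + 1), M :=
              Finset.prod_le_prod (fun i _ => (ha _).le) (fun i _ => hM _)
          _ = _ := by simp
      have := mul_le_mul_of_nonneg_left this (hwpos j).le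
      linarith)
    rw [hQ0] at h4
    simp only [zero_add, pow_one] at h4
    have h5 : w 0 * M ≤ w 0 * a n := by linarith
    exact le_of_mul_le_mul_left h5 (hwpos 0)
  intro k
  rw [haM k, ← haM 0, ha0]
end

section
/- Let g_k (k ≥ 1) solve the Smoluchowski–Horton ODE system for Kingman's coalescent. Then for every k ≥ 1 and every t > 0 one has 0 < g_{k+1}(t) < g_k(t). -/
/-- Integrating-factor comparison: `u' = q - p u` with `q ≥ 0`, plus one strictness. -/
theorem linear_ode_pos (p q u : ℝ → ℝ) (hp : ContinuousOn p (Set.Ici 0))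
    (hu : ∀ t ∈ Set.Ici (0 : ℝ), HasDerivWithinAt u (q t - p t * u t) (Set.Ici 0) t)
    (h0 : 0 ≤ u 0) (hq : ∀ t, 0 < t → 0 ≤ q t)
    (hs : 0 < u 0 ∨ ∀ t, 0 < t → 0 < q t) : ∀ t, 0 < t → 0 < u t := by
  have hc : Continuous (fun s : ℝ => p (max 0 s)) :=
    hp.comp_continuous (by fun_prop) (fun s => by simp)
  set P : ℝ → ℝ := fun t => ∫ s in (0 : ℝ)..t, p (max 0 s) with hP
  have hPd : ∀ t, HasDerivAt P (p (max 0 t)) t := fun t =>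
    (hc.integral_hasStrictDerivAt 0 t).hasDerivAt
  have hP0 : P 0 = 0 := by simp [hP]
  have hv : ∀ t ∈ Set.Ici (0 : ℝ),
      HasDerivWithinAt (fun t => u t * Real.exp (P t)) (q t * Real.exp (P t)) (Set.Ici 0) t := by
    intro t ht
    have h := (hu t ht).mul (hPd t).exp.hasDerivWithinAt
    have hm : max 0 t = t := max_eq_right ht
    rw [hm] at h
    refine h.congr_deriv ?_
    ring
  have hcont : ContinuousOn (fun t => u t * Real.exp (P t)) (Set.Ici 0) :=
    fun t ht => (hv t ht).continuousWithinAt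
  have hd : ∀ t, 0 < t → deriv (fun t => u t * Real.exp (P t)) t = q t * Real.exp (P t) :=
    fun t ht => ((hv t ht.le).hasDerivAt (Ici_mem_nhds ht)).deriv
  intro t ht
  have key : 0 < u t * Real.exp (P t) := by
    rcases hs with hs | hs
    · have hmono : MonotoneOn (fun t => u t * Real.exp (P t)) (Set.Ici 0) := by
        refine monotoneOn_of_deriv_nonneg (convex_Ici 0) hcont ?_ ?_
        · intro x hx
          rw [interior_Ici] at hx
          exact ((hv x (Set.mem_Ici.2 (Set.mem_Ioi.1 hx).le)).hasDerivAt
            (Ici_mem_nhds hx)).differentiableAt.differentiableWithinAt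
        · intro x hx
          rw [interior_Ici] at hx
          rw [hd x hx]
          exact mul_nonneg (hq x hx) (Real.exp_pos _).le
      have h := hmono (Set.mem_Ici.2 le_rfl) (Set.mem_Ici.2 ht.le) ht.le
      simp only [hP0, Real.exp_zero, mul_one] at h
      linarith
    · have hmono : StrictMonoOn (fun t => u t * Real.exp (P t)) (Set.Ici 0) := by
        refine strictMonoOn_of_deriv_pos (convex_Ici 0) hcont ?_
        intro x hx
        rw [interior_Ici] at hx
        rw [hd x hx]
        exact mul_pos (hs x hx) (Real.exp_pos _)
      have h := hmono (Set.mem_Ici.2 le_rfl) (Set.mem_Ici.2 ht.le) ht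
      simp only [hP0, Real.exp_zero, mul_one] at h
      linarith
  exact (pos_iff_pos_of_mul_pos key).2 (Real.exp_pos _)

/-- For the Smoluchowski–Horton ODE system of Kingman's coalescent
(`g₁(t) = 2/(t+2)`, `g_{k+1}(0) = 0`,
`g_{k+1}' = g_k²/2 - g_k·g_{k+1}` on `[0,∞)`), one has
`0 < g_{k+1}(t) < g_k(t)` for every `k ≥ 1` and `t > 0`. -/
theorem stmt9 (g : ℕ → ℝ → ℝ)
    (hg1 : ∀ t : ℝ, g 1 t = 2 / (t + 2))
    (hg0 : ∀ k : ℕ, 1 ≤ k → g (k + 1) 0 = 0)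
    (hder : ∀ k : ℕ, 1 ≤ k → ∀ t ∈ Set.Ici (0 : ℝ),
      HasDerivWithinAt (g (k + 1)) (g k t ^ 2 / 2 - g k t * g (k + 1) t)
        (Set.Ici 0) t) :
    ∀ k : ℕ, 1 ≤ k → ∀ t : ℝ, 0 < t →
      0 < g (k + 1) t ∧ g (k + 1) t < g k t := by
  have hg1d : ∀ t ∈ Set.Ici (0 : ℝ), HasDerivWithinAt (g 1) (-(g 1 t ^ 2 / 2)) (Set.Ici 0) t := by
    intro t ht
    have ht2 : t + 2 ≠ 0 := by
      have : (0 : ℝ) ≤ t := ht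
      positivity
    have hfun : g 1 = fun t => 2 / (t + 2) := funext hg1
    rw [hfun]
    have h := ((hasDerivAt_const t (2 : ℝ)).div ((hasDerivAt_id t).add_const 2) ht2)
    refine (h.congr_deriv ?_).hasDerivWithinAt
    simp only [id]
    field_simp
    ring
  have hcont : ∀ k : ℕ, 1 ≤ k → ContinuousOn (g k) (Set.Ici 0) := by
    intro k hk t ht
    rcases Nat.exists_eq_add_of_le' hk with ⟨n, rfl⟩
    rcases n with _ | n
    · exact (hg1d t ht).continuousWithinAt
    · exact (hder (n + 1) (by omega) t ht).continuousWithinAt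
  have hpos : ∀ k : ℕ, 1 ≤ k → ∀ t : ℝ, 0 < t → 0 < g k t := by
    intro k hk
    induction k, hk using Nat.le_induction with
    | base =>
      intro t ht
      rw [hg1]
      positivity
    | succ k hk ih =>
      refine linear_ode_pos (g k) (fun t => g k t ^ 2 / 2) (g (k + 1)) (hcont k hk)
        (hder k hk) (hg0 k hk).ge (fun t _ => by positivity) (Or.inr fun t ht => ?_)
      have := ih t ht
      positivity
  have hlt : ∀ k : ℕ, 1 ≤ k → ∀ t : ℝ, 0 < t → 0 < g k t - g (k + 1) t := by
    intro k hk
    induction k, hk using Nat.le_induction with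
    | base =>
      have h0 : 0 < g 1 0 - g (1 + 1) 0 := by
        rw [hg0 1 le_rfl, hg1]
        norm_num
      refine linear_ode_pos (g 1) (fun _ => 0) (fun t => g 1 t - g (1 + 1) t) (hcont 1 le_rfl)
        (fun t ht => ?_) h0.le (fun t _ => le_rfl) (Or.inl h0)
      refine ((hg1d t ht).sub (hder 1 le_rfl t ht)).congr_deriv ?_
      ring
    | succ k hk ih =>
      refine linear_ode_pos (g (k + 1)) (fun t => (g k t - g (k + 1) t) ^ 2 / 2)
        (fun t => g (k + 1) t - g (k + 1 + 1) t) (hcont (k + 1) (by omega))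
        (fun t ht => ?_) ?_ (fun t _ => by positivity) (Or.inr fun t ht => ?_)
      · refine ((hder k hk t ht).sub (hder (k + 1) (by omega) t ht)).congr_deriv ?_
        ring
      · simp [hg0 k hk, hg0 (k + 1) (by omega)]
      · have := ih t ht
        positivity
  intro k hk t ht
  exact ⟨hpos (k + 1) (by omega) t ht, sub_pos.1 (hlt k hk t ht)⟩
end

section
/- Let g_k (k ≥ 1) solve the Smoluchowski–Horton ODE system for Kingman's coalescent. Then for every k ≥ 1 the functions g_k², g_k·g_{k+1}, and (g_k − g_{k+1})² are integrable on (0,∞), and (1/2)·∫₀^∞ g_k(t)² dt = ∫₀^∞ g_k(t)·g_{k+1}(t) dt and ∫₀^∞ g_{k+1}(t)² dt = ∫₀^∞ (g_k(t) − g_{k+1}(t))² dt. -/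
open MeasureTheory

lemma nonneg_of_lin (f u q : ℝ → ℝ) (hf : ContinuousOn f (Set.Ici 0))
    (hu : ∀ t ∈ Set.Ici (0 : ℝ), HasDerivWithinAt u (q t - f t * u t) (Set.Ici 0) t)
    (hq : ∀ t ∈ Set.Ici (0 : ℝ), 0 ≤ q t) (h0 : 0 ≤ u 0) :
    ∀ t ∈ Set.Ici (0 : ℝ), 0 ≤ u t := by
  have hfc : Continuous (fun s : ℝ => f (max s 0)) := by
    have h := hf.comp_continuous (f := fun s : ℝ => max s 0) (by fun_prop)
      (fun x => le_max_right x 0)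
    exact h
  have hF : ∀ t, HasDerivAt (fun t => ∫ s in (0:ℝ)..t, f (max s 0)) (f (max t 0)) t :=
    fun t => (hfc.integral_hasStrictDerivAt 0 t).hasDerivAt
  set F : ℝ → ℝ := fun t => ∫ s in (0:ℝ)..t, f (max s 0) with hFdef
  have hv : ∀ t ∈ Set.Ici (0 : ℝ),
      HasDerivWithinAt (fun t => u t * Real.exp (F t)) (q t * Real.exp (F t)) (Set.Ici 0) t := by
    intro t ht
    have h := (hu t ht).mul ((hF t).exp.hasDerivWithinAt (s := Set.Ici 0))
    refine h.congr_deriv ?_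
    rw [max_eq_left (Set.mem_Ici.1 ht)]
    ring
  have hmono : MonotoneOn (fun t => u t * Real.exp (F t)) (Set.Ici 0) := by
    refine monotoneOn_of_hasDerivWithinAt_nonneg (convex_Ici 0)
      (fun t ht => (hv t ht).continuousWithinAt) (f' := fun t => q t * Real.exp (F t)) ?_ ?_
    · intro t ht
      exact (hv t (interior_subset ht)).mono interior_subset
    · intro t ht
      exact mul_nonneg (hq t (interior_subset ht)) (Real.exp_pos _).le
  intro t ht
  have h := hmono (Set.mem_Ici.2 le_rfl) ht ht
  have h1 : 0 ≤ u t * Real.exp (F t) := le_trans (mul_nonneg h0 (Real.exp_pos _).le) h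
  exact nonneg_of_mul_nonneg_left h1 (Real.exp_pos _)

lemma integrable_bd : IntegrableOn (fun t : ℝ => (2 / (t + 2)) ^ 2) (Set.Ioi 0) := by
  have hd : ∀ t ∈ Set.Ici (0:ℝ), HasDerivAt (fun t : ℝ => -4 / (t + 2)) ((2 / (t + 2)) ^ 2) t := by
    intro t ht
    have ht' : t + 2 ≠ 0 := by have := Set.mem_Ici.1 ht; positivity
    have h := (hasDerivAt_const t (-4:ℝ)).div ((hasDerivAt_id t).add_const 2) ht'
    refine h.congr_deriv ?_
    simp only [id]
    field_simp
    ring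
  refine integrableOn_Ioi_deriv_of_nonneg (l := 0) (hd 0 Set.self_mem_Ici).continuousAt.continuousWithinAt
    (fun t ht => hd t (Set.mem_Ici.2 (le_of_lt ht))) (fun t _ => sq_nonneg _) ?_
  exact Filter.Tendsto.const_div_atTop (Filter.tendsto_atTop_add_const_right _ _ Filter.tendsto_id) _

/-- For the Smoluchowski–Horton ODE system of Kingman's coalescent, the functions
`g_k²`, `g_k·g_{k+1}` and `(g_k - g_{k+1})²` are integrable on `(0,∞)`, and
`(1/2)∫₀^∞ g_k² = ∫₀^∞ g_k·g_{k+1}` and `∫₀^∞ g_{k+1}² = ∫₀^∞ (g_k - g_{k+1})²`. -/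
theorem stmt10 (g : ℕ → ℝ → ℝ)
    (hg1 : ∀ t : ℝ, g 1 t = 2 / (t + 2))
    (hg0 : ∀ k : ℕ, 1 ≤ k → g (k + 1) 0 = 0)
    (hder : ∀ k : ℕ, 1 ≤ k → ∀ t ∈ Set.Ici (0 : ℝ),
      HasDerivWithinAt (g (k + 1)) (g k t ^ 2 / 2 - g k t * g (k + 1) t)
        (Set.Ici 0) t) :
    ∀ k : ℕ, 1 ≤ k →
      IntegrableOn (fun t => g k t ^ 2) (Set.Ioi 0) ∧
      IntegrableOn (fun t => g k t * g (k + 1) t) (Set.Ioi 0) ∧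
      IntegrableOn (fun t => (g k t - g (k + 1) t) ^ 2) (Set.Ioi 0) ∧
      (1 / 2) * ∫ t in Set.Ioi (0 : ℝ), g k t ^ 2
        = ∫ t in Set.Ioi (0 : ℝ), g k t * g (k + 1) t ∧
      ∫ t in Set.Ioi (0 : ℝ), g (k + 1) t ^ 2
        = ∫ t in Set.Ioi (0 : ℝ), (g k t - g (k + 1) t) ^ 2 := by

  have hd1 : ∀ t ∈ Set.Ici (0:ℝ), HasDerivWithinAt (g 1) (- (g 1 t ^ 2 / 2)) (Set.Ici 0) t := by
    intro t ht
    have ht' : t + 2 ≠ 0 := by have := Set.mem_Ici.1 ht; positivity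
    have h := (hasDerivAt_const t (2:ℝ)).div ((hasDerivAt_id t).add_const 2) ht'
    have he : g 1 = fun t => 2 / (t + 2) := funext hg1
    rw [he]
    refine (h.congr_deriv ?_).hasDerivWithinAt
    simp only [id]
    field_simp
    ring
  have hcont : ∀ k, 1 ≤ k → ContinuousOn (g k) (Set.Ici 0) := by
    intro k hk
    obtain ⟨j, rfl⟩ := Nat.exists_eq_add_of_le' hk
    rcases Nat.eq_zero_or_pos j with rfl | hj
    · exact fun t ht => (hd1 t ht).continuousWithinAt
    · exact fun t ht => (hder j hj t ht).continuousWithinAt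
  have hnn : ∀ k, 1 ≤ k → ∀ t ∈ Set.Ici (0:ℝ), 0 ≤ g (k + 1) t := by
    intro k hk
    exact nonneg_of_lin (g k) (g (k+1)) (fun t => g k t ^ 2 / 2) (hcont k hk) (hder k hk)
      (fun t _ => by positivity) (hg0 k hk).ge
  have hle : ∀ k, 1 ≤ k → ∀ t ∈ Set.Ici (0:ℝ), g (k + 1) t ≤ g k t := by
    intro k hk
    suffices h : ∀ t ∈ Set.Ici (0:ℝ), 0 ≤ g k t - g (k + 1) t from
      fun t ht => sub_nonneg.1 (h t ht)
    obtain ⟨j, rfl⟩ := Nat.exists_eq_add_of_le' hk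
    rcases Nat.eq_zero_or_pos j with rfl | hj
    · refine nonneg_of_lin (g 1) (fun t => g 1 t - g (1+1) t) (fun t => 0) (hcont 1 le_rfl) ?_
        (fun t _ => le_rfl) ?_
      · intro t ht
        exact ((hd1 t ht).sub (hder 1 le_rfl t ht)).congr_deriv (by ring)
      · simp only [hg0 1 le_rfl, hg1]; norm_num
    · refine nonneg_of_lin (g (j+1)) (fun t => g (j+1) t - g (j+1+1) t)
        (fun t => (g j t - g (j+1) t)^2/2) (hcont _ hk) ?_ (fun t _ => by positivity) ?_
      · intro t ht
        exact ((hder j hj t ht).sub (hder (j+1) hk t ht)).congr_deriv (by ring)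
      · simp only [hg0 j hj, hg0 (j+1) hk]; norm_num
  have hb : ∀ k, 1 ≤ k → ∀ t ∈ Set.Ici (0:ℝ), 0 ≤ g k t ∧ g k t ≤ 2 / (t + 2) := by
    intro k hk
    induction k, hk using Nat.le_induction with
    | base =>
      intro t ht
      have := Set.mem_Ici.1 ht
      rw [hg1]
      exact ⟨by positivity, le_rfl⟩
    | succ k hk ih =>
      intro t ht
      exact ⟨hnn k hk t ht, (hle k hk t ht).trans (ih t ht).2⟩
  have hint : ∀ i j, 1 ≤ i → 1 ≤ j → IntegrableOn (fun t => g i t * g j t) (Set.Ioi 0) := by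
    intro i j hi hj
    refine Integrable.mono' integrable_bd
      ((((hcont i hi).mul (hcont j hj)).mono Set.Ioi_subset_Ici_self).aestronglyMeasurable
        measurableSet_Ioi) ?_
    refine (ae_restrict_iff' measurableSet_Ioi).2 (Filter.Eventually.of_forall fun t ht => ?_)
    have ht' : t ∈ Set.Ici (0:ℝ) := Set.Ioi_subset_Ici_self ht
    obtain ⟨a, b⟩ := hb i hi t ht'
    obtain ⟨c, d⟩ := hb j hj t ht'
    rw [Real.norm_of_nonneg (mul_nonneg a c), sq]
    exact mul_le_mul b d c (a.trans b)
  intro k hk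
  have hk1 : 1 ≤ k + 1 := by omega
  have i1 : IntegrableOn (fun t => g k t ^ 2) (Set.Ioi 0) := by
    simpa only [sq] using hint k k hk hk
  have i2 := hint k (k+1) hk hk1
  have i3 : IntegrableOn (fun t => g (k+1) t ^ 2) (Set.Ioi 0) := by
    simpa only [sq] using hint (k+1) (k+1) hk1 hk1
  have e : (fun t => (g k t - g (k + 1) t) ^ 2)
      = fun t => (g k t ^ 2 - 2 * (g k t * g (k+1) t)) + g (k+1) t ^ 2 := by
    funext t; ring
  have i12 : IntegrableOn (fun t => g k t ^ 2 - 2 * (g k t * g (k+1) t)) (Set.Ioi 0) :=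
    i1.sub (i2.const_mul 2)
  have ht : Filter.Tendsto (g (k+1)) Filter.atTop (nhds 0) := by
    have hz : Filter.Tendsto (fun t : ℝ => 2 / (t + 2)) Filter.atTop (nhds 0) :=
      Filter.Tendsto.const_div_atTop
        (Filter.tendsto_atTop_add_const_right _ _ Filter.tendsto_id) _
    refine squeeze_zero' ?_ ?_ hz
    · filter_upwards [Filter.eventually_ge_atTop 0] with t ht using (hb _ hk1 t ht).1
    · filter_upwards [Filter.eventually_ge_atTop 0] with t ht using (hb _ hk1 t ht).2
  have hI := integral_Ioi_of_hasDerivAt_of_tendsto (a := 0) (m := 0) (f := g (k+1))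
    (f' := fun t => g k t ^ 2 / 2 - g k t * g (k + 1) t)
    (hcont _ hk1 0 Set.self_mem_Ici)
    (fun t ht => (hder k hk t (Set.Ioi_subset_Ici_self ht)).hasDerivAt (Ici_mem_nhds ht))
    ((i1.div_const 2).sub i2) ht
  rw [integral_sub (i1.div_const 2) i2, integral_div, hg0 k hk] at hI
  refine ⟨i1, i2, ?_, by linarith, ?_⟩
  · rw [e]
    exact i12.add i3
  · rw [e, integral_add i12 i3, integral_sub i1 (i2.const_mul 2), integral_const_mul]
    linarith
end

section
/- Let g_k (k ≥ 1) solve the Smoluchowski–Horton ODE system for Kingman's coalescent. Then for every k ≥ 1, lim_{t→∞} t·g_k(t) = 2. -/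
open Filter
open scoped Topology

lemma horton_step (p h : ℝ → ℝ)
    (hp : Tendsto (fun t : ℝ => t * p t) atTop (𝓝 2))
    (hd : ∀ t : ℝ, 0 < t → HasDerivAt h (p t ^ 2 / 2 - p t * h t) t) :
    Tendsto (fun t : ℝ => t * h t) atTop (𝓝 2) := by
  rw [Metric.tendsto_atTop]
  intro ε hε
  have hδ : 0 < ε ^ 2 / 2 := by positivity
  have h1 : ∀ᶠ t in atTop, (7 / 4 : ℝ) < t * p t :=
    hp.eventually (lt_mem_nhds (by norm_num))
  have h2 : ∀ᶠ t in atTop, (t * p t - 2) ^ 4 / 2 < ε ^ 2 / 2 := by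
    have h3 : Tendsto (fun t : ℝ => (t * p t - 2) ^ 4 / 2) atTop (𝓝 ((2 - 2) ^ 4 / 2)) :=
      ((hp.sub_const 2).pow 4).div_const 2
    exact h3.eventually (gt_mem_nhds (by simpa using hδ))
  obtain ⟨T, hT⟩ := eventually_atTop.1 (h1.and (h2.and (eventually_ge_atTop 1)))
  have hT1 : 1 ≤ T := (hT T le_rfl).2.2
  set F : ℝ → ℝ := fun t => t * ((t * h t - 2) ^ 2 - ε ^ 2 / 2) with hF
  have hFd : ∀ t : ℝ, 0 < t → HasDerivAt F
      (((t * h t - 2) ^ 2 - ε ^ 2 / 2) +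
        t * (2 * (t * h t - 2) * (h t + t * (p t ^ 2 / 2 - p t * h t)))) t := by
    intro t ht
    have e1 := (hasDerivAt_id' t).mul (hd t ht)
    have e2 := (hasDerivAt_id' t).mul (((e1.sub_const 2).pow 2).sub_const (ε ^ 2 / 2))
    refine e2.congr_deriv ?_
    simp
  have hanti : AntitoneOn F (Set.Ici T) := by
    apply antitoneOn_of_deriv_nonpos (convex_Ici T)
    · intro t ht
      have ht' : T ≤ t := ht
      exact (hFd t (by linarith)).continuousAt.continuousWithinAt
    · intro t ht
      rw [interior_Ici] at ht
      have ht' : T < t := ht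
      exact (hFd t (by linarith)).differentiableAt.differentiableWithinAt
    · intro t ht
      rw [interior_Ici] at ht
      have ht' : T < t := ht
      rw [(hFd t (by linarith)).deriv]
      obtain ⟨a1, a2, -⟩ := hT t ht'.le
      have key : t * (2 * (t * h t - 2) * (h t + t * (p t ^ 2 / 2 - p t * h t)))
          = 2 * (t * h t - 2) * ((t * p t - 2) ^ 2 / 2 - (t * p t - 1) * (t * h t - 2)) := by
        ring
      rw [key]
      generalize t * h t - 2 = v at *
      generalize t * p t = q at *
      nlinarith [mul_nonneg (sub_nonneg.2 a1.le) (sq_nonneg v), sq_nonneg (v - 2 * (q - 2) ^ 2 / 2)]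
  obtain ⟨N, hN⟩ : ∃ N : ℝ, F T < N * (ε ^ 2 / 2) := by
    refine ⟨F T / (ε ^ 2 / 2) + 1, ?_⟩
    rw [add_mul, div_mul_cancel₀ _ hδ.ne']
    linarith
  refine ⟨max T N, fun t ht => ?_⟩
  have htT : T ≤ t := le_trans (le_max_left _ _) ht
  have htN : N ≤ t := le_trans (le_max_right _ _) ht
  have hle : F t ≤ F T := hanti Set.self_mem_Ici htT htT
  have ht0 : 0 < t := by linarith
  have h5 : t * ((t * h t - 2) ^ 2 - ε ^ 2 / 2) < t * (ε ^ 2 / 2) := by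
    have := mul_le_mul_of_nonneg_right htN hδ.le
    simp only [hF] at hle hN
    linarith
  have h6 := lt_of_mul_lt_mul_left h5 ht0.le
  rw [Real.dist_eq]
  exact abs_lt_of_sq_lt_sq (by linarith) hε.le

/-- For the Smoluchowski–Horton ODE system of Kingman's coalescent,
`t·g_k(t) → 2` as `t → ∞` for every `k ≥ 1`. -/
theorem stmt11 (g : ℕ → ℝ → ℝ)
    (hg1 : ∀ t : ℝ, g 1 t = 2 / (t + 2))
    (hg0 : ∀ k : ℕ, 1 ≤ k → g (k + 1) 0 = 0)
    (hder : ∀ k : ℕ, 1 ≤ k → ∀ t ∈ Set.Ici (0 : ℝ),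
      HasDerivWithinAt (g (k + 1)) (g k t ^ 2 / 2 - g k t * g (k + 1) t)
        (Set.Ici 0) t) :
    ∀ k : ℕ, 1 ≤ k →
      Filter.Tendsto (fun t : ℝ => t * g k t) Filter.atTop (nhds 2) := by
  intro k hk
  induction k, hk using Nat.le_induction with
  | base =>
    have h1 : Tendsto (fun t : ℝ => 2 - 4 / (t + 2)) atTop (𝓝 (2 - 0)) :=
      ((tendsto_atTop_add_const_right atTop (2 : ℝ) tendsto_id).const_div_atTop 4).const_sub 2
    rw [sub_zero] at h1
    refine h1.congr' ?_
    filter_upwards [eventually_gt_atTop 0] with t ht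
    rw [hg1]
    field_simp
    ring
  | succ k hk ih =>
    exact horton_step (g k) (g (k + 1)) ih fun t ht =>
      (hder k hk t ht.le).hasDerivAt (Ici_mem_nhds ht)
end

section
/- Let g_k (k ≥ 1) solve the Smoluchowski–Horton ODE system for Kingman's coalescent. Then for every k ≥ 1 the integrals ∫₀^∞ g_k(t)² dt are finite and strictly positive, and the Horton ratios n_k = (∫₀^∞ g_k(t)² dt)/(∫₀^∞ g_{k+1}(t)² dt) satisfy 2 ≤ n_k ≤ 4. -/
open MeasureTheory

lemma aux_nonneg (f p a : ℝ → ℝ) (hp : ContinuousOn p (Set.Ici 0))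
    (hf : ∀ t ∈ Set.Ici (0 : ℝ), HasDerivWithinAt f (a t - p t * f t) (Set.Ici 0) t)
    (ha : ∀ t ∈ Set.Ici (0 : ℝ), 0 ≤ a t) (h0 : 0 ≤ f 0) :
    ∀ t ∈ Set.Ici (0 : ℝ), 0 ≤ f t := by
  have hq : Continuous (fun t => p (max 0 t)) :=
    hp.comp_continuous (by fun_prop) (fun t => le_max_left 0 t)
  have hP : ∀ t, HasDerivAt (fun x => ∫ s in (0:ℝ)..x, p (max 0 s)) (p (max 0 t)) t := fun t =>
    intervalIntegral.integral_hasDerivAt_right (hq.intervalIntegrable _ _)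
      hq.aestronglyMeasurable.stronglyMeasurableAtFilter hq.continuousAt
  set P : ℝ → ℝ := fun x => ∫ s in (0:ℝ)..x, p (max 0 s)
  have hF : ∀ t ∈ Set.Ici (0 : ℝ), HasDerivWithinAt (fun t => f t * Real.exp (P t))
      (a t * Real.exp (P t)) (Set.Ici 0) t := by
    intro t ht
    have h1 := (hf t ht).mul (hP t).exp.hasDerivWithinAt
    rw [max_eq_right (show (0:ℝ) ≤ t from ht)] at h1
    refine h1.congr_deriv ?_
    ring
  have hm : MonotoneOn (fun t => f t * Real.exp (P t)) (Set.Ici 0) := by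
    refine monotoneOn_of_hasDerivWithinAt_nonneg (f' := fun t => a t * Real.exp (P t))
      (convex_Ici 0) (fun t ht => (hF t ht).continuousWithinAt) ?_ ?_
    · intro t ht
      exact (hF t (interior_subset ht)).mono interior_subset
    · intro t ht
      exact mul_nonneg (ha t (interior_subset ht)) (Real.exp_pos _).le
  intro t ht
  have h2 := hm (Set.mem_Ici.2 le_rfl) ht ht
  have h3 : 0 ≤ f t * Real.exp (P t) := le_trans (mul_nonneg h0 (Real.exp_pos _).le) h2
  exact nonneg_of_mul_nonneg_left h3 (Real.exp_pos _)

/-- For the Smoluchowski–Horton ODE system of Kingman's coalescent, the integrals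
`∫₀^∞ g_k²` are finite and strictly positive, and the Horton ratios
`n_k = (∫₀^∞ g_k²)/(∫₀^∞ g_{k+1}²)` satisfy `2 ≤ n_k ≤ 4`. -/
theorem stmt12 (g : ℕ → ℝ → ℝ)
    (hg1 : ∀ t : ℝ, g 1 t = 2 / (t + 2))
    (hg0 : ∀ k : ℕ, 1 ≤ k → g (k + 1) 0 = 0)
    (hder : ∀ k : ℕ, 1 ≤ k → ∀ t ∈ Set.Ici (0 : ℝ),
      HasDerivWithinAt (g (k + 1)) (g k t ^ 2 / 2 - g k t * g (k + 1) t)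
        (Set.Ici 0) t) :
    ∀ k : ℕ, 1 ≤ k →
      IntegrableOn (fun t => g k t ^ 2) (Set.Ioi 0) ∧
      0 < ∫ t in Set.Ioi (0 : ℝ), g k t ^ 2 ∧
      2 ≤ (∫ t in Set.Ioi (0 : ℝ), g k t ^ 2) / (∫ t in Set.Ioi (0 : ℝ), g (k + 1) t ^ 2) ∧
      (∫ t in Set.Ioi (0 : ℝ), g k t ^ 2) / (∫ t in Set.Ioi (0 : ℝ), g (k + 1) t ^ 2) ≤ 4 := by
  have hg1' : g 1 = fun t => 2 / (t + 2) := funext hg1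
  have hd1 : ∀ t ∈ Set.Ici (0 : ℝ), HasDerivAt (g 1) (- (g 1 t ^ 2 / 2)) t := by
    intro t ht
    have ht' : t + 2 ≠ 0 := by have : (0:ℝ) ≤ t := ht; positivity
    rw [hg1']
    refine ((hasDerivAt_const t (2:ℝ)).div ((hasDerivAt_id t).add_const 2) ht').congr_deriv ?_
    simp only [id]
    field_simp
    ring
  have hcont : ∀ k, 1 ≤ k → ContinuousOn (g k) (Set.Ici 0) := by
    intro k hk t ht
    obtain ⟨j, rfl⟩ : ∃ j, k = j + 1 := ⟨k - 1, by omega⟩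
    rcases Nat.eq_zero_or_pos j with rfl | hj
    · exact (hd1 t ht).continuousAt.continuousWithinAt
    · exact (hder j hj t ht).continuousWithinAt
  have hnn : ∀ k, 1 ≤ k → ∀ t ∈ Set.Ici (0 : ℝ), 0 ≤ g k t := by
    intro k hk
    obtain ⟨j, rfl⟩ : ∃ j, k = j + 1 := ⟨k - 1, by omega⟩
    rcases Nat.eq_zero_or_pos j with rfl | hj
    · intro t ht
      have : (0:ℝ) ≤ t := ht
      simp only [Nat.zero_add, hg1]
      positivity
    · exact aux_nonneg _ (g j) (fun t => g j t ^ 2 / 2) (hcont j hj) (hder j hj)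
        (fun t _ => by positivity) (hg0 j hj).ge
  have hle : ∀ k, 1 ≤ k → ∀ t ∈ Set.Ici (0 : ℝ), g (k + 1) t ≤ g k t := by
    intro k hk t ht
    obtain ⟨j, rfl⟩ : ∃ j, k = j + 1 := ⟨k - 1, by omega⟩
    rw [← sub_nonneg]
    rcases Nat.eq_zero_or_pos j with rfl | hj
    · refine aux_nonneg (fun t => g 1 t - g 2 t) (g 1) (fun _ => 0) (hcont 1 hk) ?_
        (fun t _ => le_rfl) ?_ t ht
      · intro t ht
        refine ((hd1 t ht).hasDerivWithinAt.sub (hder 1 le_rfl t ht)).congr_deriv ?_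
        simp only [Nat.reduceAdd]
        ring
      · have := hg0 1 le_rfl
        simp only [Nat.reduceAdd] at this
        simp [this, hg1]
    · refine aux_nonneg (fun t => g (j + 1) t - g (j + 1 + 1) t) (g (j + 1))
        (fun t => (g j t - g (j + 1) t) ^ 2 / 2) (hcont _ hk) ?_
        (fun t _ => by positivity) ?_ t ht
      · intro t ht
        refine ((hder j hj t ht).sub (hder (j + 1) hk t ht)).congr_deriv ?_
        ring
      · simp [hg0 j hj, hg0 (j + 1) hk]
  have hle1 : ∀ k, 1 ≤ k → ∀ t ∈ Set.Ici (0 : ℝ), g k t ≤ g 1 t := by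
    intro k hk t ht
    induction k, hk using Nat.le_induction with
    | base => exact le_rfl
    | succ k hk ih => exact (hle k hk t ht).trans ih
  have hlim1 : Filter.Tendsto (g 1) Filter.atTop (nhds 0) := by
    rw [hg1']
    exact Filter.Tendsto.const_div_atTop
      (Filter.tendsto_atTop_add_const_right _ _ Filter.tendsto_id) 2
  have hlim : ∀ k, 1 ≤ k → Filter.Tendsto (g k) Filter.atTop (nhds 0) := by
    intro k hk
    refine tendsto_of_tendsto_of_tendsto_of_le_of_le' tendsto_const_nhds hlim1 ?_ ?_
    · filter_upwards [Filter.eventually_ge_atTop 0] with t ht using hnn k hk t ht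
    · filter_upwards [Filter.eventually_ge_atTop 0] with t ht using hle1 k hk t ht
  have hint1 : IntegrableOn (fun t => g 1 t ^ 2) (Set.Ioi 0) := by
    have := integrableOn_Ioi_deriv_of_nonpos' (a := 0) (g := g 1)
      (g' := fun t => - (g 1 t ^ 2 / 2)) hd1
      (fun t _ => by have := sq_nonneg (g 1 t); linarith) hlim1
    refine (this.const_mul (-2)).congr (Filter.Eventually.of_forall fun t => ?_)
    ring
  have hpos1 : 0 < ∫ t in Set.Ioi (0 : ℝ), g 1 t ^ 2 := by
    have := integral_Ioi_of_hasDerivAt_of_nonpos' (a := 0) (g := g 1)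
      (g' := fun t => - (g 1 t ^ 2 / 2)) hd1
      (fun t _ => by have := sq_nonneg (g 1 t); linarith) hlim1
    rw [integral_neg, integral_div, hg1 0] at this
    linarith
  have hmeas : ∀ k, 1 ≤ k → AEStronglyMeasurable (g k) (volume.restrict (Set.Ioi 0)) :=
    fun k hk => ((hcont k hk).mono Set.Ioi_subset_Ici_self).aestronglyMeasurable measurableSet_Ioi
  have hmul : ∀ k l, 1 ≤ k → 1 ≤ l → IntegrableOn (fun t => g k t * g l t) (Set.Ioi 0) := by
    intro k l hk hl
    refine Integrable.mono' hint1 ((hmeas k hk).mul (hmeas l hl)) ?_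
    refine (ae_restrict_iff' measurableSet_Ioi).2 (Filter.Eventually.of_forall fun t ht => ?_)
    have ht : t ∈ Set.Ici (0:ℝ) := Set.Ioi_subset_Ici_self ht
    rw [Real.norm_of_nonneg (mul_nonneg (hnn k hk t ht) (hnn l hl t ht)), sq]
    exact mul_le_mul (hle1 k hk t ht) (hle1 l hl t ht) (hnn l hl t ht) (hnn 1 le_rfl t ht)
  have hsq : ∀ k, 1 ≤ k → IntegrableOn (fun t => g k t ^ 2) (Set.Ioi 0) := by
    intro k hk
    simpa only [sq] using hmul k k hk hk
  have key : ∀ k, 1 ≤ k → (∫ t in Set.Ioi (0 : ℝ), g k t ^ 2) / 2 =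
      ∫ t in Set.Ioi (0 : ℝ), g k t * g (k + 1) t := by
    intro k hk
    have h := integral_Ioi_of_hasDerivAt_of_tendsto (a := 0) (f := g (k + 1))
      (f' := fun t => g k t ^ 2 / 2 - g k t * g (k + 1) t)
      (hcont (k + 1) (by omega) 0 (Set.mem_Ici.2 le_rfl))
      (fun t ht => (hder k hk t (Set.Ioi_subset_Ici_self ht)).hasDerivAt (Ici_mem_nhds ht))
      (((hsq k hk).div_const 2).sub (hmul k (k + 1) hk (by omega)))
      (hlim (k + 1) (by omega))
    rw [integral_sub ((hsq k hk).div_const 2) (hmul k (k + 1) hk (by omega)), integral_div,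
      hg0 k hk] at h
    linarith
  have hlow : ∀ k, 1 ≤ k → 2 * (∫ t in Set.Ioi (0 : ℝ), g (k + 1) t ^ 2) ≤
      ∫ t in Set.Ioi (0 : ℝ), g k t ^ 2 := by
    intro k hk
    have h : (∫ t in Set.Ioi (0 : ℝ), g (k + 1) t ^ 2) ≤
        ∫ t in Set.Ioi (0 : ℝ), g k t * g (k + 1) t := by
      refine setIntegral_mono_on (hsq (k + 1) (by omega)) (hmul k (k + 1) hk (by omega))
        measurableSet_Ioi fun t ht => ?_
      have ht : t ∈ Set.Ici (0:ℝ) := Set.Ioi_subset_Ici_self ht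
      rw [sq]
      exact mul_le_mul_of_nonneg_right (hle k hk t ht) (hnn (k + 1) (by omega) t ht)
    linarith [key k hk]
  have hup : ∀ k, 1 ≤ k → (∫ t in Set.Ioi (0 : ℝ), g k t ^ 2) ≤
      4 * ∫ t in Set.Ioi (0 : ℝ), g (k + 1) t ^ 2 := by
    intro k hk
    have h : (∫ t in Set.Ioi (0 : ℝ), 4 * (g k t * g (k + 1) t)) ≤
        ∫ t in Set.Ioi (0 : ℝ), (g k t ^ 2 + 4 * g (k + 1) t ^ 2) := by
      refine setIntegral_mono_on ((hmul k (k + 1) hk (by omega)).const_mul 4)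
        ((hsq k hk).add ((hsq (k + 1) (by omega)).const_mul 4))
        measurableSet_Ioi fun t ht => ?_
      nlinarith [sq_nonneg (g k t - 2 * g (k + 1) t)]
    rw [integral_add (hsq k hk) ((hsq (k + 1) (by omega)).const_mul 4), integral_const_mul,
      integral_const_mul] at h
    linarith [key k hk]
  have hpos : ∀ k, 1 ≤ k → 0 < ∫ t in Set.Ioi (0 : ℝ), g k t ^ 2 := by
    intro k hk
    induction k, hk using Nat.le_induction with
    | base => exact hpos1
    | succ k hk ih => linarith [hup k hk]
  intro k hk
  have hp := hpos (k + 1) (by omega)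
  exact ⟨hsq k hk, hpos k hk, (le_div_iff₀ hp).2 (hlow k hk), (div_le_iff₀ hp).2 (hup k hk)⟩
end

section
/- Let h_k (k ≥ 1) solve the rescaled Smoluchowski–Horton ODE system. Then for every k ≥ 1 and every x ∈ (0,1): h_k(x) < h_{k+1}(x) < 1/(1−x). -/
lemma gron_pos (a r g : ℝ → ℝ) (ha : ContinuousOn a (Set.Icc 0 1)) (g0 : g 0 = 0)
    (hg : ContinuousOn g (Set.Ico 0 1))
    (hd : ∀ x ∈ Set.Ioo (0 : ℝ) 1, HasDerivAt g (a x * g x + r x) x)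
    (hr : ∀ x ∈ Set.Ioo (0 : ℝ) 1, 0 < r x) : ∀ x ∈ Set.Ioo (0 : ℝ) 1, 0 < g x := by
  set b : ℝ → ℝ := Set.IccExtend (zero_le_one' ℝ) ((Set.Icc (0 : ℝ) 1).domRestrict a) with hb
  have hbc : Continuous b := (continuousOn_iff_continuous_domRestrict.mp ha).Icc_extend'
  have hba : ∀ x ∈ Set.Icc (0 : ℝ) 1, b x = a x := fun x hx => by
    rw [hb, Set.IccExtend_of_mem _ _ hx]; rfl
  have hA : ∀ x, HasDerivAt (fun x => ∫ t in (0 : ℝ)..x, b t) (b x) x := fun x =>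
    intervalIntegral.integral_hasDerivAt_right (hbc.intervalIntegrable _ _)
      (hbc.stronglyMeasurableAtFilter _ _) hbc.continuousAt
  set A : ℝ → ℝ := fun x => ∫ t in (0 : ℝ)..x, b t
  have hAc : Continuous A := continuous_iff_continuousAt.mpr fun x => (hA x).continuousAt
  have hm : StrictMonoOn (fun x => g x * Real.exp (-A x)) (Set.Ico 0 1) := by
    apply strictMonoOn_of_deriv_pos (convex_Ico 0 1)
    · exact hg.mul (by fun_prop)
    · rw [interior_Ico]
      intro x hx
      have h1 := (hd x hx).mul (hA x).neg.exp
      have h2 : deriv (fun x => g x * Real.exp (-A x)) x = _ := h1.deriv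
      rw [h2, hba x ⟨hx.1.le, hx.2.le⟩]
      have := mul_pos (hr x hx) (Real.exp_pos (-A x))
      simp only [Pi.neg_apply]
      linarith
  intro x hx
  have := hm ⟨le_rfl, one_pos⟩ ⟨hx.1.le, hx.2⟩ hx.1
  simp only [g0, zero_mul] at this
  exact (pos_iff_pos_of_mul_pos this).mpr (Real.exp_pos _)

/-- For the rescaled Smoluchowski–Horton ODE system (`h₁ ≡ 1`, `h_{k+1}(0) = 1`,
`h_{k+1}' = 2h_k·h_{k+1} - h_k²` on `[0,1]`), one has
`h_k(x) < h_{k+1}(x) < 1/(1-x)` for every `k ≥ 1` and every `x ∈ (0,1)`. -/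
theorem stmt13 (h : ℕ → ℝ → ℝ)
    (hh1 : ∀ x : ℝ, h 1 x = 1)
    (hh0 : ∀ k : ℕ, 1 ≤ k → h (k + 1) 0 = 1)
    (hder : ∀ k : ℕ, 1 ≤ k → ∀ x ∈ Set.Icc (0 : ℝ) 1,
      HasDerivWithinAt (h (k + 1)) (2 * h k x * h (k + 1) x - h k x ^ 2)
        (Set.Icc 0 1) x) :
    ∀ k : ℕ, 1 ≤ k → ∀ x ∈ Set.Ioo (0 : ℝ) 1,
      h k x < h (k + 1) x ∧ h (k + 1) x < 1 / (1 - x) := by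
  have e1 : h 1 = fun _ => 1 := funext hh1
  have hc : ∀ k, 1 ≤ k → ContinuousOn (h k) (Set.Icc 0 1) := by
    intro k hk
    obtain rfl | ⟨j, hj, rfl⟩ : k = 1 ∨ ∃ j, 1 ≤ j ∧ k = j + 1 := by
      rcases hk.eq_or_lt with h | h
      · exact Or.inl h.symm
      · exact Or.inr ⟨k - 1, by omega, by omega⟩
    · rw [e1]; exact continuousOn_const
    · exact fun x hx => (hder j hj x hx).continuousWithinAt
  have hd : ∀ k, 1 ≤ k → ∀ x ∈ Set.Ioo (0 : ℝ) 1,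
      HasDerivAt (h (k + 1)) (2 * h k x * h (k + 1) x - h k x ^ 2) x := fun k hk x hx =>
    (hder k hk x ⟨hx.1.le, hx.2.le⟩).hasDerivAt (Icc_mem_nhds hx.1 hx.2)
  have h0 : ∀ k, 1 ≤ k → h k 0 = 1 := by
    intro k hk
    rcases hk.eq_or_lt with h | h
    · rw [← h]; exact hh1 0
    · have := hh0 (k - 1) (by omega)
      rwa [show k - 1 + 1 = k by omega] at this
  have hR : ∀ x : ℝ, x < 1 → HasDerivAt (fun x : ℝ => 1 / (1 - x)) ((1 / (1 - x)) ^ 2) x := by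
    intro x hx
    have hx' : 1 - x ≠ 0 := by linarith
    have := ((hasDerivAt_id x).const_sub 1).inv hx'
    simp only [one_div]
    refine HasDerivAt.congr_deriv (f := fun x : ℝ => (1 - x)⁻¹) this ?_
    simp [div_eq_mul_inv]
  have hI : Set.Ico (0 : ℝ) 1 ⊆ Set.Icc 0 1 := Set.Ico_subset_Icc_self
  have hup : ∀ k, 1 ≤ k → (∀ x ∈ Set.Ioo (0 : ℝ) 1, h k x < 1 / (1 - x)) →
      ∀ x ∈ Set.Ioo (0 : ℝ) 1, h (k + 1) x < 1 / (1 - x) := by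
    intro k hk ih x hx
    have := gron_pos (fun x => 2 * h k x) (fun x => (1 / (1 - x) - h k x) ^ 2)
      (fun x => 1 / (1 - x) - h (k + 1) x) (continuousOn_const.mul (hc k hk))
      (by simp [hh0 k hk])
      (ContinuousOn.sub (fun x hx => (hR x hx.2).continuousAt.continuousWithinAt)
        ((hc (k + 1) (by omega)).mono hI))
      (fun x hx => ((hR x hx.2).sub (hd k hk x hx)).congr_deriv (by ring))
      (fun x hx => pow_pos (sub_pos.mpr (ih x hx)) 2) x hx
    exact sub_pos.mp this
  intro k hk
  induction k, hk using Nat.le_induction with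
  | base =>
    intro x hx
    constructor
    · have := gron_pos (fun _ => 2) (fun _ => 1) (fun x => h 2 x - 1) continuousOn_const
        (by simp [h0 2]) (((hc 2 (by omega)).mono hI).sub continuousOn_const)
        (fun x hx => ((hd 1 le_rfl x hx).sub_const 1).congr_deriv (by
          simp only [hh1]; norm_num; ring)) (fun _ _ => one_pos) x hx
      rw [hh1]; exact sub_pos.mp this
    · refine hup 1 le_rfl (fun x hx => ?_) x hx
      rw [hh1, lt_div_iff₀ (by linarith [hx.2])]
      linarith [hx.1]
  | succ k hk ih =>
    intro x hx
    refine ⟨?_, hup (k + 1) (by omega) (fun x hx => (ih x hx).2) x hx⟩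
    have := gron_pos (fun x => 2 * h (k + 1) x) (fun x => (h (k + 1) x - h k x) ^ 2)
      (fun x => h (k + 1 + 1) x - h (k + 1) x)
      (continuousOn_const.mul (hc (k + 1) (by omega)))
      (by simp [h0 (k + 1 + 1), h0 (k + 1)])
      (((hc (k + 1 + 1) (by omega)).mono hI).sub ((hc (k + 1) (by omega)).mono hI))
      (fun x hx => ((hd (k + 1) (by omega) x hx).sub (hd k hk x hx)).congr_deriv (by ring))
      (fun x hx => pow_pos (sub_pos.mpr (ih x hx).1) 2) x hx
    exact sub_pos.mp this
end

section
/- Let h_k (k ≥ 1) solve the rescaled Smoluchowski–Horton ODE system. Then for every k ≥ 1: ∫₀¹ (1 − (1−x)·h_{k+1}(x))² dx = ∫₀¹ (1−x)²·(h_{k+1}(x) − h_k(x))² dx; that is, in L²[0,1] notation with h(x) = 1/(1−x), ‖1 − h_{k+1}/h‖ = ‖h_{k+1}/h − h_k/h‖. -/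
open MeasureTheory

/-- For the rescaled Smoluchowski–Horton ODE system, for every `k ≥ 1`:
`∫₀¹ (1 - (1-x)h_{k+1}(x))² dx = ∫₀¹ (1-x)²(h_{k+1}(x) - h_k(x))² dx`,
i.e. `‖1 - h_{k+1}/h‖ = ‖h_{k+1}/h - h_k/h‖` in `L²[0,1]` with `h(x) = 1/(1-x)`. -/
theorem stmt14 (h : ℕ → ℝ → ℝ)
    (hh1 : ∀ x : ℝ, h 1 x = 1)
    (hh0 : ∀ k : ℕ, 1 ≤ k → h (k + 1) 0 = 1)
    (hder : ∀ k : ℕ, 1 ≤ k → ∀ x ∈ Set.Icc (0 : ℝ) 1,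
      HasDerivWithinAt (h (k + 1)) (2 * h k x * h (k + 1) x - h k x ^ 2)
        (Set.Icc 0 1) x) :
    ∀ k : ℕ, 1 ≤ k →
      ∫ x in (0 : ℝ)..1, (1 - (1 - x) * h (k + 1) x) ^ 2
        = ∫ x in (0 : ℝ)..1, (1 - x) ^ 2 * (h (k + 1) x - h k x) ^ 2 := by
  intro k hk
  have hgc : ∀ k : ℕ, 1 ≤ k → ContinuousOn (h (k + 1)) (Set.Icc 0 1) :=
    fun k hk x hx => (hder k hk x hx).continuousWithinAt
  have hg := hgc k hk
  have hf : ContinuousOn (h k) (Set.Icc 0 1) := by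
    rcases Nat.lt_or_ge 1 k with h1 | h1
    · obtain ⟨m, rfl⟩ : ∃ m, k = m + 1 := ⟨k - 1, by omega⟩
      exact hgc m (by omega)
    · obtain rfl : k = 1 := by omega
      have : h 1 = fun _ => 1 := funext hh1
      rw [this]
      exact continuousOn_const
  have hu : Set.uIcc (0 : ℝ) 1 = Set.Icc 0 1 := Set.uIcc_of_le zero_le_one
  have i1 : IntervalIntegrable (fun x => (1 - (1 - x) * h (k + 1) x) ^ 2) volume 0 1 := by
    apply ContinuousOn.intervalIntegrable
    rw [hu]
    fun_prop
  have i2 : IntervalIntegrable (fun x => (1 - x) ^ 2 * (h (k + 1) x - h k x) ^ 2) volume 0 1 := by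
    apply ContinuousOn.intervalIntegrable
    rw [hu]
    fun_prop
  have key : ∫ x in (0 : ℝ)..1, ((1 - (1 - x) * h (k + 1) x) ^ 2
      - (1 - x) ^ 2 * (h (k + 1) x - h k x) ^ 2)
      = (1 + (1 - 1) ^ 2 * h (k + 1) 1) - (0 + (1 - 0) ^ 2 * h (k + 1) 0) := by
    apply intervalIntegral.integral_eq_sub_of_hasDerivAt_of_le
      (f := fun x => x + (1 - x) ^ 2 * h (k + 1) x) zero_le_one
    · fun_prop
    · intro x hx
      have hd := (hder k hk x (Set.Ioo_subset_Icc_self hx)).hasDerivAt (Icc_mem_nhds hx.1 hx.2)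
      have := (hasDerivAt_id x).add ((((hasDerivAt_id x).const_sub 1).pow 2).mul hd)
      convert this using 1
      · rfl
      · simp
        ring
    · exact i1.sub i2
  rw [intervalIntegral.integral_sub i1 i2, hh0 k hk] at key
  linarith
end

section
/- Let h_k (k ≥ 1) solve the rescaled Smoluchowski–Horton ODE system. Then for every k ≥ 1: ∫₀¹ (1 − (1−x)·h_{k+1}(x))² dx ≤ 1/h_{k+1}(1) ≤ ∫₀¹ (1 − (1−x)·h_k(x))² dx (in particular h_{k+1}(1) > 0). -/
open MeasureTheory

lemma sh_cmp (u d d' : ℝ → ℝ) (hu : ContinuousOn u (Set.Icc 0 1))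
    (hd : ∀ x ∈ Set.Icc (0 : ℝ) 1, HasDerivWithinAt d (d' x) (Set.Icc 0 1) x)
    (hle : ∀ x ∈ Set.Icc (0 : ℝ) 1, 2 * u x * d x ≤ d' x) (h0 : d 0 = 0) :
    ∀ x ∈ Set.Icc (0 : ℝ) 1, 0 ≤ d x := by
  have h01 : (0 : ℝ) ≤ 1 := zero_le_one
  set U : ℝ → ℝ := Set.IccExtend h01 ((Set.Icc (0 : ℝ) 1).domRestrict u) with hU
  have hUc : Continuous U := by
    rw [hU]
    exact (continuousOn_iff_continuous_domRestrict.1 hu).Icc_extend'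
  have hUe : ∀ x ∈ Set.Icc (0 : ℝ) 1, U x = u x := by
    intro x hx
    rw [hU, Set.IccExtend_of_mem h01 _ hx]
    rfl
  have hV : ∀ x, HasDerivAt (fun y => ∫ t in (0 : ℝ)..y, U t) (U x) x := fun x =>
    intervalIntegral.integral_hasDerivAt_right (hUc.intervalIntegrable _ _)
      hUc.stronglyMeasurable.stronglyMeasurableAtFilter hUc.continuousAt
  set V : ℝ → ℝ := fun y => ∫ t in (0 : ℝ)..y, U t with hVdef
  have hder : ∀ x ∈ Set.Icc (0 : ℝ) 1, HasDerivWithinAt (fun y => Real.exp (-2 * V y) * d y)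
      (Real.exp (-2 * V x) * (-2 * U x) * d x + Real.exp (-2 * V x) * d' x)
      (Set.Icc 0 1) x := by
    intro x hx
    exact (((hV x).const_mul (-2)).exp.hasDerivWithinAt).mul (hd x hx)
  have hmono : MonotoneOn (fun y => Real.exp (-2 * V y) * d y) (Set.Icc 0 1) := by
    refine monotoneOn_of_hasDerivWithinAt_nonneg (convex_Icc 0 1)
      (fun x hx => (hder x hx).continuousWithinAt)
      (fun x hx => (hder x (interior_subset hx)).mono interior_subset) ?_
    intro x hx
    have hx' := interior_subset hx
    rw [hUe x hx']
    have := mul_nonneg (Real.exp_pos (-2 * V x)).le (sub_nonneg.2 (hle x hx'))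
    linarith
  intro x hx
  have := hmono (Set.left_mem_Icc.2 h01) hx hx.1
  simp only [h0, mul_zero] at this
  exact nonneg_of_mul_nonneg_right this (Real.exp_pos _)

theorem stmt15 (h : ℕ → ℝ → ℝ)
    (hh1 : ∀ x : ℝ, h 1 x = 1)
    (hh0 : ∀ k : ℕ, 1 ≤ k → h (k + 1) 0 = 1)
    (hder : ∀ k : ℕ, 1 ≤ k → ∀ x ∈ Set.Icc (0 : ℝ) 1,
      HasDerivWithinAt (h (k + 1)) (2 * h k x * h (k + 1) x - h k x ^ 2)
        (Set.Icc 0 1) x) :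
    ∀ k : ℕ, 1 ≤ k →
      0 < h (k + 1) 1 ∧
      (∫ x in (0 : ℝ)..1, (1 - (1 - x) * h (k + 1) x) ^ 2) ≤ 1 / h (k + 1) 1 ∧
      1 / h (k + 1) 1 ≤ ∫ x in (0 : ℝ)..1, (1 - (1 - x) * h k x) ^ 2 := by
  have hh1' : h 1 = fun _ => 1 := funext hh1
  have hcont : ∀ k, 1 ≤ k → ContinuousOn (h k) (Set.Icc 0 1) := by
    intro k hk
    rcases Nat.exists_eq_add_of_le' hk with ⟨m, rfl⟩
    rcases Nat.eq_zero_or_pos m with rfl | hm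
    · simp only [zero_add, hh1']
      exact continuousOn_const
    · exact fun x hx => (hder m hm x hx).continuousWithinAt
  have hmon : ∀ k, 1 ≤ k → ∀ x ∈ Set.Icc (0 : ℝ) 1, 1 ≤ h k x ∧ h k x ≤ h (k + 1) x := by
    intro k hk
    induction k, hk using Nat.le_induction with
    | base =>
      intro x hx
      have := sh_cmp (h 1) (fun x => h 2 x - 1) (fun x => 2 * h 1 x * h 2 x - h 1 x ^ 2)
        (hcont 1 le_rfl) (fun x hx => (hder 1 le_rfl x hx).sub_const 1)
        (fun x _ => by simp only [hh1]; linarith) (by simp [hh0 1 le_rfl]) x hx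
      rw [hh1]
      constructor
      · exact le_rfl
      · show 1 ≤ h 2 x
        linarith
    | succ k hk ih =>
      intro x hx
      have := sh_cmp (h (k+1)) (fun x => h (k+1+1) x - h (k+1) x)
        (fun x => (2 * h (k+1) x * h (k+1+1) x - h (k+1) x ^ 2)
          - (2 * h k x * h (k+1) x - h k x ^ 2))
        (hcont (k+1) (by omega))
        (fun x hx => (hder (k+1) (by omega) x hx).sub (hder k hk x hx))
        (fun x _ => by nlinarith [sq_nonneg (h (k+1) x - h k x)])
        (by simp [hh0 k hk, hh0 (k+1) (by omega)]) x hx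
      obtain ⟨i1, i2⟩ := ih x hx
      constructor <;> linarith
  intro k hk
  have hu := hcont k hk
  have hv := hcont (k+1) (by omega)
  have hm := hmon k hk
  have hd := hder k hk
  have hv0 := hh0 k hk
  generalize h (k+1) = v at *
  generalize h k = u at *
  have h01 : (0 : ℝ) ≤ 1 := zero_le_one
  have hpos : ∀ x ∈ Set.Icc (0 : ℝ) 1, 0 < v x := fun x hx => by
    linarith [(hm x hx).1, (hm x hx).2]
  have hF : ∀ x ∈ Set.Icc (0 : ℝ) 1, HasDerivWithinAt (fun y => (v y)⁻¹ + y)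
      ((1 - u x / v x) ^ 2) (Set.Icc 0 1) x := by
    intro x hx
    have hne := (hpos x hx).ne'
    refine (((hd x hx).inv hne).add (hasDerivWithinAt_id x _)).congr_deriv ?_
    field_simp
    ring
  have hFc : ContinuousOn (fun y => (v y)⁻¹ + y) (Set.Icc 0 1) :=
    fun x hx => (hF x hx).continuousWithinAt
  have hmono : MonotoneOn (fun y => (v y)⁻¹ + y) (Set.Icc 0 1) :=
    monotoneOn_of_hasDerivWithinAt_nonneg (convex_Icc 0 1) hFc
      (fun x hx => (hF x (interior_subset hx)).mono interior_subset) (fun x _ => sq_nonneg _)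
  have hle : ∀ x ∈ Set.Icc (0 : ℝ) 1, (1 - x) * v x ≤ 1 := by
    intro x hx
    have h1 := hmono (Set.left_mem_Icc.2 h01) hx hx.1
    simp only [hv0] at h1
    have h2 := hpos x hx
    have h3 : 1 - x ≤ (v x)⁻¹ := by linarith [inv_one (G := ℝ)]
    calc (1 - x) * v x ≤ (v x)⁻¹ * v x := by gcongr
      _ = 1 := inv_mul_cancel₀ h2.ne'
  have hii : ∀ f : ℝ → ℝ, ContinuousOn f (Set.Icc 0 1) →
      IntervalIntegrable f volume 0 1 := fun f hf =>
    ContinuousOn.intervalIntegrable (by rwa [Set.uIcc_of_le h01])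
  have hqc : ContinuousOn (fun x => (1 - u x / v x) ^ 2) (Set.Icc 0 1) :=
    (continuousOn_const.sub (hu.div hv fun x hx => (hpos x hx).ne')).pow 2
  have e1 : ∫ x in (0:ℝ)..1, (1 - u x / v x) ^ 2 = 1 / v 1 := by
    rw [intervalIntegral.integral_eq_sub_of_hasDerivAt_of_le h01 hFc
      (fun x hx => (hF x (Set.Ioo_subset_Icc_self hx)).hasDerivAt
        (Icc_mem_nhds hx.1 hx.2)) (hii _ hqc)]
    simp [hv0]
  have hG : ∀ x ∈ Set.Icc (0 : ℝ) 1, HasDerivWithinAt (fun y => y + (1 - y) ^ 2 * v y)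
      ((1 - (1 - x) * v x) ^ 2 - (1 - x) ^ 2 * (v x - u x) ^ 2) (Set.Icc 0 1) x := by
    intro x hx
    refine ((hasDerivWithinAt_id x _).add
      (((((hasDerivWithinAt_id x _).const_sub 1).pow 2)).mul (hd x hx))).congr_deriv ?_
    simp
    ring
  have c1 : ContinuousOn (fun x => (1 - (1 - x) * v x) ^ 2) (Set.Icc 0 1) := by fun_prop
  have c2 : ContinuousOn (fun x => (1 - x) ^ 2 * (v x - u x) ^ 2) (Set.Icc 0 1) := by fun_prop
  have c3 : ContinuousOn (fun x => (1 - (1 - x) * u x) ^ 2) (Set.Icc 0 1) := by fun_prop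
  have e2 : ∫ x in (0:ℝ)..1, ((1 - (1 - x) * v x) ^ 2 - (1 - x) ^ 2 * (v x - u x) ^ 2) = 0 := by
    rw [intervalIntegral.integral_eq_sub_of_hasDerivAt_of_le h01
      (fun x hx => (hG x hx).continuousWithinAt)
      (fun x hx => (hG x (Set.Ioo_subset_Icc_self hx)).hasDerivAt
        (Icc_mem_nhds hx.1 hx.2)) (hii _ (c1.sub c2))]
    simp [hv0]
  rw [intervalIntegral.integral_sub (hii _ c1) (hii _ c2), sub_eq_zero] at e2
  refine ⟨hpos 1 (Set.right_mem_Icc.2 h01), ?_, ?_⟩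
  · rw [e2, ← e1]
    refine intervalIntegral.integral_mono_on h01 (hii _ c2) (hii _ hqc) fun x hx => ?_
    have h2 := hpos x hx
    have h3 : v x - u x = v x * (1 - u x / v x) := by field_simp
    have h4 : 0 ≤ (1 - x) * v x := mul_nonneg (by linarith [hx.2]) h2.le
    have h5 : ((1 - x) * v x) ^ 2 ≤ 1 := pow_le_one₀ h4 (hle x hx)
    calc (1 - x) ^ 2 * (v x - u x) ^ 2
        = ((1 - x) * v x) ^ 2 * (1 - u x / v x) ^ 2 := by rw [h3]; ring
      _ ≤ 1 * (1 - u x / v x) ^ 2 := by gcongr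
      _ = _ := one_mul _
  · rw [← e1]
    refine intervalIntegral.integral_mono_on h01 (hii _ hqc) (hii _ c3) fun x hx => ?_
    have h2 := hpos x hx
    have h3 : u x / v x ≤ 1 := (div_le_one h2).2 (hm x hx).2
    have h4 : (1 - x) * u x ≤ u x / v x := by
      rw [le_div_iff₀ h2]
      nlinarith [hle x hx, (hm x hx).1]
    exact pow_le_pow_left₀ (by linarith) (by linarith) 2
end

section
/- Let h_k (k ≥ 1) solve the rescaled Smoluchowski–Horton ODE system, and set γ_k = h_k(1)/h_{k+1}(1). Then γ_k ≤ γ_{k+1} for every k ≥ 1, and consequently the limit lim_{k→∞} h_{k+1}(1)/h_k(1) exists, is finite, and is greater than or equal to 1. -/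
open Filter
open scoped Topology

/-- Integrating factor. -/
lemma gron (p q : ℝ) (hpq : p ≤ q) (f f' g : ℝ → ℝ) (hg : ContinuousOn g (Set.Icc p q))
    (hf : ∀ x ∈ Set.Icc p q, HasDerivWithinAt f (f' x) (Set.Icc p q) x)
    (hge : ∀ x ∈ Set.Icc p q, g x * f x ≤ f' x) :
    (0 ≤ f p → 0 ≤ f q) ∧ (0 < f p → 0 < f q) := by
  set e : ℝ → ℝ := Set.IccExtend hpq (Set.restrict (Set.Icc p q) g) with he
  have hec : Continuous e := (continuousOn_iff_continuous_restrict.1 hg).Icc_extend'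
  have heq : ∀ x ∈ Set.Icc p q, e x = g x := by
    intro x hx
    rw [he, Set.IccExtend_of_mem _ _ hx]; rfl
  set G : ℝ → ℝ := fun x => ∫ t in p..x, e t with hG
  have hGd : ∀ x, HasDerivAt G (e x) x := fun x => hec.integral_hasStrictDerivAt p x |>.hasDerivAt
  have hF : ∀ x ∈ Set.Icc p q, HasDerivWithinAt (fun x => f x * Real.exp (-G x))
      ((f' x - g x * f x) * Real.exp (-G x)) (Set.Icc p q) x := by
    intro x hx
    have h1 := (hf x hx).mul ((hGd x).neg.exp.hasDerivWithinAt (s := Set.Icc p q))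
    refine h1.congr_deriv ?_
    rw [heq x hx]; simp only [Pi.neg_apply]; ring
  have hmono : MonotoneOn (fun x => f x * Real.exp (-G x)) (Set.Icc p q) := by
    apply monotoneOn_of_hasDerivWithinAt_nonneg (convex_Icc p q)
      (f' := fun x => (f' x - g x * f x) * Real.exp (-G x))
    · exact fun x hx => (hF x hx).continuousWithinAt
    · exact fun x hx => (hF x (interior_subset hx)).mono interior_subset
    · intro x hx
      have := hge x (interior_subset hx)
      exact mul_nonneg (by linarith) (Real.exp_pos _).le
  have key := hmono (Set.left_mem_Icc.2 hpq) (Set.right_mem_Icc.2 hpq) hpq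
  simp only at key
  constructor
  · intro h0
    have h1 : 0 ≤ f q * Real.exp (-G q) := le_trans (mul_nonneg h0 (Real.exp_pos _).le) key
    exact nonneg_of_mul_nonneg_left h1 (Real.exp_pos _)
  · intro h0
    have h1 : 0 < f q * Real.exp (-G q) := lt_of_lt_of_le (mul_pos h0 (Real.exp_pos _)) key
    exact pos_of_mul_pos_left h1 (Real.exp_pos _).le

/-- Comparison for the Horton step. -/
lemma compar (p q : ℝ) (hpq : p ≤ q) (a b y z : ℝ → ℝ)
    (hb : ContinuousOn b (Set.Icc p q))
    (hy : ∀ x ∈ Set.Icc p q, HasDerivWithinAt y (2 * a x * y x - a x ^ 2) (Set.Icc p q) x)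
    (hz : ∀ x ∈ Set.Icc p q, HasDerivWithinAt z (2 * b x * z x - b x ^ 2) (Set.Icc p q) x)
    (hay : ∀ x ∈ Set.Icc p q, a x ≤ y x)
    (hba : ∀ x ∈ Set.Icc p q, b x ≤ a x) :
    (z p ≤ y p → z q ≤ y q) ∧ (z p < y p → z q < y q) := by
  have := gron p q hpq (fun x => y x - z x) _ (fun x => 2 * b x)
    (continuousOn_const.mul hb) (fun x hx => (hy x hx).sub (hz x hx)) (by
      intro x hx
      have h1 := hay x hx
      have h2 := hba x hx
      have : 0 ≤ (a x - b x) * (2 * y x - a x - b x) :=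
        mul_nonneg (by linarith) (by linarith)
      nlinarith)
  simpa only [sub_nonneg, sub_pos] using this

theorem stmt16 (h : ℕ → ℝ → ℝ)
    (hh1 : ∀ x : ℝ, h 1 x = 1)
    (hh0 : ∀ k : ℕ, 1 ≤ k → h (k + 1) 0 = 1)
    (hder : ∀ k : ℕ, 1 ≤ k → ∀ x ∈ Set.Icc (0 : ℝ) 1,
      HasDerivWithinAt (h (k + 1)) (2 * h k x * h (k + 1) x - h k x ^ 2)
        (Set.Icc 0 1) x) :
    (∀ k : ℕ, 1 ≤ k → h k 1 / h (k + 1) 1 ≤ h (k + 1) 1 / h (k + 2) 1) ∧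
    ∃ R : ℝ, 1 ≤ R ∧
      Filter.Tendsto (fun k : ℕ => h (k + 1) 1 / h k 1) Filter.atTop (nhds R) := by
  have hh0' : ∀ k : ℕ, 1 ≤ k → h k 0 = 1 := by
    intro k hk
    rcases Nat.lt_or_ge 1 k with h1 | h1
    · obtain ⟨m, rfl⟩ : ∃ m, k = m + 1 := ⟨k - 1, by omega⟩
      exact hh0 m (by omega)
    · obtain rfl : k = 1 := by omega
      exact hh1 0
  have hcont : ∀ k : ℕ, 1 ≤ k → ContinuousOn (h k) (Set.Icc 0 1) := by
    intro k hk
    rcases Nat.lt_or_ge 1 k with h1 | h1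
    · obtain ⟨m, rfl⟩ : ∃ m, k = m + 1 := ⟨k - 1, by omega⟩
      exact fun x hx => (hder m (by omega) x hx).continuousWithinAt
    · obtain rfl : k = 1 := by omega
      exact continuousOn_const.congr (fun x _ => hh1 x)
  -- monotone in k
  have hmon : ∀ k : ℕ, 1 ≤ k → ∀ x ∈ Set.Icc (0 : ℝ) 1, h k x ≤ h (k + 1) x := by
    intro k hk t ht
    have hsub : Set.Icc 0 t ⊆ Set.Icc (0 : ℝ) 1 := Set.Icc_subset_Icc_right ht.2
    rcases Nat.lt_or_ge 1 k with h1 | h1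
    · obtain ⟨m, rfl⟩ : ∃ m, k = m + 1 := ⟨k - 1, by omega⟩
      have := (gron 0 t ht.1 (fun x => h (m + 1 + 1) x - h (m + 1) x) _
        (fun x => 2 * h (m + 1) x)
        (continuousOn_const.mul ((hcont (m + 1) (by omega)).mono hsub))
        (fun x hx => ((hder (m + 1) (by omega) x (hsub hx)).mono hsub).sub
          ((hder m (by omega) x (hsub hx)).mono hsub)) (by
          intro x hx
          nlinarith [sq_nonneg (h (m + 1) x - h m x)])).1
        (by simp only [hh0' (m + 1) (by omega), hh0' (m + 1 + 1) (by omega)]; norm_num)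
      simpa using this
    · obtain rfl : k = 1 := by omega
      have := (gron 0 t ht.1 (fun x => h (1 + 1) x - 1) _
        (fun x => 2) continuousOn_const
        (fun x hx => ((hder 1 (by omega) x (hsub hx)).mono hsub).sub_const 1) (by
          intro x hx
          simp only [hh1]; linarith)).1
        (by simp only [hh0' (1 + 1) (by omega)]; norm_num)
      rw [hh1]; simpa using this
  have hone : ∀ k : ℕ, 1 ≤ k → ∀ x ∈ Set.Icc (0 : ℝ) 1, 1 ≤ h k x := by
    intro k hk
    induction k, hk using Nat.le_induction with
    | base => intro x _; rw [hh1]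
    | succ n hn ih => intro x hx; exact (ih x hx).trans (hmon n hn x hx)
  -- upper bound
  have hup : ∀ k : ℕ, 1 ≤ k → ∀ x : ℝ, 0 ≤ x → x < 1 → h k x ≤ (1 - x)⁻¹ := by
    intro k hk t ht0 ht1
    have hsub : Set.Icc 0 t ⊆ Set.Icc (0 : ℝ) 1 := Set.Icc_subset_Icc_right ht1.le
    rcases Nat.lt_or_ge 1 k with h1 | h1
    · obtain ⟨m, rfl⟩ : ∃ m, k = m + 1 := ⟨k - 1, by omega⟩
      have hd : ∀ x ∈ Set.Icc 0 t, HasDerivWithinAt (fun x : ℝ => (1 - x)⁻¹) ((1 - x)⁻¹ ^ 2)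
          (Set.Icc 0 t) x := by
        intro x hx
        have hx1 : (1 - x) ≠ 0 := by linarith [hx.2]
        have := ((hasDerivAt_id x).const_sub 1).inv hx1
        refine this.hasDerivWithinAt.congr_deriv ?_
        simp
      have := (gron 0 t ht0 (fun x => (1 - x)⁻¹ - h (m + 1) x) _
        (fun x => 2 * h m x)
        (continuousOn_const.mul ((hcont m (by omega)).mono hsub))
        (fun x hx => (hd x hx).sub ((hder m (by omega) x (hsub hx)).mono hsub)) (by
          intro x hx
          nlinarith [sq_nonneg ((1 - x)⁻¹ - h m x)])).1
        (by simp only [hh0' (m + 1) (by omega)]; norm_num)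
      simpa using this
    · obtain rfl : k = 1 := by omega
      rw [hh1]
      exact (one_le_inv₀ (by linarith)).2 (by linarith)
  have hpos1 : ∀ k : ℕ, 1 ≤ k → 0 < h k 1 := fun k hk =>
    lt_of_lt_of_le one_pos (hone k hk 1 (by simp))
  -- scaling
  have hmaps : ∀ μ : ℝ, 1 ≤ μ → ∀ x ∈ Set.Icc (1 - μ⁻¹) 1,
      1 - μ * (1 - x) ∈ Set.Icc (0 : ℝ) 1 := by
    intro μ hμ x hx
    have hμ0 : 0 < μ := by linarith
    have h1 : μ * (1 - x) ≤ μ * μ⁻¹ := mul_le_mul_of_nonneg_left (by linarith [hx.1]) hμ0.le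
    rw [mul_inv_cancel₀ hμ0.ne'] at h1
    have h2 : 0 ≤ μ * (1 - x) := mul_nonneg hμ0.le (by linarith [hx.2])
    exact ⟨by linarith, by linarith⟩
  have hs01 : ∀ μ : ℝ, 1 ≤ μ → Set.Icc (1 - μ⁻¹) 1 ⊆ Set.Icc (0 : ℝ) 1 := by
    intro μ hμ
    exact Set.Icc_subset_Icc_left (by linarith [inv_le_one_of_one_le₀ hμ])
  let A : ℝ → ℕ → ℝ → ℝ := fun μ k x => μ * h k (1 - μ * (1 - x))
  have hAder : ∀ μ : ℝ, 1 ≤ μ → ∀ k : ℕ, 1 ≤ k → ∀ x ∈ Set.Icc (1 - μ⁻¹) 1,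
      HasDerivWithinAt (A μ (k + 1)) (2 * A μ k x * A μ (k + 1) x - A μ k x ^ 2)
        (Set.Icc (1 - μ⁻¹) 1) x := by
    intro μ hμ k hk x hx
    have h1 : HasDerivWithinAt (fun x : ℝ => 1 - μ * (1 - x)) μ (Set.Icc (1 - μ⁻¹) 1) x := by
      have := ((((hasDerivAt_id x).const_sub 1).const_mul μ).const_sub 1)
      exact this.hasDerivWithinAt.congr_deriv (by ring)
    have h2 := ((hder k hk _ (hmaps μ hμ x hx)).comp x h1 (hmaps μ hμ)).const_mul μ
    refine h2.congr_deriv ?_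
    simp only [A]; ring
  have hAcont : ∀ μ : ℝ, 1 ≤ μ → ∀ k : ℕ, 1 ≤ k →
      ContinuousOn (A μ k) (Set.Icc (1 - μ⁻¹) 1) := by
    intro μ hμ k hk
    exact continuousOn_const.mul ((hcont k hk).comp (by fun_prop) (hmaps μ hμ))
  have hAmon : ∀ μ : ℝ, 1 ≤ μ → ∀ k : ℕ, 1 ≤ k → ∀ x ∈ Set.Icc (1 - μ⁻¹) 1,
      A μ k x ≤ A μ (k + 1) x := by
    intro μ hμ k hk x hx
    exact mul_le_mul_of_nonneg_left (hmon k hk _ (hmaps μ hμ x hx)) (by linarith)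
  have hAstart : ∀ μ : ℝ, 1 ≤ μ → ∀ k : ℕ, 1 ≤ k → ∀ j : ℕ, 1 ≤ j →
      h j (1 - μ⁻¹) ≤ A μ k (1 - μ⁻¹) := by
    intro μ hμ k hk j hj
    have hμ0 : 0 < μ := by linarith
    have h1 : A μ k (1 - μ⁻¹) = μ := by
      have : 1 - μ * (1 - (1 - μ⁻¹)) = 0 := by field_simp; ring
      simp only [A, this, hh0' k hk, mul_one]
    rw [h1]
    have h2 := hup j hj (1 - μ⁻¹) (by linarith [inv_le_one_of_one_le₀ hμ])
      (by linarith [inv_pos.2 hμ0])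
    simpa using h2
  -- forward comparison
  have hfwd : ∀ μ : ℝ, 1 ≤ μ → ∀ k : ℕ, 1 ≤ k → ∀ t ∈ Set.Icc (1 - μ⁻¹) 1,
      (∀ x ∈ Set.Icc (1 - μ⁻¹) t, h (k + 1) x ≤ A μ k x) →
      h (k + 2) t ≤ A μ (k + 1) t := by
    intro μ hμ k hk t ht hle
    have hsub : Set.Icc (1 - μ⁻¹) t ⊆ Set.Icc (1 - μ⁻¹) 1 := Set.Icc_subset_Icc_right ht.2
    have hsub' := hsub.trans (hs01 μ hμ)
    exact (compar (1 - μ⁻¹) t ht.1 (A μ k) (h (k + 1)) (A μ (k + 1)) (h (k + 2))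
      ((hcont (k + 1) (by omega)).mono hsub')
      (fun x hx => (hAder μ hμ k hk x (hsub hx)).mono hsub)
      (fun x hx => (hder (k + 1) (by omega) x (hsub' hx)).mono hsub')
      (fun x hx => hAmon μ hμ k hk x (hsub hx)) hle).1
      (hAstart μ hμ (k + 1) (by omega) (k + 2) (by omega))
  -- single crossing
  have hQ : ∀ μ : ℝ, 1 ≤ μ → ∀ k : ℕ, 1 ≤ k → ∀ x ∈ Set.Icc (1 - μ⁻¹) 1,
      ∀ t ∈ Set.Icc x 1, A μ k x < h (k + 1) x → A μ k t < h (k + 1) t := by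
    intro μ hμ k hk
    induction k, hk using Nat.le_induction with
    | base =>
      intro x hx t ht hlt
      simp only [A, hh1] at hlt ⊢
      refine lt_of_lt_of_le hlt ?_
      have hm : MonotoneOn (h (1 + 1)) (Set.Icc 0 1) := by
        apply monotoneOn_of_hasDerivWithinAt_nonneg (convex_Icc 0 1)
          (f' := fun x => 2 * h 1 x * h (1 + 1) x - h 1 x ^ 2) (hcont 2 (by omega))
        · exact fun x hx => (hder 1 le_rfl x (interior_subset hx)).mono interior_subset
        · intro x hx
          have := hone 2 (by omega) x (interior_subset hx)
          simp only [hh1]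
          norm_num at this ⊢
          linarith
      have hx0 := hs01 μ hμ hx
      exact hm hx0 ⟨hx0.1.trans ht.1, ht.2⟩ ht.1
    | succ n hn ih =>
      intro x hx t ht hlt
      by_cases hc : A μ n x < h (n + 1) x
      · have hsub : Set.Icc x t ⊆ Set.Icc (1 - μ⁻¹) 1 := Set.Icc_subset_Icc hx.1 ht.2
        have hsub' := hsub.trans (hs01 μ hμ)
        exact (compar x t ht.1 (h (n + 1)) (A μ n) (h (n + 2)) (A μ (n + 1))
          ((hAcont μ hμ n hn).mono hsub)
          (fun x hx => (hder (n + 1) (by omega) x (hsub' hx)).mono hsub')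
          (fun x hx => (hAder μ hμ n hn x (hsub hx)).mono hsub)
          (fun x hx => hmon (n + 1) (by omega) x (hsub' hx))
          (fun y hy => (ih x hx y ⟨hy.1, hy.2.trans ht.2⟩ hc).le)).2 hlt
      · exfalso
        refine absurd (hfwd μ hμ n hn x hx ?_) (not_le.2 hlt)
        intro y hy
        by_contra hcon
        exact hc (ih y ⟨hy.1, hy.2.trans hx.2⟩ x ⟨hy.2, hx.2⟩ (not_le.1 hcon))
  have hratio1 : ∀ k : ℕ, 1 ≤ k → 1 ≤ h (k + 1) 1 / h k 1 := fun k hk =>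
    (one_le_div (hpos1 k hk)).2 (hmon k hk 1 (by simp))
  have hmain : ∀ k : ℕ, 1 ≤ k → h (k + 2) 1 ≤ h (k + 1) 1 / h k 1 * h (k + 1) 1 := by
    intro k hk
    set μ := h (k + 1) 1 / h k 1 with hμd
    have hμ : 1 ≤ μ := hratio1 k hk
    have hmem : (1 : ℝ) ∈ Set.Icc (1 - μ⁻¹) 1 :=
      ⟨by linarith [inv_pos.2 (show 0 < μ by linarith)], le_rfl⟩
    have h1 := hfwd μ hμ k hk 1 hmem (by
      intro x hx
      by_contra hcon
      have h2 := hQ μ hμ k hk x hx 1 ⟨hx.2, le_rfl⟩ (not_le.1 hcon)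
      simp only [A, sub_self, mul_zero, sub_zero] at h2
      rw [hμd, div_mul_cancel₀ _ (hpos1 k hk).ne'] at h2
      exact lt_irrefl _ h2)
    simpa only [A, sub_self, mul_zero, sub_zero] using h1
  refine ⟨?_, ?_⟩
  · intro k hk
    have h1 := hmain k hk
    have p0 := hpos1 k hk
    have p1 := hpos1 (k + 1) (by omega)
    have p2 := hpos1 (k + 2) (by omega)
    rw [div_mul_eq_mul_div, le_div_iff₀ p0] at h1
    rw [div_le_div_iff₀ p1 p2]
    linarith
  · let r : ℕ → ℝ := fun k => h (k + 1 + 1) 1 / h (k + 1) 1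
    have hr : Antitone r := by
      apply antitone_nat_of_succ_le
      intro n
      exact (div_le_iff₀ (hpos1 (n + 2) (by omega))).2 (hmain (n + 1) (by omega))
    have hb : BddBelow (Set.range r) := ⟨1, by
      rintro _ ⟨n, rfl⟩
      exact hratio1 (n + 1) (by omega)⟩
    refine ⟨⨅ i, r i, le_ciInf fun n => hratio1 (n + 1) (by omega), ?_⟩
    exact (tendsto_add_atTop_iff_nat (f := fun k : ℕ => h (k + 1) 1 / h k 1) 1).1
      (tendsto_atTop_ciInf hr hb)
end

section
/- Let g_k (k ≥ 1) solve the Smoluchowski–Horton ODE system for Kingman's coalescent, and set 𝒩_j = (1/2)·∫₀^∞ g_j(t)² dt for j ≥ 1 (so 𝒩_1 = 1). Then the limit R = lim_{j→∞} (𝒩_j)^{−1/j} exists and satisfies 2 ≤ R ≤ 4 (the root-Horton law for Kingman's coalescent, with Horton exponent R). -/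
open Filter MeasureTheory
open scoped Topology

lemma gron_s17 {a b : ℝ} (hab : a ≤ b) (c f f' : ℝ → ℝ) (hc : ContinuousOn c (Set.Icc a b))
    (hf : ∀ x ∈ Set.Icc a b, HasDerivWithinAt f (f' x) (Set.Icc a b) x)
    (h : ∀ x ∈ Set.Icc a b, c x * f x ≤ f' x) : ∃ e : ℝ, 0 < e ∧ f a ≤ f b * e := by
  set d : ℝ → ℝ := fun t => c (max a (min t b)) with hd
  have hdc : Continuous d := by
    apply hc.comp_continuous (by fun_prop)
    intro x
    exact ⟨le_max_left _ _, max_le hab (min_le_right _ _)⟩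
  have hdx : ∀ x ∈ Set.Icc a b, d x = c x := by
    intro x hx
    simp [hd, hx.1, hx.2]
  set C : ℝ → ℝ := fun x => ∫ t in a..x, d t with hC
  have hCd : ∀ x, HasDerivAt C (d x) x := fun x =>
    intervalIntegral.integral_hasDerivAt_right (hdc.intervalIntegrable _ _)
      hdc.aestronglyMeasurable.stronglyMeasurableAtFilter hdc.continuousAt
  have hF : ∀ x ∈ Set.Icc a b, HasDerivWithinAt (fun x => f x * Real.exp (-C x))
      (f' x * Real.exp (-C x) + f x * (Real.exp (-C x) * (-d x))) (Set.Icc a b) x := fun x hx =>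
    (hf x hx).mul ((hCd x).neg.exp.hasDerivWithinAt)
  have hm : MonotoneOn (fun x => f x * Real.exp (-C x)) (Set.Icc a b) := by
    apply monotoneOn_of_hasDerivWithinAt_nonneg (convex_Icc a b)
      (f' := fun x => f' x * Real.exp (-C x) + f x * (Real.exp (-C x) * (-d x)))
    · exact fun x hx => (hF x hx).continuousWithinAt
    · exact fun x hx => (hF x (interior_subset hx)).mono interior_subset
    · intro x hx
      have hx' := interior_subset hx
      have h1 := h x hx'
      rw [← hdx x hx'] at h1
      have := mul_nonneg (sub_nonneg.2 h1) (Real.exp_pos (-C x)).le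
      nlinarith
  have := hm (Set.left_mem_Icc.2 hab) (Set.right_mem_Icc.2 hab) hab
  simp only [hC, intervalIntegral.integral_same, neg_zero, Real.exp_zero, mul_one] at this
  exact ⟨_, Real.exp_pos _, this⟩

lemma gron_nonneg {a b : ℝ} (hab : a ≤ b) (c f f' : ℝ → ℝ) (hc : ContinuousOn c (Set.Icc a b))
    (hf : ∀ x ∈ Set.Icc a b, HasDerivWithinAt f (f' x) (Set.Icc a b) x)
    (h : ∀ x ∈ Set.Icc a b, c x * f x ≤ f' x) (h0 : 0 ≤ f a) : 0 ≤ f b := by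
  obtain ⟨e, he, h1⟩ := gron_s17 hab c f f' hc hf h
  exact nonneg_of_mul_nonneg_left (h0.trans h1) he

lemma ex_step (a : ℝ → ℝ) (ha : Continuous a) :
    ∃ b : ℝ → ℝ, b 0 = 1 ∧ ∀ x, HasDerivAt b (2 * a x * b x - a x ^ 2) x := by
  set C : ℝ → ℝ := fun x => ∫ t in (0:ℝ)..x, 2 * a t with hC
  have hCd : ∀ x, HasDerivAt C (2 * a x) x := fun x =>
    have hdc : Continuous fun t => 2 * a t := by fun_prop
    intervalIntegral.integral_hasDerivAt_right (hdc.intervalIntegrable _ _)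
      hdc.aestronglyMeasurable.stronglyMeasurableAtFilter hdc.continuousAt
  have hCc : Continuous C := continuous_iff_continuousAt.2 fun x => (hCd x).continuousAt
  set D : ℝ → ℝ := fun x => ∫ t in (0:ℝ)..x, a t ^ 2 * Real.exp (-C t) with hD
  have hDd : ∀ x, HasDerivAt D (a x ^ 2 * Real.exp (-C x)) x := fun x =>
    have hdc : Continuous fun t => a t ^ 2 * Real.exp (-C t) := by fun_prop
    intervalIntegral.integral_hasDerivAt_right (hdc.intervalIntegrable _ _)
      hdc.aestronglyMeasurable.stronglyMeasurableAtFilter hdc.continuousAt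
  refine ⟨fun x => Real.exp (C x) * (1 - D x), by simp [hC, hD], fun x => ?_⟩
  have : Real.exp (C x) * Real.exp (-C x) = 1 := by rw [← Real.exp_add]; simp
  refine ((hCd x).exp.mul ((hDd x).const_sub 1)).congr_deriv ?_
  linear_combination (-a x ^ 2) * this

structure HSeq (H : ℕ → ℝ → ℝ) : Prop where
  zero : ∀ x, H 0 x = 0
  one : ∀ k, H (k + 1) 0 = 1
  der : ∀ k x, HasDerivAt (H (k + 1)) (2 * H k x * H (k + 1) x - H k x ^ 2) x

lemma ex_H : ∃ H, HSeq H := by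
  choose! S hS0 hS using ex_step
  let H : ℕ → ℝ → ℝ := fun k => Nat.rec (fun _ => 0) (fun _ p => S p) k
  have hc : ∀ k, Continuous (H k) := by
    intro k
    induction k with
    | zero => exact continuous_const
    | succ k ih => exact continuous_iff_continuousAt.2 fun x => (hS (H k) ih x).continuousAt
  exact ⟨H, fun _ => rfl, fun k => hS0 _ (hc k), fun k x => hS _ (hc k) x⟩

namespace HSeq
variable {H : ℕ → ℝ → ℝ} (h : HSeq H)
include h

lemma cont (k : ℕ) : Continuous (H k) := by
  cases k with
  | zero => exact (by funext x; exact h.zero x : H 0 = fun _ => 0) ▸ continuous_const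
  | succ k => exact continuous_iff_continuousAt.2 fun x => (h.der k x).continuousAt

lemma step (k : ℕ) {x : ℝ} (hx : 0 ≤ x) : H k x ≤ H (k + 1) x := by
  have key : 0 ≤ H (k + 1) x - H k x := by
    cases k with
    | zero =>
      have := gron_nonneg hx (fun _ => 0) (fun x => H 1 x) (fun _ => 0) continuousOn_const
        (fun x _ => by simpa [h.zero] using (h.der 0 x).hasDerivWithinAt) (by simp) (by simp [h.one])
      simpa [h.zero] using this
    | succ k =>
      refine gron_nonneg hx (fun x => 2 * H (k + 1) x) (fun x => H (k + 1 + 1) x - H (k + 1) x) _ ?_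
        (fun x _ => ((h.der (k + 1) x).sub (h.der k x)).hasDerivWithinAt) ?_ ?_
      · exact ((h.cont (k + 1)).const_mul 2).continuousOn
      · intro y _
        nlinarith [sq_nonneg (H (k + 1) y - H k y)]
      · simp [h.one]
  linarith

lemma nonneg (k : ℕ) {x : ℝ} (hx : 0 ≤ x) : 0 ≤ H k x := by
  induction k with
  | zero => simp [h.zero]
  | succ k ih => exact ih.trans (h.step k hx)

lemma mono (k : ℕ) : MonotoneOn (H k) (Set.Ici 0) := by
  cases k with
  | zero => intro x _ y _ _; simp [h.zero]
  | succ k =>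
    apply monotoneOn_of_hasDerivWithinAt_nonneg (convex_Ici 0) (h.cont _).continuousOn
      (fun x _ => (h.der k x).hasDerivWithinAt)
    intro x hx
    have hx' : (0:ℝ) ≤ x := interior_subset hx
    nlinarith [mul_nonneg (h.nonneg k hx') (sub_nonneg.2 (h.step k hx')), sq_nonneg (H k x)]

lemma one_le (k : ℕ) {x : ℝ} (hx : 0 ≤ x) : 1 ≤ H (k + 1) x := by
  rw [← h.one k]
  exact h.mono (k + 1) (Set.mem_Ici.2 le_rfl) hx hx

lemma upper (k : ℕ) {x : ℝ} (hx : 0 ≤ x) (hx1 : x ≤ 1) : (1 - x) * H k x ≤ 1 := by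
  cases k with
  | zero => simp [h.zero]
  | succ k =>
    have := gron_nonneg hx (fun x => H (k + 1) x) (fun x => 1 - (1 - x) * H (k + 1) x) _
      (h.cont _).continuousOn
      (fun x _ => (((((hasDerivAt_id x).const_sub 1).mul (h.der k x)).const_sub 1)).hasDerivWithinAt)
      (by
        intro y hy
        have : 0 ≤ 1 - y := by linarith [hy.2]
        simp only [id]
        nlinarith [mul_nonneg this (sq_nonneg (H (k + 1) y - H k y))])
      (by simp [h.one])
    linarith

lemma lower (k : ℕ) {x : ℝ} (hx1 : x ≤ 1) :
    1 ≤ H (k + 1) x * (1 - x + 1 / H (k + 1) 1) := by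
  set A := H (k + 1) 1 with hA
  have hA1 : 1 ≤ A := h.one_le k zero_le_one
  obtain ⟨e, he, h1⟩ := gron_s17 hx1 (fun x => H (k + 1) x)
    (fun x => 1 - H (k + 1) x * (1 - x + 1 / A)) _
      (h.cont _).continuousOn
      (fun x _ => ((((h.der k x).mul (((hasDerivAt_id x).const_sub 1).add_const (1 / A))).const_sub 1)).hasDerivWithinAt)
      (by
        intro y hy
        have : 0 ≤ 1 - y + 1 / A := by
          have : 0 ≤ 1 / A := by positivity
          linarith [hy.2]
        simp only [id]
        nlinarith [mul_nonneg this (sq_nonneg (H (k + 1) y - H k y))])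
  have h2 : 1 - H (k + 1) 1 * (1 - 1 + 1 / A) = 0 := by
    rw [← hA]; field_simp; ring
  simp only [h2, zero_mul] at h1
  linarith

lemma submul (i k : ℕ) : H (i + k + 1) 1 ≤ H (i + 1) 1 * H (k + 1) 1 := by
  set A := H (i + 1) 1 with hA
  have hA1 : 1 ≤ A := h.one_le i zero_le_one
  have hA0 : 0 < A := by linarith
  have hiA : 1 / A ≤ 1 := by rw [div_le_one hA0]; exact hA1
  have hiA0 : 0 < 1 / A := by positivity
  set x0 := 1 - 1 / A with hx0
  have hAx : A * (1 - x0) = 1 := by rw [hx0]; field_simp; ring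
  have main : ∀ k, ∀ x, x0 ≤ x → x ≤ 1 → H (i + k + 1) x ≤ A * H (k + 1) (A * (x - x0)) := by
    intro k
    induction k with
    | zero =>
      intro x h0 h1
      have h3 : H (i + 1) x ≤ A := h.mono (i + 1) (by simp; linarith) (by simp) h1
      have h4 := h.one_le 0 (x := A * (x - x0)) (mul_nonneg hA0.le (by linarith))
      simp only [Nat.add_zero]
      nlinarith
    | succ k ih =>
      intro x h0 h1
      have := gron_nonneg h0 (fun x => 2 * H (i + k + 1) x)
        (fun x => A * H (k + 1 + 1) (A * (x - x0)) - H (i + k + 1 + 1) x) _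
        ((h.cont _).const_mul 2).continuousOn
        (fun x _ => ((((h.der (k + 1) (A * (x - x0))).comp x
          (((hasDerivAt_id x).sub_const x0).const_mul A)).const_mul A).sub
            (h.der (i + k + 1) x)).hasDerivWithinAt)
        (by
          intro y hy
          have a1 := ih y hy.1 (hy.2.trans h1)
          have hy0 : 0 ≤ A * (y - x0) := mul_nonneg hA0.le (by linarith [hy.1])
          have a2 := mul_le_mul_of_nonneg_left (h.step (k + 1) hy0) hA0.le
          simp only [mul_one]
          nlinarith [mul_nonneg (sub_nonneg.2 a1)
            (by linarith : 0 ≤ 2 * (A * H (k + 1 + 1) (A * (y - x0))) - A * H (k + 1) (A * (y - x0))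
              - H (i + k + 1) y)])
        (by
          have := h.upper (i + k + 1 + 1) (x := x0) (by linarith) (by linarith)
          simp only [sub_self, mul_zero, h.one, mul_one]
          nlinarith)
      have e : i + (k + 1) + 1 = i + k + 1 + 1 := by ring
      rw [e]
      linarith
  have := main k 1 (by linarith) le_rfl
  rwa [hAx] at this

end HSeq

lemma intg {a c : ℝ} (K : ℝ) (h : 0 < a + c) :
    IntegrableOn (fun t : ℝ => (K / (t + c)) ^ 2) (Set.Ioi a) ∧
      ∫ t in Set.Ioi a, (K / (t + c)) ^ 2 = K ^ 2 / (a + c) := by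
  have hd : ∀ t ∈ Set.Ici a, HasDerivAt (fun t : ℝ => -(K ^ 2 / (t + c))) ((K / (t + c)) ^ 2) t := by
    intro t ht
    have ht' : t + c ≠ 0 := by have : a ≤ t := ht; linarith
    refine (((hasDerivAt_const t (K ^ 2)).div ((hasDerivAt_id t).add_const c) ht').neg).congr_deriv ?_
    simp only [id]
    field_simp
    ring
  have hl : Tendsto (fun t : ℝ => -(K ^ 2 / (t + c))) atTop (𝓝 0) := by
    have := (tendsto_const_nhds (x := K ^ 2)).div_atTop (tendsto_atTop_add_const_right atTop c tendsto_id)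
    simpa using this.neg
  refine ⟨integrableOn_Ioi_deriv_of_nonneg' hd (fun t _ => sq_nonneg _) hl, ?_⟩
  rw [integral_Ioi_of_hasDerivAt_of_nonneg' hd (fun t _ => sq_nonneg _) hl]
  ring

section main
variable {H : ℕ → ℝ → ℝ} (h : HSeq H) (g : ℕ → ℝ → ℝ)
    (hg1 : ∀ t : ℝ, g 1 t = 2 / (t + 2))
    (hg0 : ∀ k : ℕ, 1 ≤ k → g (k + 1) 0 = 0)
    (hder : ∀ k : ℕ, 1 ≤ k → ∀ t ∈ Set.Ici (0 : ℝ),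
      HasDerivWithinAt (g (k + 1)) (g k t ^ 2 / 2 - g k t * g (k + 1) t)
        (Set.Ici 0) t)
include h hg1 hg0 hder

omit h hg0 in
lemma gcont (k : ℕ) : ContinuousOn (g (k + 1)) (Set.Ici 0) := by
  cases k with
  | zero =>
    have : g 1 = fun t => 2 / (t + 2) := funext hg1
    rw [zero_add, this]
    apply ContinuousOn.div (by fun_prop) (by fun_prop)
    intro x hx
    have : (0:ℝ) ≤ x := hx
    linarith
  | succ k => exact fun t ht => (hder (k + 1) (by omega) t ht).continuousWithinAt

lemma gform (k : ℕ) : ∀ t : ℝ, 0 ≤ t →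
    g (k + 1) t = 2 / (t + 2) - (2 / (t + 2)) ^ 2 * H k (1 - 2 / (t + 2)) := by
  induction k with
  | zero => intro t _; simp [h.zero, hg1]
  | succ k ih =>
    intro T hT
    set G : ℝ → ℝ := fun t => 2 / (t + 2) - (2 / (t + 2)) ^ 2 * H (k + 1) (1 - 2 / (t + 2)) with hG
    have hs : ∀ t : ℝ, 0 ≤ t → HasDerivAt (fun t : ℝ => 2 / (t + 2)) (-(2 / (t + 2)) ^ 2 / 2) t := by
      intro t ht
      have ht' : t + 2 ≠ 0 := by linarith
      refine ((hasDerivAt_const t (2 : ℝ)).div ((hasDerivAt_id t).add_const 2) ht').congr_deriv ?_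
      simp only [id]
      field_simp
      ring
    have hGd : ∀ t : ℝ, 0 ≤ t → HasDerivAt G (g (k + 1) t ^ 2 / 2 - g (k + 1) t * G t) t := by
      intro t ht
      have h1 := (hs t ht).sub (((hs t ht).pow 2).mul
        ((h.der k (1 - 2 / (t + 2))).comp t ((hs t ht).const_sub 1)))
      refine h1.congr_deriv ?_
      rw [ih t ht, hG]
      simp
      ring
    have hD : ∀ t ∈ Set.Icc 0 T, HasDerivWithinAt (fun t => g (k + 1 + 1) t - G t)
        (-g (k + 1) t * (g (k + 1 + 1) t - G t)) (Set.Icc 0 T) t := by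
      intro t ht
      refine (((hder (k + 1) (by omega) t ht.1).mono Set.Icc_subset_Ici_self).sub
        (hGd t ht.1).hasDerivWithinAt).congr_deriv ?_
      ring
    have hc : ContinuousOn (fun t => -g (k + 1) t) (Set.Icc 0 T) :=
      ((gcont g hg1 hder k).mono Set.Icc_subset_Ici_self).neg
    have hG0 : G 0 = 0 := by
      simp [hG, h.one]
    have p1 := gron_nonneg hT _ _ _ hc hD (fun x _ => le_rfl)
      (by rw [hG0, hg0 (k + 1) (by omega)]; simp)
    have p2 := gron_nonneg hT _ _ _ hc (fun t ht => (hD t ht).neg)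
      (fun x _ => by simp only [Pi.neg_apply]; linarith)
      (by simp [hG0, hg0 (k + 1) (by omega)])
    simp only [Pi.neg_apply] at p2
    have : g (k + 1 + 1) T = G T := by linarith
    exact this

omit h hg1 hg0 hder in
lemma sbd {t : ℝ} (ht : 0 ≤ t) : 0 < 2 / (t + 2) ∧ 2 / (t + 2) ≤ 1 :=
  ⟨by positivity, by rw [div_le_one (by linarith)]; linarith⟩

lemma gnonneg (k : ℕ) {t : ℝ} (ht : 0 ≤ t) : 0 ≤ g (k + 1) t := by
  obtain ⟨s0, s1⟩ := sbd ht
  rw [gform h g hg1 hg0 hder k t ht]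
  set s := 2 / (t + 2)
  have := h.upper k (x := 1 - s) (by linarith) (by linarith)
  nlinarith

lemma gle (k : ℕ) {t : ℝ} (ht : 0 ≤ t) : g (k + 1) t ≤ 2 / (t + 2) := by
  obtain ⟨s0, s1⟩ := sbd ht
  rw [gform h g hg1 hg0 hder k t ht]
  set s := 2 / (t + 2)
  have := h.nonneg k (x := 1 - s) (by linarith)
  nlinarith [mul_nonneg (sq_nonneg s) this]

lemma gstep (k : ℕ) {t : ℝ} (ht : 0 ≤ t) : g (k + 1 + 1) t ≤ g (k + 1) t := by
  obtain ⟨s0, s1⟩ := sbd ht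
  rw [gform h g hg1 hg0 hder k t ht, gform h g hg1 hg0 hder (k + 1) t ht]
  set s := 2 / (t + 2)
  have := h.step k (x := 1 - s) (by linarith)
  nlinarith [mul_nonneg (sq_nonneg s) (sub_nonneg.2 this)]

lemma gle2 (k : ℕ) {t : ℝ} (ht : 0 ≤ t) :
    g (k + 1 + 1) t ≤ 2 / (t + (2 + 2 * H (k + 1) 1)) := by
  obtain ⟨s0, s1⟩ := sbd ht
  have hA1 : 1 ≤ H (k + 1) 1 := h.one_le k zero_le_one
  have e : 2 / (t + (2 + 2 * H (k + 1) 1)) =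
      2 / (t + 2) / (1 + H (k + 1) 1 * (2 / (t + 2))) := by
    field_simp
    ring
  rw [gform h g hg1 hg0 hder (k + 1) t ht, e]
  set s := 2 / (t + 2)
  have := h.lower k (x := 1 - s) (by linarith)
  set A := H (k + 1) 1
  set u := H (k + 1) (1 - s)
  have hA0 : 0 < A := by linarith
  have h2 : A ≤ u * (A * s + 1) := by
    have := mul_le_mul_of_nonneg_right this hA0.le
    have e : u * (1 - (1 - s) + 1 / A) * A = u * (A * s + 1) := by field_simp; ring
    linarith
  rw [le_div_iff₀ (by positivity)]
  nlinarith [mul_nonneg (sq_nonneg s) (sub_nonneg.2 h2)]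

lemma gge (k : ℕ) {t : ℝ} (ht : 4 * H (k + 1) 1 - 2 ≤ t) :
    1 / (t + 2) ≤ g (k + 1 + 1) t := by
  have hA1 : 1 ≤ H (k + 1) 1 := h.one_le k zero_le_one
  have ht0 : 0 ≤ t := by linarith
  obtain ⟨s0, s1⟩ := sbd ht0
  have hsA : 2 / (t + 2) * H (k + 1) 1 ≤ 1 / 2 := by
    rw [div_mul_eq_mul_div, div_le_iff₀ (by linarith)]; linarith
  have e : 1 / (t + 2) = 2 / (t + 2) / 2 := by ring
  rw [gform h g hg1 hg0 hder (k + 1) t ht0, e]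
  set s := 2 / (t + 2)
  have : H (k + 1) (1 - s) ≤ H (k + 1) 1 := h.mono (k + 1) (by simp; linarith) (by simp) (by linarith)
  nlinarith [mul_nonneg (sq_nonneg s) (sub_nonneg.2 this), mul_nonneg s0.le (sub_nonneg.2 hsA)]

lemma gint (k l : ℕ) : IntegrableOn (fun t => g (k + 1) t * g (l + 1) t) (Set.Ioi 0) := by
  refine Integrable.mono' (intg (a := 0) (c := 2) 2 (by norm_num)).1 ?_ ?_
  · exact (((gcont g hg1 hder k).mul (gcont g hg1 hder l)).mono Set.Ioi_subset_Ici_self).aestronglyMeasurable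
      measurableSet_Ioi
  · filter_upwards [ae_restrict_mem measurableSet_Ioi] with t ht
    have ht' : (0:ℝ) ≤ t := le_of_lt ht
    rw [Real.norm_of_nonneg (mul_nonneg (gnonneg h g hg1 hg0 hder k ht') (gnonneg h g hg1 hg0 hder l ht')), sq]
    exact mul_le_mul (gle h g hg1 hg0 hder k ht') (gle h g hg1 hg0 hder l ht')
      (gnonneg h g hg1 hg0 hder l ht') (sbd ht').1.le

lemma gint2 (k : ℕ) : IntegrableOn (fun t => g (k + 1) t ^ 2) (Set.Ioi 0) := by
  simpa only [sq] using gint h g hg1 hg0 hder k k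

lemma gbal (k : ℕ) : ∫ t in Set.Ioi (0:ℝ), g (k + 1) t ^ 2 =
    2 * ∫ t in Set.Ioi (0:ℝ), g (k + 1) t * g (k + 1 + 1) t := by
  have hl : Tendsto (g (k + 1 + 1)) atTop (𝓝 0) := by
    have hl2 : Tendsto (fun t : ℝ => 2 / (t + 2)) atTop (𝓝 0) :=
      (tendsto_const_nhds (x := (2:ℝ))).div_atTop (tendsto_atTop_add_const_right atTop 2 tendsto_id)
    refine tendsto_of_tendsto_of_tendsto_of_le_of_le' tendsto_const_nhds hl2 ?_ ?_
    · filter_upwards [eventually_ge_atTop 0] with t ht using gnonneg h g hg1 hg0 hder (k + 1) ht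
    · filter_upwards [eventually_ge_atTop 0] with t ht using gle h g hg1 hg0 hder (k + 1) ht
  have i1 := (gint2 h g hg1 hg0 hder k).div_const 2
  have i2 := gint h g hg1 hg0 hder k (k + 1)
  have := integral_Ioi_of_hasDerivAt_of_tendsto (a := 0) (f := g (k + 1 + 1))
    (f' := fun t => g (k + 1) t ^ 2 / 2 - g (k + 1) t * g (k + 1 + 1) t)
    ((gcont g hg1 hder (k + 1)) 0 (by simp))
    (fun t ht => (hder (k + 1) (by omega) t (Set.mem_Ici.2 (le_of_lt (Set.mem_Ioi.1 ht)))).hasDerivAt (Ici_mem_nhds ht))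
    (i1.sub i2) hl
  rw [integral_sub i1 i2, integral_div, hg0 (k + 1) (by omega)] at this
  linarith

lemma half (k : ℕ) : 2 * ∫ t in Set.Ioi (0:ℝ), g (k + 1 + 1) t ^ 2 ≤ ∫ t in Set.Ioi (0:ℝ), g (k + 1) t ^ 2 := by
  rw [gbal h g hg1 hg0 hder k]
  have := setIntegral_mono_on (gint2 h g hg1 hg0 hder (k + 1)) (gint h g hg1 hg0 hder k (k + 1))
    measurableSet_Ioi (fun t ht => by
      have ht' : (0:ℝ) ≤ t := le_of_lt ht
      rw [sq]
      exact mul_le_mul_of_nonneg_right (gstep h g hg1 hg0 hder k ht')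
        (gnonneg h g hg1 hg0 hder (k + 1) ht'))
  linarith

lemma quarter (k : ℕ) : ∫ t in Set.Ioi (0:ℝ), g (k + 1) t ^ 2 ≤ 4 * ∫ t in Set.Ioi (0:ℝ), g (k + 1 + 1) t ^ 2 := by
  have hb := gbal h g hg1 hg0 hder k
  have i1 := (gint2 h g hg1 hg0 hder k).div_const 4
  have i2 := gint2 h g hg1 hg0 hder (k + 1)
  have := setIntegral_mono_on (gint h g hg1 hg0 hder k (k + 1)) (i1.add i2)
    measurableSet_Ioi (fun t ht => by
      simp only [Pi.add_apply]
      nlinarith [sq_nonneg (g (k + 1) t - 2 * g (k + 1 + 1) t)])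
  simp only [Pi.add_apply] at this
  rw [integral_add i1 i2, integral_div] at this
  linarith

lemma Nupper (k : ℕ) : (1 / 2) * ∫ t in Set.Ioi (0:ℝ), g (k + 1 + 1) t ^ 2 ≤ 1 / H (k + 1) 1 := by
  have hA1 : 1 ≤ H (k + 1) 1 := h.one_le k zero_le_one
  obtain ⟨j1, j2⟩ := intg (a := 0) (c := 2 + 2 * H (k + 1) 1) 2 (by linarith)
  have := setIntegral_mono_on (gint2 h g hg1 hg0 hder (k + 1)) j1
    measurableSet_Ioi (fun t ht => by
      have ht' : (0:ℝ) ≤ t := le_of_lt ht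
      exact pow_le_pow_left₀ (gnonneg h g hg1 hg0 hder (k + 1) ht') (gle2 h g hg1 hg0 hder k ht') 2)
  rw [j2] at this
  have h3 : (2:ℝ) ^ 2 / (0 + (2 + 2 * H (k + 1) 1)) ≤ 2 / H (k + 1) 1 := by
    rw [div_le_div_iff₀ (by linarith) (by linarith)]; linarith
  have h4 : 2 / H (k + 1) 1 = 2 * (1 / H (k + 1) 1) := by ring
  linarith

lemma Nlower (k : ℕ) : 1 / (8 * H (k + 1) 1) ≤ (1 / 2) * ∫ t in Set.Ioi (0:ℝ), g (k + 1 + 1) t ^ 2 := by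
  have hA1 : 1 ≤ H (k + 1) 1 := h.one_le k zero_le_one
  set T := 4 * H (k + 1) 1 - 2 with hT
  obtain ⟨j1, j2⟩ := intg (a := T) (c := 2) 1 (by linarith)
  have hi := gint2 h g hg1 hg0 hder (k + 1)
  have hsub : Set.Ioi T ⊆ Set.Ioi 0 := Set.Ioi_subset_Ioi (by linarith)
  have h1 := setIntegral_mono_on j1 (hi.mono_set hsub)
    measurableSet_Ioi (fun t ht => by
      have ht' : T < t := ht
      exact pow_le_pow_left₀ (by apply div_nonneg <;> linarith) (gge h g hg1 hg0 hder k ht'.le) 2)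
  have h2 := setIntegral_mono_set hi (ae_of_all _ fun t => sq_nonneg (g (k + 1 + 1) t))
    (LE.le.eventuallyLE hsub)
  rw [j2] at h1
  have h3 : (1:ℝ) ^ 2 / (T + 2) = 2 * (1 / (8 * H (k + 1) 1)) := by
    rw [hT]; field_simp; ring
  linarith

end main

/-- Root-Horton law for Kingman's coalescent: with
`𝒩_j = (1/2)∫₀^∞ g_j(t)² dt` (so `𝒩₁ = 1`) defined from the Smoluchowski–Horton
ODE system, the limit `R = lim_{j→∞} 𝒩_j^{-1/j}` exists and satisfies `2 ≤ R ≤ 4`. -/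
theorem stmt17 (g : ℕ → ℝ → ℝ)
    (hg1 : ∀ t : ℝ, g 1 t = 2 / (t + 2))
    (hg0 : ∀ k : ℕ, 1 ≤ k → g (k + 1) 0 = 0)
    (hder : ∀ k : ℕ, 1 ≤ k → ∀ t ∈ Set.Ici (0 : ℝ),
      HasDerivWithinAt (g (k + 1)) (g k t ^ 2 / 2 - g k t * g (k + 1) t)
        (Set.Ici 0) t) :
    (1 / 2) * (∫ t in Set.Ioi (0 : ℝ), g 1 t ^ 2) = 1 ∧
    ∃ R : ℝ, 2 ≤ R ∧ R ≤ 4 ∧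
      Filter.Tendsto
        (fun j : ℕ => ((1 / 2) * ∫ t in Set.Ioi (0 : ℝ), g j t ^ 2) ^ (-(j : ℝ)⁻¹))
        Filter.atTop (nhds R) := by
  have hN1 : (1 / 2) * (∫ t in Set.Ioi (0 : ℝ), g 1 t ^ 2) = 1 := by
    simp only [hg1]
    rw [(intg (a := 0) (c := 2) 2 (by norm_num)).2]
    norm_num
  refine ⟨hN1, ?_⟩
  obtain ⟨H, h⟩ := ex_H
  set N : ℕ → ℝ := fun j => (1 / 2) * ∫ t in Set.Ioi (0 : ℝ), g j t ^ 2 with hN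
  change ∃ R : ℝ, 2 ≤ R ∧ R ≤ 4 ∧ Tendsto (fun j : ℕ => N j ^ (-(j : ℝ)⁻¹)) atTop (nhds R)
  have hhalf : ∀ k, N (k + 1) ≤ (1 / 2) ^ k := by
    intro k
    induction k with
    | zero => simpa [hN] using hN1.le
    | succ k ih =>
      have := half h g hg1 hg0 hder k
      have e : N (k + 1 + 1) ≤ N (k + 1) * (1 / 2) := by simp only [hN]; linarith
      rw [pow_succ]
      linarith
  have hquart : ∀ k, (1 / 4) ^ k ≤ N (k + 1) := by
    intro k
    induction k with
    | zero => simpa [hN] using hN1.ge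
    | succ k ih =>
      have := quarter h g hg1 hg0 hder k
      have e : N (k + 1) * (1 / 4) ≤ N (k + 1 + 1) := by simp only [hN]; linarith
      rw [pow_succ]
      linarith
  have hpos : ∀ k, 0 < N (k + 1) := fun k => lt_of_lt_of_le (by positivity) (hquart k)
  have hA : ∀ k, 1 ≤ H (k + 1) 1 := fun k => h.one_le k zero_le_one
  set u : ℕ → ℝ := fun k => Real.log (H (k + 1) 1) with hu
  have hsub : Subadditive u := by
    intro i k
    have p1 := hA i
    have p2 := hA k
    have p3 := hA (i + k)
    simp only [hu]
    rw [← Real.log_mul (by linarith) (by linarith)]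
    exact Real.log_le_log (by linarith) (h.submul i k)
  have hlim : Tendsto (fun k => u k / k) atTop (𝓝 hsub.lim) := by
    apply hsub.tendsto_lim
    refine ⟨0, ?_⟩
    rintro _ ⟨k, rfl⟩
    exact div_nonneg (Real.log_nonneg (hA k)) (Nat.cast_nonneg k)
  set L := hsub.lim
  have hlo : ∀ k, u k ≤ -Real.log (N (k + 2)) := by
    intro k
    have p := hA k
    have := Real.log_le_log (hpos (k + 1)) (Nupper h g hg1 hg0 hder k)
    rw [one_div, Real.log_inv] at this
    simp only [hu]; linarith
  have hhi : ∀ k, -Real.log (N (k + 2)) ≤ u k + Real.log 8 := by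
    intro k
    have p := hA k
    have := Real.log_le_log (by positivity) (Nlower h g hg1 hg0 hder k)
    rw [one_div, Real.log_inv, Real.log_mul (by norm_num) (by linarith)] at this
    simp only [hu]; linarith
  have hkr : Tendsto (fun k : ℕ => (k : ℝ) / ((k : ℝ) + 2)) atTop (𝓝 1) :=
    tendsto_natCast_div_add_atTop 2
  have hc : ∀ c : ℝ, Tendsto (fun k : ℕ => c / ((k : ℝ) + 2)) atTop (𝓝 0) := fun c =>
    (tendsto_const_nhds (x := c)).div_atTop
      (tendsto_atTop_add_const_right atTop 2 tendsto_natCast_atTop_atTop)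
  have hu2 : Tendsto (fun k : ℕ => u k / ((k : ℝ) + 2)) atTop (𝓝 L) := by
    have := hlim.mul hkr
    rw [mul_one] at this
    refine this.congr' ?_
    filter_upwards [eventually_gt_atTop 0] with k hk
    have : (k : ℝ) ≠ 0 := by positivity
    field_simp
  have hmain : Tendsto (fun k : ℕ => -Real.log (N (k + 2)) / ((k : ℝ) + 2)) atTop (𝓝 L) := by
    have hu3 := hu2.add (hc (Real.log 8))
    rw [add_zero] at hu3
    refine tendsto_of_tendsto_of_tendsto_of_le_of_le hu2 hu3 ?_ ?_
    · intro k
      exact div_le_div_of_nonneg_right (hlo k) (by positivity)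
    · intro k
      simp only
      rw [← add_div]
      exact div_le_div_of_nonneg_right (hhi k) (by positivity)
  have hlin : ∀ c : ℝ, Tendsto (fun k : ℕ => ((k : ℝ) + 1) * c / ((k : ℝ) + 2)) atTop (𝓝 c) := by
    intro c
    have := (hkr.mul_const c).add (hc c)
    rw [one_mul, add_zero] at this
    refine this.congr fun k => ?_
    ring
  have hL2 : Real.log 2 ≤ L := by
    refine le_of_tendsto_of_tendsto' (hlin (Real.log 2)) hmain fun k => ?_
    refine div_le_div_of_nonneg_right ?_ (by positivity)
    have := Real.log_le_log (hpos (k + 1)) (hhalf (k + 1))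
    rw [Real.log_pow, one_div, Real.log_inv] at this
    push_cast at this
    linarith
  have hL4 : L ≤ Real.log 4 := by
    refine le_of_tendsto_of_tendsto' hmain (hlin (Real.log 4)) fun k => ?_
    refine div_le_div_of_nonneg_right ?_ (by positivity)
    have := Real.log_le_log (by positivity) (hquart (k + 1))
    rw [Real.log_pow, one_div, Real.log_inv] at this
    push_cast at this
    linarith
  refine ⟨Real.exp L, ?_, ?_, ?_⟩
  · rwa [← Real.log_le_iff_le_exp (by norm_num)]
  · rwa [← Real.le_log_iff_exp_le (by norm_num)]
  · rw [← tendsto_add_atTop_iff_nat 2]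
    refine ((Real.continuous_exp.tendsto L).comp hmain).congr fun k => ?_
    simp only [Function.comp]
    rw [Real.rpow_def_of_pos (hpos (k + 1))]
    push_cast
    congr 1
    ring
end
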